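/- r₂(H) = 3 if and only if n has one of the following forms, where p, p₁, p₂, p₃ denote distinct primes ≡ 1 (mod 4) and q, q₁, q₂, q₃, q₄ distinct primes ≡ 3 (mod 4): (1) n = p₁p₂ with either ((2/p₁) = (2/p₂) = 1 and (2/p_i)₄ ≠ (p_i/2)₄ for at least one i ∈ {1,2}), or ((2/p_i) = −(2/p_j) = −1 and (2/p_j)₄ = (p_j/2)₄ for some ordering {i,j} = {1,2}); (2) n = p₁p₂p₃ with either (2/p_i) = −1 for all i ∈ {1,2,3}, or ((2/p_i) = (2/p_j) = −(2/p_k) = −1 and (2/p_k)₄ ≠ (p_k/2)₄ for some ordering {i,j,k} = {1,2,3}); (3) n = q₁q₂q₃ with exactly one of the symbols (2/q_i), i ∈ {1,2,3}, equal to −1; (4) n = q₁q₂q₃q₄ with at most one of the symbols (2/q_i), i ∈ {1,2,3,4}, equal to 1; (5) n = p₁p₂p₃q with (2/p_i) = −1 for all i ∈ {1,2,3}; (6) n = p·q₁q₂q₃ with (2/p) = −1 and at most one of the symbols (2/q_i), i ∈ {1,2,3}, equal to 1; (7) n = p₁p₂q₁q₂ with (2/p₁) = (2/p₂) = −1 and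 ((2/q₁) = −1 or (2/q₂) = −1); (8) n = p·q₁q₂ with either ((2/p) = 1 and ((2/q₁) = −1 or (2/q₂) = −1)), or ((2/p) = −1 and (2/q₁) = (2/q₂) = 1); (9) n = p₁p₂q with (2/p₁) ≠ (2/p₂). -/

import Mathlib

/-- `ε` is the fundamental unit of the real quadratic field `ℚ(√l)` (viewed inside `ℝ`):
it lies in `ℚ(√l)`, it is a unit of the ring of integers (both `ε` and `ε⁻¹` are
algebraic integers), `ε > 1`, and it is the smallest such unit. -/
def IsFundamentalUnit (l : ℕ) (ε : ℝ) : Prop :=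
  1 < ε ∧ ε ∈ IntermediateField.adjoin ℚ ({Real.sqrt (l : ℝ)} : Set ℝ) ∧
    IsIntegral ℤ ε ∧ IsIntegral ℤ ε⁻¹ ∧
    ∀ x : ℝ, 1 < x → x ∈ IntermediateField.adjoin ℚ ({Real.sqrt (l : ℝ)} : Set ℝ) →
      IsIntegral ℤ x → IsIntegral ℤ x⁻¹ → ε ≤ x

/-- The Legendre symbol `(a/p)`, via Euler's criterion (so that no `Fact p.Prime`
instance is needed): for an odd prime `p` it is `1` if `a` is a nonzero square mod `p`,
`0` if `p ∣ a`, and `-1` otherwise. -/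
def legSym (p : ℕ) (a : ℤ) : ℤ :=
  if (a : ZMod p) ^ ((p - 1) / 2) = 1 then 1 else if (a : ZMod p) = 0 then 0 else -1

/-- The rational fourth power residue symbol `(a/p)₄ ∈ {±1}`, meaningful when
`(a/p) = 1`; it is determined by `(a/p)₄ ≡ a ^ ((p-1)/4) (mod p)`. -/
def quartSym (p : ℕ) (a : ℤ) : ℤ :=
  if (a : ZMod p) ^ ((p - 1) / 4) = 1 then 1 else -1

/-- The cardinality of the 2-torsion subgroup of the class group of `K`.
For a number field `K` this equals `2 ^ r₂(H)`, where `r₂(H)` is the rank of the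
2-class group `H` of `K` (i.e. `dim_{𝔽₂} Cl(K)/Cl(K)²`); in particular
`r₂(H) = r` iff this cardinality is `2 ^ r`. -/
noncomputable def twoTorsCard (K : IntermediateField ℚ ℝ) : ℕ :=
  Nat.card {x : ClassGroup (NumberField.RingOfIntegers K) // x ^ 2 = 1}

section

open scoped nonZeroDivisors

/-- The congruence on a commutative monoid identifying elements that agree up to squares. -/
def sqCon (M : Type*) [CommMonoid M] : Con M where
  r s t := ∃ a b : M, a ^ 2 * s = b ^ 2 * t
  iseqv :=
    { refl := fun s => ⟨1, 1, rfl⟩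
      symm := fun ⟨a, b, h⟩ => ⟨b, a, h.symm⟩
      trans := by
        rintro s t u ⟨a, b, h⟩ ⟨c, d, h'⟩
        refine ⟨c * a, b * d, ?_⟩
        rw [mul_pow, mul_assoc, h, mul_left_comm, h', mul_pow, mul_assoc] }
  mul' := by
    rintro s t u v ⟨a, b, h⟩ ⟨c, d, h'⟩
    refine ⟨a * c, b * d, ?_⟩
    rw [mul_pow, mul_pow, mul_mul_mul_comm, h, h', mul_mul_mul_comm]

/-- The group of classes of a commutative monoid modulo squares. -/
def SqClass (M : Type*) [CommMonoid M] : Type _ := (sqCon M).Quotient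

namespace SqClass

variable {M : Type*} [CommMonoid M]

instance : CommMonoid (SqClass M) := inferInstanceAs (CommMonoid (sqCon M).Quotient)

/-- The class of an element modulo squares. -/
def mk : M →* SqClass M := (sqCon M).mk'

theorem mk_eq_mk {s t : M} : mk s = mk t ↔ ∃ a b : M, a ^ 2 * s = b ^ 2 * t :=
  Con.eq (sqCon M)

theorem mk_surjective : Function.Surjective (mk : M → SqClass M) := Con.mk'_surjective

theorem mk_sq (s : M) : mk (s ^ 2) = 1 := by
  rw [← map_one mk, mk_eq_mk]
  exact ⟨1, s, by simp⟩

theorem mul_self (q : SqClass M) : q * q = 1 := by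
  obtain ⟨s, rfl⟩ := mk_surjective q
  rw [← map_mul, ← sq, mk_sq]

instance : CommGroup (SqClass M) where
  inv q := q
  inv_mul_cancel := mul_self

theorem mk_mul_sq (s t : M) : mk (s * t ^ 2) = mk s := by rw [map_mul, mk_sq, mul_one]

end SqClass

theorem card_subgroup_prod {G H : Type*} [Group G] [Group H] (Γ : Subgroup (G × H)) :
    Nat.card Γ = Nat.card {g : G | ∃ h : H, (g, h) ∈ Γ} * Nat.card {h : H | ((1 : G), h) ∈ Γ} := by
  set f : Γ →* G := (MonoidHom.fst G H).comp Γ.subtype with hf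
  rw [Subgroup.card_eq_card_quotient_mul_card_subgroup f.ker,
    Nat.card_congr (QuotientGroup.quotientKerEquivRange f).toEquiv]
  congr 1
  · refine Nat.card_congr (Equiv.setCongr ?_)
    ext g
    constructor
    · rintro ⟨⟨⟨a, b⟩, h⟩, rfl⟩
      exact ⟨b, h⟩
    · rintro ⟨b, h⟩
      exact ⟨⟨(g, b), h⟩, rfl⟩
  · refine Nat.card_congr
      { toFun := fun x => ⟨x.1.1.2, ?_⟩
        invFun := fun x => ⟨⟨(1, x.1), x.2⟩, rfl⟩
        left_inv := ?_
        right_inv := fun x => rfl }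
    · have h1 : x.1.1.1 = 1 := x.2
      have h2 := x.1.2
      change ((1 : G), x.1.1.2) ∈ Γ
      rw [← h1]
      exact h2
    · rintro ⟨⟨⟨a, b⟩, h⟩, h'⟩
      have : a = 1 := h'
      subst this
      rfl

theorem card_snd_mul_card_fiber {G H : Type*} [Group G] [Group H] (Γ : Subgroup (G × H))
    (hΓ : ∀ h : H, ((1 : G), h) ∈ Γ → h = 1) :
    Nat.card {h : H | ∃ g : G, (g, h) ∈ Γ} * Nat.card {g : G | (g, (1 : H)) ∈ Γ} =
      Nat.card {g : G | ∃ h : H, (g, h) ∈ Γ} := by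
  have h1 := card_subgroup_prod Γ
  have h2 := card_subgroup_prod (Γ.comap (MulEquiv.prodComm : H × G ≃* G × H).toMonoidHom)
  have h3 : Nat.card {h : H | ((1 : G), h) ∈ Γ} = 1 := by
    have : {h : H | ((1 : G), h) ∈ Γ} = {1} := by
      ext h
      exact ⟨hΓ h, fun hh => by rw [Set.mem_singleton_iff.1 hh]; exact Γ.one_mem⟩
    rw [this]
    simp
  have h4 : Nat.card (Γ.comap (MulEquiv.prodComm : H × G ≃* G × H).toMonoidHom) = Nat.card Γ :=
    Nat.card_congr (MulEquiv.comapSubgroup (MulEquiv.prodComm : H × G ≃* G × H) |>.symm.toEquiv |>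
      fun _ => (MulEquiv.prodComm : H × G ≃* G × H).toEquiv.subtypeEquiv fun _ => Iff.rfl)
  rw [h3, mul_one] at h1
  rw [← h1, ← h4, h2]
  rfl

section Selmer

variable {S : Type*} [CommRing S] [IsDedekindDomain S]

theorem Ideal.eq_of_sq_eq_sq {I J : Ideal S} (h : I ^ 2 = J ^ 2) : I = J :=
  (pow_left_injective (M := Ideal S) two_ne_zero) h

/-- Pairs consisting of a square class and an ideal class, such that the square class is
represented by a generator of the square of an ideal in the ideal class. -/
noncomputable def selmerClass (S : Type*) [CommRing S] [IsDedekindDomain S] :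
    Subgroup (SqClass S⁰ × ClassGroup S) where
  carrier := {p | ∃ (s : S⁰) (I : (Ideal S)⁰), SqClass.mk s = p.1 ∧
    Ideal.span {(s : S)} = (I : Ideal S) ^ 2 ∧ ClassGroup.mk0 I = p.2}
  mul_mem' := by
    rintro ⟨q, c⟩ ⟨q', c'⟩ ⟨s, I, rfl, h, rfl⟩ ⟨s', I', rfl, h', rfl⟩
    refine ⟨s * s', I * I', by simp, ?_, by simp⟩
    rw [Submonoid.coe_mul, Submonoid.coe_mul, ← Ideal.span_singleton_mul_span_singleton, h, h',
      mul_pow]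
  one_mem' := ⟨1, 1, by simp, by simp [← Ideal.one_eq_top], by simp⟩
  inv_mem' := by
    rintro ⟨q, c⟩ ⟨s, I, rfl, h, rfl⟩
    refine ⟨s, I, rfl, h, ?_⟩
    symm
    change (ClassGroup.mk0 I)⁻¹ = _
    rw [inv_eq_iff_mul_eq_one, ← map_mul, ClassGroup.mk0_eq_one_iff]
    exact ⟨⟨s, by rw [Submonoid.coe_mul, ← sq, ← h]⟩⟩

theorem card_two_torsion_mul_card_units :
    Nat.card {c : ClassGroup S // c ^ 2 = 1} *
      Nat.card {q : SqClass S⁰ | ∃ s : S⁰, IsUnit (s : S) ∧ SqClass.mk s = q} =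
    Nat.card {q : SqClass S⁰ | ∃ (s : S⁰) (I : Ideal S), SqClass.mk s = q ∧
      Ideal.span {(s : S)} = I ^ 2} := by
  have key := card_snd_mul_card_fiber (selmerClass S) (by
    rintro c ⟨s, I, h1, h2, rfl⟩
    change SqClass.mk s = 1 at h1
    rw [← map_one SqClass.mk, SqClass.mk_eq_mk] at h1
    obtain ⟨a, b, hab⟩ := h1
    have h3 : (Ideal.span {(a : S)} * (I : Ideal S)) = Ideal.span {(b : S)} := by
      apply Ideal.eq_of_sq_eq_sq
      rw [mul_pow, ← h2, Ideal.span_singleton_pow, Ideal.span_singleton_mul_span_singleton,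
        Ideal.span_singleton_pow]
      have := congrArg (Subtype.val) hab
      simp only [Submonoid.coe_mul, SubmonoidClass.coe_pow, mul_one] at this
      rw [this]
    rw [← map_one (ClassGroup.mk0 (R := S)), ClassGroup.mk0_eq_mk0_iff]
    refine ⟨a, b, nonZeroDivisors.coe_ne_zero a, nonZeroDivisors.coe_ne_zero b, ?_⟩
    rw [h3]
    simp)
  convert key using 2
  · refine Nat.card_congr (Equiv.subtypeEquivRight ?_)
    intro c
    constructor
    · intro h
      obtain ⟨I, rfl⟩ := ClassGroup.mk0_surjective c
      rw [← map_pow, ClassGroup.mk0_eq_one_iff] at h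
      obtain ⟨s, hs⟩ := h.principal
      have hs0 : s ≠ 0 := by
        rintro rfl
        apply nonZeroDivisors.coe_ne_zero (I ^ 2)
        rw [hs]
        simp
      exact ⟨SqClass.mk ⟨s, mem_nonZeroDivisors_of_ne_zero hs0⟩, _, I, rfl, by
        rw [← SubmonoidClass.coe_pow, hs], rfl⟩
    · rintro ⟨q, s, I, h1, h2, rfl⟩
      rw [← map_pow, ClassGroup.mk0_eq_one_iff]
      exact ⟨⟨s, by rw [SubmonoidClass.coe_pow, ← h2]⟩⟩
  · refine Nat.card_congr (Equiv.setCongr ?_)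
    ext q
    constructor
    · rintro ⟨s, hs, rfl⟩
      refine ⟨s, 1, rfl, ?_, by simp⟩
      rw [Ideal.span_singleton_eq_top.2 hs]
      simp [← Ideal.one_eq_top]
    · rintro ⟨s, I, rfl, h2, h3⟩
      rw [ClassGroup.mk0_eq_one_iff] at h3
      obtain ⟨x, hx⟩ := h3.principal
      have hx' : (I : Ideal S) = Ideal.span {x} := hx
      rw [hx', Ideal.span_singleton_pow, Ideal.span_singleton_eq_span_singleton] at h2
      obtain ⟨u, hu⟩ := h2
      have hx0 : x ≠ 0 := by
        rintro rfl
        apply nonZeroDivisors.coe_ne_zero s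
        have := hu
        rw [zero_pow two_ne_zero] at this
        exact (Units.mul_left_eq_zero u).1 this
      refine ⟨⟨(u : S), mem_nonZeroDivisors_of_ne_zero u.ne_zero⟩, u.isUnit, ?_⟩
      rw [SqClass.mk_eq_mk]
      refine ⟨s, ⟨x, mem_nonZeroDivisors_of_ne_zero hx0⟩, Subtype.ext ?_⟩
      simp only [Submonoid.coe_mul, SubmonoidClass.coe_pow]
      rw [← hu]
      ring
  · apply congrArg
    ext q
    constructor
    · rintro ⟨s, I, rfl, h⟩
      have hI : I ≠ 0 := by
        rintro rfl
        rw [zero_pow two_ne_zero, Ideal.zero_eq_bot, Ideal.span_singleton_eq_bot] at h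
        exact nonZeroDivisors.coe_ne_zero s h
      exact ⟨_, s, ⟨I, mem_nonZeroDivisors_of_ne_zero hI⟩, rfl, h, rfl⟩
    · rintro ⟨c, s, I, rfl, h, rfl⟩
      exact ⟨s, I, rfl, h⟩

end Selmer

namespace QuadraticAlgebra

variable {R : Type*} [CommRing R] {δ : R}

theorem norm_eq_re_sq_sub (z : QuadraticAlgebra R δ 0) : z.norm = z.re ^ 2 - δ * z.im ^ 2 := by
  rw [norm_def]
  ring

theorem dvd_re_of_dvd_norm {p : R} (hp : Prime p) (h2 : p ∣ 2 → p ∣ δ) {x y c u : R}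
    (h : x ^ 2 - δ * y ^ 2 = u * c ^ 2) (hc : p ∣ c) (hx : p ∣ 2 * x) : p ∣ x := by
  rcases hp.dvd_or_dvd hx with h' | h'
  · refine hp.dvd_of_dvd_pow (n := 2) ?_
    rw [sub_eq_iff_eq_add.1 h]
    exact dvd_add (hc.trans (Dvd.intro_left (u * c) (by ring))) ((h2 h').mul_right _)
  · exact h'

variable [IsDomain R]

theorem dvd_im_of_dvd_re (hδ : Squarefree δ) {p : R} (hp : Prime p) {x y c u : R}
    (h : x ^ 2 - δ * y ^ 2 = u * c ^ 2) (hc : p ∣ c) (hx : p ∣ x) : p ∣ y := by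
  obtain ⟨c, rfl⟩ := hc
  obtain ⟨x, rfl⟩ := hx
  have h1 : p * p ∣ δ * y ^ 2 := ⟨x ^ 2 - u * c ^ 2, by linear_combination -h⟩
  by_contra hy
  obtain ⟨e, he⟩ := (hp.dvd_or_dvd ((dvd_mul_right _ _).trans h1)).resolve_right
    fun h => hy (hp.dvd_of_dvd_pow h)
  have h2 : p ∣ e * y ^ 2 := by
    rw [he, mul_assoc] at h1
    exact (mul_dvd_mul_iff_left hp.ne_zero).1 h1
  obtain ⟨f, rfl⟩ := (hp.dvd_or_dvd h2).resolve_right fun h => hy (hp.dvd_of_dvd_pow h)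
  exact hp.not_isUnit (hδ p ⟨f, by rw [he]; ring⟩)

variable [IsPrincipalIdealRing R]

local notation "𝒮" => QuadraticAlgebra R δ 0

theorem exists_primitive_norm_eq (u : R) {z : 𝒮} {c : R} (hc : c ≠ 0)
    (h : z.norm = u * c ^ 2) : ∃ (z' : 𝒮) (c' : R), c' ≠ 0 ∧ z'.norm = u * c' ^ 2 ∧
      ∃ α β γ : R, α * z'.re + β * z'.im + γ * c' = 1 := by
  obtain ⟨d, hd⟩ := (IsPrincipalIdealRing.principal (Ideal.span {z.re, z.im, c})).principal
  change _ = Ideal.span {d} at hd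
  have hmem : ∀ t ∈ ({z.re, z.im, c} : Set R), d ∣ t := fun t ht =>
    Ideal.mem_span_singleton.1 (hd ▸ Ideal.subset_span ht)
  obtain ⟨x, hx⟩ := hmem z.re (by simp)
  obtain ⟨y, hy⟩ := hmem z.im (by simp)
  obtain ⟨e, he⟩ := hmem c (by simp)
  have hd0 : d ≠ 0 := by
    rintro rfl
    exact hc (by rw [he, zero_mul])
  refine ⟨⟨x, y⟩, e, ?_, ?_, ?_⟩
  · rintro rfl
    exact hc (by rw [he, mul_zero])
  · rw [norm_eq_re_sq_sub] at h ⊢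
    rw [hx, hy, he] at h
    apply mul_left_cancel₀ (pow_ne_zero 2 hd0)
    linear_combination h
  · have h1 : d ∈ Ideal.span {z.re, z.im, c} := hd ▸ Ideal.mem_span_singleton_self d
    rw [Ideal.mem_span_insert] at h1
    obtain ⟨α, t, ht, h1⟩ := h1
    rw [Ideal.mem_span_pair] at ht
    obtain ⟨β, γ, rfl⟩ := ht
    refine ⟨α, β, γ, mul_left_cancel₀ hd0 ?_⟩
    change d * (α * x + β * y + γ * e) = d * 1
    rw [hx, hy, he] at h1
    linear_combination -h1

theorem exists_span_eq_sq_of_norm (hδ : Squarefree δ) (h2 : ∀ p : R, Prime p → p ∣ 2 → p ∣ δ)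
    (u : Rˣ) {z : 𝒮} {c : R} (hc : c ≠ 0) (h : z.norm = u * c ^ 2) (hprim :
      ∃ α β γ : R, α * z.re + β * z.im + γ * c = 1) : ∃ I : Ideal 𝒮, Ideal.span {z} = I ^ 2 := by
  set c' : 𝒮 := algebraMap R 𝒮 c with hc'
  set J : Ideal 𝒮 := Ideal.span {z, star z, c'} with hJ
  have hzJ : z ∈ J := Ideal.subset_span (by simp)
  have hzJ' : star z ∈ J := Ideal.subset_span (by simp)
  have hcJ : c' ∈ J := Ideal.subset_span (by simp)
  have hnorm : z * star z = algebraMap R 𝒮 u * c' ^ 2 := by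
    rw [← algebraMap_norm_eq_mul_star, h, map_mul, map_pow]
  have hJtop : J = ⊤ := by
    by_contra hne
    have hne' : J.comap (algebraMap R 𝒮) ≠ ⊤ := by
      rwa [Ideal.ne_top_iff_one, Ideal.mem_comap, map_one, ← Ideal.ne_top_iff_one]
    obtain ⟨M, hM, hle⟩ := Ideal.exists_le_maximal _ hne'
    obtain ⟨p, hp⟩ := (IsPrincipalIdealRing.principal M).principal
    change M = Ideal.span {p} at hp
    have hmem : ∀ t : R, algebraMap R 𝒮 t ∈ J → p ∣ t := fun t ht =>
      Ideal.mem_span_singleton.1 (hp ▸ hle (Ideal.mem_comap.2 ht))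
    have hpc : p ∣ c := hmem c hcJ
    have hp0 : p ≠ 0 := by
      rintro rfl
      exact hc (zero_dvd_iff.1 hpc)
    have hpp : Prime p := (Ideal.span_singleton_prime hp0).1 (hp ▸ hM.isPrime)
    have hpx : p ∣ 2 * z.re := hmem _ (by
      have : algebraMap R 𝒮 (2 * z.re) = z + star z := by
        ext <;> simp [two_mul]
      rw [this]
      exact J.add_mem hzJ hzJ')
    rw [norm_eq_re_sq_sub] at h
    have hx := dvd_re_of_dvd_norm hpp (h2 p hpp) h hpc hpx
    have hy := dvd_im_of_dvd_re hδ hpp h hpc hx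
    obtain ⟨α, β, γ, h1⟩ := hprim
    apply hpp.not_isUnit
    rw [isUnit_iff_dvd_one, ← h1]
    exact dvd_add (dvd_add (hx.mul_left _) (hy.mul_left _)) (hpc.mul_left _)
  have h1 : (1 : 𝒮) ∈ J := hJtop ▸ Submodule.mem_top
  rw [hJ, Ideal.mem_span_insert] at h1
  obtain ⟨α, t, ht, h1⟩ := h1
  rw [Ideal.mem_span_pair] at ht
  obtain ⟨β, γ, rfl⟩ := ht
  have hcz : c' ^ 2 = z * (star z * algebraMap R 𝒮 ((u⁻¹ : Rˣ) : R)) := by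
    rw [← mul_assoc, hnorm, mul_right_comm, ← map_mul, Units.mul_inv, map_one, one_mul]
  refine ⟨Ideal.span {z, c'}, le_antisymm ?_ ?_⟩
  · rw [Ideal.span_singleton_le_iff_mem, sq]
    have hz : z ∈ Ideal.span {z, c'} := Ideal.subset_span (by simp)
    have hc : c' ∈ Ideal.span {z, c'} := Ideal.subset_span (by simp)
    have : α * (z * z) + β * algebraMap R 𝒮 u * (c' * c') + γ * (z * c') = z := by
      linear_combination -z * h1 - β * hnorm
    have hI := Ideal.add_mem _ (Ideal.add_mem _ (Ideal.mul_mem_left _ α (Ideal.mul_mem_mul hz hz))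
      (Ideal.mul_mem_left _ (β * algebraMap R 𝒮 u) (Ideal.mul_mem_mul hc hc)))
      (Ideal.mul_mem_left _ γ (Ideal.mul_mem_mul hz hc))
    rwa [this] at hI
  · rw [sq, Ideal.span_mul_span', Ideal.span_le]
    rintro _ ⟨a, ha, b, hb, rfl⟩
    simp only [Set.mem_insert_iff, Set.mem_singleton_iff] at ha hb
    simp only [SetLike.mem_coe, Ideal.mem_span_singleton]
    rcases ha with rfl | rfl <;> rcases hb with rfl | rfl
    · exact dvd_mul_right _ _
    · exact dvd_mul_right _ _
    · exact dvd_mul_left _ _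
    · rw [← sq, hcz]
      exact dvd_mul_right _ _

variable [IsDedekindDomain (QuadraticAlgebra R δ 0)]

theorem exists_norm_eq_of_span_eq_sq {s : 𝒮} {I : Ideal 𝒮} (h : Ideal.span {s} = I ^ 2) :
    ∃ (u : Rˣ) (c : R), s.norm = u * c ^ 2 := by
  have h1 := congrArg (Ideal.relNorm R) h
  have hn : Algebra.norm R s = s.norm := by
    rw [Algebra.norm_apply, ← det_toLinearMap_eq_norm]
    rfl
  rw [Ideal.relNorm_singleton, Algebra.intNorm_eq_norm, hn, map_pow] at h1
  obtain ⟨c, hc⟩ := (IsPrincipalIdealRing.principal (Ideal.relNorm R I)).principal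
  change _ = Ideal.span {c} at hc
  rw [hc, Ideal.span_singleton_pow, Ideal.span_singleton_eq_span_singleton] at h1
  obtain ⟨u, hu⟩ := h1.symm
  exact ⟨u, c, by rw [← hu, mul_comm]⟩

theorem span_eq_sq_of_mk_eq {T : Type*} [CommRing T] [IsDedekindDomain T] {s t : T⁰}
    (hst : SqClass.mk s = SqClass.mk t) {I : Ideal T} (h : Ideal.span {(s : T)} = I ^ 2) :
    ∃ J : Ideal T, Ideal.span {(t : T)} = J ^ 2 := by
  obtain ⟨a, b, hab⟩ := SqClass.mk_eq_mk.1 hst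
  have hab' : (a : T) ^ 2 * s = (b : T) ^ 2 * t := congrArg Subtype.val hab
  have h1 : (Ideal.span {(a : T)} * I) ^ 2 = Ideal.span {(b : T)} ^ 2 * Ideal.span {(t : T)} := by
    rw [mul_pow, ← h, Ideal.span_singleton_pow, Ideal.span_singleton_mul_span_singleton,
      Ideal.span_singleton_pow, Ideal.span_singleton_mul_span_singleton, hab']
  have h2 : Ideal.span {(b : T)} ∣ Ideal.span {(a : T)} * I := by
    rw [← UniqueFactorizationMonoid.pow_dvd_pow_iff_dvd two_ne_zero, h1]
    exact dvd_mul_right _ _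
  obtain ⟨J, hJ⟩ := h2
  refine ⟨J, ?_⟩
  rw [hJ, mul_pow] at h1
  refine (mul_left_cancel₀ ?_ h1).symm
  apply pow_ne_zero
  rw [Ne, Ideal.zero_eq_bot, Ideal.span_singleton_eq_bot]
  exact nonZeroDivisors.coe_ne_zero b

end QuadraticAlgebra

namespace QuadraticAlgebra

variable {R : Type*} [CommRing R] [IsDomain R] {δ : R}

local notation "𝒮" => QuadraticAlgebra R δ 0

theorem norm_ne_zero [IsDomain (QuadraticAlgebra R δ 0)] {z : 𝒮} (hz : z ≠ 0) : z.norm ≠ 0 :=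
  nonZeroDivisors.ne_zero (norm_mem_nonZeroDivisors_iff.2 (mem_nonZeroDivisors_of_ne_zero hz))

omit [IsDomain R] in
theorem ne_zero_of_norm_ne_zero {z : 𝒮} (hz : z.norm ≠ 0) : z ≠ 0 := by
  rintro rfl
  exact hz norm_zero

/-- The image in the quadratic algebra of a nonzero element of the base ring. -/
def baseMap (r : R⁰) : 𝒮⁰ := ⟨algebraMap R 𝒮 r, algebraMap_mem_nonZeroDivisors_iff.2 r.2⟩

omit [IsDomain R] in
theorem baseMap_mul (r s : R⁰) : (baseMap (r * s) : 𝒮⁰) = baseMap r * baseMap s :=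
  Subtype.ext (map_mul (algebraMap R 𝒮) _ _)

omit [IsDomain R] in
theorem baseMap_pow (r : R⁰) (n : ℕ) : (baseMap (r ^ n) : 𝒮⁰) = baseMap r ^ n :=
  Subtype.ext (map_pow (algebraMap R 𝒮) _ _)

/-- Square classes of elements generating the square of an ideal, together with the square class
of the norm. -/
def selmerNorm (R : Type*) [CommRing R] [IsDomain R] (δ : R) [IsDedekindDomain (QuadraticAlgebra R δ 0)] :
    Subgroup (SqClass R⁰ × SqClass (QuadraticAlgebra R δ 0)⁰) where
  carrier := {p | ∃ (s : (QuadraticAlgebra R δ 0)⁰) (r : R⁰) (I : Ideal (QuadraticAlgebra R δ 0)),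
    SqClass.mk r = p.1 ∧ SqClass.mk s = p.2 ∧ (s : QuadraticAlgebra R δ 0).norm = r ∧
    Ideal.span {(s : QuadraticAlgebra R δ 0)} = I ^ 2}
  mul_mem' := by
    rintro ⟨q, c⟩ ⟨q', c'⟩ ⟨s, r, I, rfl, rfl, h1, h2⟩ ⟨s', r', I', rfl, rfl, h1', h2'⟩
    refine ⟨s * s', r * r', I * I', by simp, by simp, by simp [h1, h1'], ?_⟩
    rw [Submonoid.coe_mul, ← Ideal.span_singleton_mul_span_singleton, h2, h2', mul_pow]
  one_mem' := ⟨1, 1, 1, by simp, by simp, by simp, by simp [← Ideal.one_eq_top]⟩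
  inv_mem' := fun h => h

variable [IsPrincipalIdealRing R] [IsDedekindDomain (QuadraticAlgebra R δ 0)]

omit [IsPrincipalIdealRing R] in
theorem mk_eq_baseMap_of_norm_sq {s : 𝒮⁰} {e : R} (h : (s : 𝒮).norm = e ^ 2) :
    ∃ r : R⁰, SqClass.mk s = SqClass.mk (baseMap r) := by
  have hs := norm_ne_zero (nonZeroDivisors.coe_ne_zero s)
  have he : e ≠ 0 := by
    rintro rfl
    exact hs (by rw [h]; simp)
  by_cases hy : algebraMap R 𝒮 e + s = 0
  · refine ⟨⟨-e, mem_nonZeroDivisors_of_ne_zero (neg_ne_zero.2 he)⟩, congrArg _ (Subtype.ext ?_)⟩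
    change (s : 𝒮) = algebraMap R 𝒮 (-e)
    rw [map_neg]
    linear_combination hy
  · set y := algebraMap R 𝒮 e + s with hy'
    have hn := norm_ne_zero hy
    refine ⟨⟨e * y.norm, mem_nonZeroDivisors_of_ne_zero (mul_ne_zero he hn)⟩,
      SqClass.mk_eq_mk.2 ⟨baseMap ⟨y.norm, mem_nonZeroDivisors_of_ne_zero hn⟩,
        ⟨y, mem_nonZeroDivisors_of_ne_zero hy⟩, Subtype.ext ?_⟩⟩
    change algebraMap R 𝒮 y.norm ^ 2 * s = y ^ 2 * algebraMap R 𝒮 (e * y.norm)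
    have h1 : (s : 𝒮) * star (s : 𝒮) = algebraMap R 𝒮 e ^ 2 := by
      rw [← algebraMap_norm_eq_mul_star, h, map_pow]
    have h2 : y ^ 2 * algebraMap R 𝒮 e = s * algebraMap R 𝒮 y.norm := by
      have h3 : star (algebraMap R 𝒮 e) = algebraMap R 𝒮 e := by
        ext <;> simp
      rw [algebraMap_norm_eq_mul_star, hy', star_add, h3]
      linear_combination -(algebraMap R 𝒮 e + s) * h1
    rw [map_mul]
    linear_combination -(algebraMap R 𝒮 y.norm) * h2

theorem card_selmerNorm (hδ : Squarefree δ) (h2 : ∀ p : R, Prime p → p ∣ 2 → p ∣ δ) :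
    Nat.card {r : SqClass R⁰ | ∃ (u : R⁰) (z : 𝒮) (c : R), IsUnit (u : R) ∧ SqClass.mk u = r ∧
        c ≠ 0 ∧ z.norm = u * c ^ 2} *
      Nat.card {q : SqClass 𝒮⁰ | ∃ (r : R⁰) (J : Ideal 𝒮), SqClass.mk (baseMap r) = q ∧
        Ideal.span {algebraMap R 𝒮 r} = J ^ 2} =
    Nat.card {q : SqClass 𝒮⁰ | ∃ (s : 𝒮⁰) (I : Ideal 𝒮), SqClass.mk s = q ∧
      Ideal.span {(s : 𝒮)} = I ^ 2} := by
  have key := card_snd_mul_card_fiber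
    ((selmerNorm R δ).comap (MulEquiv.prodComm : SqClass 𝒮⁰ × SqClass R⁰ ≃* _).toMonoidHom) (by
    rintro q ⟨s, r, I, rfl, h1, h2, h3⟩
    change SqClass.mk s = 1 at h1
    rw [← map_one SqClass.mk, SqClass.mk_eq_mk] at h1 ⊢
    obtain ⟨a, b, hab⟩ := h1
    refine ⟨⟨_, norm_mem_nonZeroDivisors_iff.2 a.2⟩, ⟨_, norm_mem_nonZeroDivisors_iff.2 b.2⟩,
      Subtype.ext ?_⟩
    have := congrArg norm (congrArg Subtype.val hab)
    simpa [h2] using this)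
  convert key using 2
  · refine congrArg (fun A : Set _ => Nat.card A) ?_
    ext r
    constructor
    · rintro ⟨u, z, c, hu, rfl, hc, h⟩
      obtain ⟨z', c', hc', h', hprim⟩ := exists_primitive_norm_eq _ hc h
      obtain ⟨I, hI⟩ := exists_span_eq_sq_of_norm hδ h2 hu.unit hc' h' hprim
      have hn : z'.norm ≠ 0 := by
        rw [h']
        exact mul_ne_zero hu.ne_zero (pow_ne_zero 2 hc')
      refine ⟨_, ⟨z', mem_nonZeroDivisors_of_ne_zero (ne_zero_of_norm_ne_zero hn)⟩,
        ⟨z'.norm, mem_nonZeroDivisors_of_ne_zero hn⟩, I, ?_, rfl, rfl, hI⟩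
      refine SqClass.mk_eq_mk.2 ⟨1, ⟨c', mem_nonZeroDivisors_of_ne_zero hc'⟩, Subtype.ext ?_⟩
      change 1 ^ 2 * z'.norm = c' ^ 2 * u
      rw [h']
      ring
    · rintro ⟨q, s, r', I, rfl, h1, h2, h3⟩
      obtain ⟨u, c, hc⟩ := exists_norm_eq_of_span_eq_sq h3
      have hc0 : c ≠ 0 := by
        rintro rfl
        exact norm_ne_zero (nonZeroDivisors.coe_ne_zero s) (by rw [hc]; simp)
      refine ⟨⟨u, mem_nonZeroDivisors_of_ne_zero u.ne_zero⟩, s, c, u.isUnit, ?_, hc0, hc⟩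
      refine SqClass.mk_eq_mk.2 ⟨⟨c, mem_nonZeroDivisors_of_ne_zero hc0⟩, 1, Subtype.ext ?_⟩
      change c ^ 2 * u = 1 ^ 2 * r'
      rw [← h2, hc]
      ring
  · refine congrArg (fun A : Set _ => Nat.card A) ?_
    ext q
    constructor
    · rintro ⟨r, J, rfl, h⟩
      refine ⟨baseMap r, r ^ 2, J, ?_, rfl, ?_, h⟩
      · exact SqClass.mk_sq r
      · exact norm_algebraMap _
    · rintro ⟨s, r, I, h1, rfl, h3, h4⟩
      change SqClass.mk r = 1 at h1
      rw [← map_one SqClass.mk, SqClass.mk_eq_mk] at h1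
      obtain ⟨a, b, hab⟩ := h1
      have hab' : (a : R) ^ 2 * r = b ^ 2 := by
        simpa using congrArg Subtype.val hab
      obtain ⟨e, he⟩ := (IsIntegrallyClosed.pow_dvd_pow_iff two_ne_zero).1 (Dvd.intro _ hab')
      obtain ⟨r', hr'⟩ := mk_eq_baseMap_of_norm_sq (s := s) (e := e) (by
        rw [h3]
        refine mul_left_cancel₀ (pow_ne_zero 2 (nonZeroDivisors.coe_ne_zero a)) ?_
        rw [hab', he]
        ring)
      obtain ⟨J, hJ⟩ := span_eq_sq_of_mk_eq hr' h4
      exact ⟨r', J, hr'.symm, hJ⟩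
  · apply congrArg
    ext q
    constructor
    · rintro ⟨s, I, rfl, h⟩
      exact ⟨_, s, ⟨_, norm_mem_nonZeroDivisors_iff.2 s.2⟩, I, rfl, rfl, rfl, h⟩
    · rintro ⟨r, s, r', I, -, rfl, h1, h2⟩
      exact ⟨s, I, rfl, h2⟩

end QuadraticAlgebra

theorem Prime.not_mul_sq_eq_mul_sq {R : Type*} [CommRing R] [IsDomain R] [IsNoetherianRing R]
    {p a b x y : R} (hp : Prime p) (ha : ¬p ∣ a) (hb : ¬p ∣ b) (hx : x ≠ 0) (hy : y ≠ 0) :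
    a * x ^ 2 ≠ p * b * y ^ 2 := by
  intro h
  have h1 := congrArg (emultiplicity p) h
  have fx := FiniteMultiplicity.of_prime_left hp hx
  have fy := FiniteMultiplicity.of_prime_left hp hy
  rw [emultiplicity_mul hp, emultiplicity_mul hp, emultiplicity_mul hp, emultiplicity_pow hp,
    emultiplicity_pow hp, emultiplicity_eq_zero.2 ha, emultiplicity_eq_zero.2 hb,
    (FiniteMultiplicity.of_prime_left hp hp.ne_zero).emultiplicity_self,
    fx.emultiplicity_eq_multiplicity, fy.emultiplicity_eq_multiplicity] at h1
  norm_cast at h1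
  omega

namespace QuadraticAlgebra

variable {R : Type*} [CommRing R] [IsDomain R] [IsPrincipalIdealRing R] {δ : R}

local notation "𝒮" => QuadraticAlgebra R δ 0

theorem exists_span_eq_sq_of_dvd (hδ : Squarefree δ) {d : R} (hd : d ∣ δ) :
    ∃ J : Ideal 𝒮, Ideal.span {algebraMap R 𝒮 d} = J ^ 2 := by
  obtain ⟨e, he⟩ := hd
  obtain ⟨α, β, h1⟩ := (squarefree_mul_iff.1 (he ▸ hδ)).1.isCoprime
  set d' := algebraMap R 𝒮 d
  set e' := algebraMap R 𝒮 e
  have h1' : algebraMap R 𝒮 α * d' + algebraMap R 𝒮 β * e' = 1 := by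
    rw [← map_mul, ← map_mul, ← map_add, h1, map_one]
  have hω : (omega : 𝒮) * omega = d' * e' := by
    rw [omega_mul_omega_eq_algebraMap, map_zero, zero_mul, add_zero, ← map_mul]
    exact congrArg _ he
  refine ⟨Ideal.span {d', omega}, le_antisymm ?_ ?_⟩
  · rw [Ideal.span_singleton_le_iff_mem, sq]
    have hz : d' ∈ Ideal.span {d', omega} := Ideal.subset_span (by simp)
    have hc : (omega : 𝒮) ∈ Ideal.span {d', omega} := Ideal.subset_span (by simp)
    have : algebraMap R 𝒮 α * (d' * d') + algebraMap R 𝒮 β * (omega * omega) = d' := by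
      rw [hω]
      linear_combination d' * h1'
    have hI := Ideal.add_mem _ (Ideal.mul_mem_left _ (algebraMap R 𝒮 α) (Ideal.mul_mem_mul hz hz))
      (Ideal.mul_mem_left _ (algebraMap R 𝒮 β) (Ideal.mul_mem_mul hc hc))
    rwa [this] at hI
  · rw [sq, Ideal.span_mul_span', Ideal.span_le]
    rintro _ ⟨a, ha, b, hb, rfl⟩
    simp only [Set.mem_insert_iff, Set.mem_singleton_iff] at ha hb
    simp only [SetLike.mem_coe, Ideal.mem_span_singleton]
    rcases ha with rfl | rfl <;> rcases hb with rfl | rfl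
    · exact dvd_mul_right _ _
    · exact dvd_mul_right _ _
    · exact dvd_mul_left _ _
    · rw [hω]
      exact dvd_mul_right _ _

omit [IsDomain R] [IsPrincipalIdealRing R] in
theorem dvd_of_span_eq_sq (h2 : ∀ p : R, Prime p → p ∣ 2 → p ∣ δ) {r : R} (hr : Squarefree r)
    {J : Ideal 𝒮} (hJ : Ideal.span {algebraMap R 𝒮 r} = J ^ 2) {p : R} (hp : Prime p)
    (hpr : p ∣ r) : p ∣ δ := by
  by_contra hpδ
  have hle : J ≤ Ideal.span {algebraMap R 𝒮 p} := by
    intro z hz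
    have h1 : z * z ∈ Ideal.span {algebraMap R 𝒮 r} := by
      rw [hJ, sq]
      exact Ideal.mul_mem_mul hz hz
    rw [Ideal.mem_span_singleton] at h1 ⊢
    rw [algebraMap_dvd_iff] at h1 ⊢
    simp only [re_mul, im_mul, zero_mul, add_zero] at h1
    have hxy : p ∣ z.re * z.im := by
      refine (hp.dvd_or_dvd (a := 2) ?_).resolve_left fun h => hpδ (h2 p hp h)
      convert hpr.trans h1.2 using 1
      ring
    have hsum := hpr.trans h1.1
    rcases hp.dvd_or_dvd hxy with h | h
    · refine ⟨h, ?_⟩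
      rw [dvd_add_right (h.mul_right _), mul_assoc] at hsum
      have := (hp.dvd_or_dvd hsum).resolve_left hpδ
      exact (hp.dvd_or_dvd this).elim id id
    · refine ⟨?_, h⟩
      rw [dvd_add_left (h.mul_left _)] at hsum
      exact (hp.dvd_or_dvd hsum).elim id id
  have h3 : Ideal.span {algebraMap R 𝒮 r} ≤ Ideal.span {algebraMap R 𝒮 (p * p)} := by
    rw [hJ, map_mul, ← Ideal.span_singleton_mul_span_singleton, sq]
    exact Ideal.mul_mono hle hle
  rw [Ideal.span_singleton_le_span_singleton, algebraMap_dvd_iff_dvd] at h3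
  exact hp.not_isUnit (hr p h3)

theorem exists_squarefree_mk_eq (r : R⁰) :
    ∃ d : R⁰, Squarefree (d : R) ∧ SqClass.mk r = SqClass.mk d := by
  obtain ⟨r, hr⟩ := r
  revert hr
  refine wellFounded_dvdNotUnit.induction (C := fun r : R => ∀ hr : r ∈ R⁰, ∃ d : R⁰,
    Squarefree (d : R) ∧ SqClass.mk (⟨r, hr⟩ : R⁰) = SqClass.mk d) r ?_
  · intro r ih hr
    by_cases h : Squarefree r
    · exact ⟨⟨r, hr⟩, h, rfl⟩
    · simp only [Squarefree, not_forall] at h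
      obtain ⟨x, ⟨y, rfl⟩, hx⟩ := h
      have h0 := nonZeroDivisors.ne_zero hr
      have hx0 : x ≠ 0 := by
        rintro rfl
        simp at h0
      have hy0 : y ≠ 0 := right_ne_zero_of_mul h0
      obtain ⟨d, hd, h1⟩ := ih y ⟨hy0, x * x, fun h => hx (isUnit_of_mul_isUnit_left h),
        mul_comm _ _⟩ (mem_nonZeroDivisors_of_ne_zero hy0)
      refine ⟨d, hd, Eq.trans ?_ h1⟩
      refine SqClass.mk_eq_mk.2 ⟨1, ⟨x, mem_nonZeroDivisors_of_ne_zero hx0⟩, Subtype.ext ?_⟩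
      change 1 ^ 2 * (x * x * y) = x ^ 2 * y
      ring

omit [IsPrincipalIdealRing R] in
theorem mk_baseMap_eq (hδ0 : δ ∈ R⁰) {r s : R⁰} (h : ∃ a b : R⁰, (a : R) ^ 2 * r = b ^ 2 * s ∨
      (a : R) ^ 2 * r = b ^ 2 * s * δ) :
    (SqClass.mk (baseMap r) : SqClass 𝒮⁰) = SqClass.mk (baseMap s) := by
  obtain ⟨a, b, h | h⟩ := h
  · refine SqClass.mk_eq_mk.2 ⟨baseMap a, baseMap b, ?_⟩
    rw [← baseMap_pow, ← baseMap_mul, ← baseMap_pow, ← baseMap_mul]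
    exact congrArg _ (Subtype.ext h)
  · have hω : (omega : 𝒮) ^ 2 = algebraMap R 𝒮 δ := by
      rw [sq, omega_mul_omega_eq_algebraMap, map_zero, zero_mul, add_zero]
    have hω0 : (omega : 𝒮) ∈ 𝒮⁰ := by
      rw [← norm_mem_nonZeroDivisors_iff]
      simpa [norm_eq_re_sq_sub] using hδ0
    refine SqClass.mk_eq_mk.2 ⟨baseMap a, baseMap b * ⟨omega, hω0⟩, ?_⟩
    rw [mul_pow, ← baseMap_pow, ← baseMap_mul, ← baseMap_pow]
    refine Subtype.ext ?_
    change algebraMap R 𝒮 (a ^ 2 * r) = algebraMap R 𝒮 (b ^ 2) * omega ^ 2 * algebraMap R 𝒮 s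
    rw [hω, h, ← map_mul, ← map_mul]
    congr 1
    ring

end QuadraticAlgebra

namespace QuadraticAlgebra

variable {R : Type*} [CommRing R] [IsDomain R] [IsPrincipalIdealRing R] {δ : R}

local notation "𝒮" => QuadraticAlgebra R δ 0

theorem not_dvd_of_squarefree_mul {M : Type*} [CommMonoid M] {p a b : M} (h : Squarefree (a * b))
    (hp : ¬IsUnit p) (hpa : p ∣ a) : ¬p ∣ b := fun hb => hp (h p (mul_dvd_mul hpa hb))

theorem eq_unit_mul_prod {P : Finset R} (hPp : ∀ p ∈ P, Prime p) {π₀ : R} (hπ₀ : Prime π₀) (u₀ : Rˣ)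
    (hδ : Squarefree (u₀ * π₀ * ∏ p ∈ P, p)) {d : R} (hd : Squarefree d)
    (hdvd : ∀ p, Prime p → p ∣ d → p ∣ u₀ * π₀ * ∏ p ∈ P, p) :
    ∃ s ⊆ P, ∃ u : Rˣ, d = u * ∏ p ∈ s, p ∨ d = u * π₀ * ∏ p ∈ s, p := by
  classical
  have hsd : ∏ p ∈ P.filter (· ∣ d), p ∣ d := by
    refine Finset.prod_dvd_of_coprime ?_ fun p hp => (Finset.mem_filter.1 hp).2
    intro p hp q hq hpq
    have hp' := Finset.mem_filter.1 hp
    have hq' := Finset.mem_filter.1 hq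
    refine (hPp p hp'.1).irreducible.isRelPrime_iff_not_dvd.2 ?_ |>.isCoprime
    intro hdvd
    rw [← Finset.mul_prod_erase _ _ hp'.1, ← mul_assoc] at hδ
    exact not_dvd_of_squarefree_mul hδ (hPp p hp'.1).not_isUnit (dvd_mul_left p _)
      (hdvd.trans (Finset.dvd_prod_of_mem _ (Finset.mem_erase.2 ⟨hpq.symm, hq'.1⟩)))
  obtain ⟨t, ht⟩ := hsd
  have hd0 : d ≠ 0 := hd.ne_zero
  have htne : t ≠ 0 := by
    rintro rfl
    exact hd0 (by rw [ht, mul_zero])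
  have hprime : ∀ p, Prime p → p ∣ t → Associated p π₀ := by
    intro p hp hpt
    have hps : ¬p ∣ ∏ p ∈ P.filter (· ∣ d), p := fun h =>
      not_dvd_of_squarefree_mul (ht ▸ hd) hp.not_isUnit h hpt
    have hpd : p ∣ d := ht ▸ hpt.mul_left _
    rcases hp.dvd_or_dvd (hdvd p hp hpd) with h | h
    · rcases hp.dvd_or_dvd h with h | h
      · exact absurd (isUnit_of_dvd_unit h u₀.isUnit) hp.not_isUnit
      · exact hp.associated_of_dvd hπ₀ h
    · obtain ⟨q, hq, hpq⟩ := (hp.dvd_finsetProd_iff _).1 h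
      have hqd : q ∈ P.filter (· ∣ d) := Finset.mem_filter.2
        ⟨hq, (hp.associated_of_dvd (hPp q hq) hpq).symm.dvd.trans hpd⟩
      exact absurd (hpq.trans (Finset.dvd_prod_of_mem _ hqd)) hps
  have hunit : ∀ t' : R, t' ≠ 0 → t' ∣ t → ¬π₀ ∣ t' → IsUnit t' := by
    intro t' h0 ht' hπ
    by_contra hu
    obtain ⟨p, hp, hpt⟩ := WfDvdMonoid.exists_irreducible_factor hu h0
    exact hπ ((hprime p hp.prime (hpt.trans ht')).symm.dvd.trans hpt)
  refine ⟨P.filter (· ∣ d), Finset.filter_subset _ _, ?_⟩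
  by_cases hπt : π₀ ∣ t
  · obtain ⟨t', rfl⟩ := hπt
    have h1 : ¬π₀ ∣ t' := by
      rw [ht, ← mul_assoc] at hd
      exact not_dvd_of_squarefree_mul hd hπ₀.not_isUnit (dvd_mul_left _ _)
    obtain ⟨u, rfl⟩ := hunit t' (right_ne_zero_of_mul htne) (dvd_mul_left _ _) h1
    exact ⟨u, Or.inr (ht.trans (by ring))⟩
  · obtain ⟨u, rfl⟩ := hunit t htne dvd_rfl hπt
    exact ⟨u, Or.inl (ht.trans (mul_comm _ _))⟩

variable [IsDedekindDomain (QuadraticAlgebra R δ 0)]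

omit [IsPrincipalIdealRing R] in
theorem mk_baseMap_eq_mk_baseMap {r s : R⁰} (h20 : (2 : R) ≠ 0)
    (h : (SqClass.mk (baseMap r) : SqClass 𝒮⁰) = SqClass.mk (baseMap s)) :
    ∃ n x : R, n ≠ 0 ∧ x ≠ 0 ∧ (r * s * n ^ 2 = x ^ 2 ∨ r * s * n ^ 2 = δ * x ^ 2) := by
  obtain ⟨a, b, hab⟩ := SqClass.mk_eq_mk.1 h
  have hab' : (a : 𝒮) ^ 2 * algebraMap R 𝒮 r = (b : 𝒮) ^ 2 * algebraMap R 𝒮 s :=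
    congrArg Subtype.val hab
  have hn := norm_ne_zero (nonZeroDivisors.coe_ne_zero a)
  set n := (a : 𝒮).norm with hn'
  set z : 𝒮 := star (a : 𝒮) * b * algebraMap R 𝒮 s with hz
  have hzz : z * z = algebraMap R 𝒮 (r * s * n ^ 2) := by
    rw [map_mul, map_mul, map_pow, hn', algebraMap_norm_eq_mul_star, hz]
    linear_combination -(star (a : 𝒮)) ^ 2 * algebraMap R 𝒮 s * hab'
  have hre := congrArg re hzz
  have him := congrArg im hzz
  simp only [re_mul, im_mul, zero_mul, add_zero, algebraMap_re, algebraMap_im] at hre him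
  have hne : (r : R) * s * n ^ 2 ≠ 0 := mul_ne_zero (mul_ne_zero (nonZeroDivisors.coe_ne_zero r)
    (nonZeroDivisors.coe_ne_zero s)) (pow_ne_zero 2 hn)
  have hxy : 2 * (z.re * z.im) = 0 := by linear_combination him
  rcases mul_eq_zero.1 ((mul_eq_zero.1 hxy).resolve_left h20) with h0 | h0
  · rw [h0] at hre
    have : (r : R) * s * n ^ 2 = δ * z.im ^ 2 := by linear_combination -hre
    refine ⟨n, z.im, hn, ?_, Or.inr this⟩
    intro h1
    exact hne (by rw [this, h1]; ring)
  · rw [h0] at hre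
    have : (r : R) * s * n ^ 2 = z.re ^ 2 := by linear_combination -hre
    refine ⟨n, z.re, hn, ?_, Or.inl this⟩
    intro h1
    exact hne (by rw [this, h1]; ring)

theorem card_base_squares (hδ : Squarefree δ) (h2 : ∀ p : R, Prime p → p ∣ 2 → p ∣ δ)
    (h20 : (2 : R) ≠ 0) {V : Finset Rˣ} (hV : ∀ u : Rˣ, ∃ v ∈ V, ∃ w : Rˣ, u = v * w ^ 2)
    (hV' : ∀ v ∈ V, ∀ v' ∈ V, IsSquare (v * v') → v = v') {P : Finset R}
    (hPp : ∀ p ∈ P, Prime p) {π₀ : R} (hπ₀ : Prime π₀) (u₀ : Rˣ)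
    (hprod : δ = u₀ * π₀ * ∏ p ∈ P, p) :
    Nat.card {q : SqClass 𝒮⁰ | ∃ (r : R⁰) (J : Ideal 𝒮), SqClass.mk (baseMap r) = q ∧
        Ideal.span {algebraMap R 𝒮 r} = J ^ 2} = V.card * 2 ^ P.card := by
  classical
  have hdvd : ∀ (v : Rˣ) (s : Finset R), s ⊆ P → (v : R) * ∏ p ∈ s, p ∣ δ := by
    intro v s hs
    rw [hprod, ← Finset.prod_sdiff hs]
    exact ⟨(v⁻¹ : Rˣ) * u₀ * π₀ * ∏ p ∈ P \ s, p, by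
      linear_combination (-(u₀ : R) * π₀ * (∏ p ∈ P \ s, p) * ∏ p ∈ s, p) * v.mul_inv⟩
  have hmem : ∀ (v : Rˣ) (s : Finset R), s ⊆ P → (v : R) * ∏ p ∈ s, p ∈ R⁰ := fun v s hs =>
    mem_nonZeroDivisors_of_ne_zero (ne_zero_of_dvd_ne_zero hδ.ne_zero (hdvd v s hs))
  set D : Rˣ × Finset R → R⁰ := fun x =>
    if h : (x.1 : R) * ∏ p ∈ x.2, p ∈ R⁰ then ⟨_, h⟩ else 1 with hD
  have hDval : ∀ (v : Rˣ) (s : Finset R), s ⊆ P → ((D (v, s) : R⁰) : R) = v * ∏ p ∈ s, p := by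
    intro v s hs
    rw [hD]
    simp only [hmem v s hs, dif_pos]
  have hset : {q : SqClass 𝒮⁰ | ∃ (r : R⁰) (J : Ideal 𝒮), SqClass.mk (baseMap r) = q ∧
        Ideal.span {algebraMap R 𝒮 r} = J ^ 2} =
      ((V ×ˢ P.powerset).image fun x => SqClass.mk (baseMap (D x)) : Finset (SqClass 𝒮⁰)) := by
    ext q
    simp only [Set.mem_ofPred_eq, Finset.coe_image, Set.mem_image, Finset.mem_coe,
      Finset.mem_product, Finset.mem_powerset, Prod.exists]
    constructor
    · rintro ⟨r, J, rfl, hJ⟩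
      obtain ⟨d, hd, hrd⟩ := exists_squarefree_mk_eq r
      have hrd' : (SqClass.mk (baseMap r) : SqClass 𝒮⁰) = SqClass.mk (baseMap d) := by
        obtain ⟨a, b, hab⟩ := SqClass.mk_eq_mk.1 hrd
        exact mk_baseMap_eq (mem_nonZeroDivisors_of_ne_zero hδ.ne_zero)
          ⟨a, b, Or.inl (congrArg Subtype.val hab)⟩
      obtain ⟨J', hJ'⟩ := span_eq_sq_of_mk_eq hrd' hJ
      obtain ⟨s, hs, u, hu⟩ := eq_unit_mul_prod hPp hπ₀ u₀ (hprod ▸ hδ) hd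
        fun p hp hpd => hprod ▸ dvd_of_span_eq_sq h2 hd hJ' hp hpd
      rcases hu with hu | hu
      · obtain ⟨v, hv, w, rfl⟩ := hV u
        refine ⟨v, s, ⟨hv, hs⟩, ?_⟩
        rw [hrd']
        refine mk_baseMap_eq (mem_nonZeroDivisors_of_ne_zero hδ.ne_zero)
          ⟨⟨w, mem_nonZeroDivisors_of_ne_zero w.ne_zero⟩, 1, Or.inl ?_⟩
        rw [hDval v s hs, hu]
        push_cast
        ring
      · obtain ⟨v, hv, w, hw⟩ := hV (u * u₀)
        have hw' : (u : R) * u₀ = v * w ^ 2 := by exact_mod_cast congrArg Units.val hw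
        refine ⟨v, P \ s, ⟨hv, Finset.sdiff_subset⟩, ?_⟩
        have hs0 : π₀ * ∏ p ∈ s, p ≠ 0 := by
          intro h0
          apply hd.ne_zero
          rw [hu, mul_assoc, h0, mul_zero]
        rw [hrd']
        refine mk_baseMap_eq (mem_nonZeroDivisors_of_ne_zero hδ.ne_zero)
          ⟨⟨π₀ * ∏ p ∈ s, p, mem_nonZeroDivisors_of_ne_zero hs0⟩,
            ⟨(w⁻¹ : Rˣ), mem_nonZeroDivisors_of_ne_zero (w⁻¹).ne_zero⟩, Or.inr ?_⟩
        rw [hDval v _ Finset.sdiff_subset, hu]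
        have hw1 : (v : R) = ((w⁻¹ : Rˣ) : R) ^ 2 * (u * u₀) := by
          rw [hw', mul_left_comm, ← mul_pow, Units.inv_mul, one_pow, mul_one]
        have hPs : ∏ p ∈ P, p = (∏ p ∈ P \ s, p) * ∏ p ∈ s, p := (Finset.prod_sdiff hs).symm
        change (π₀ * ∏ p ∈ s, p) ^ 2 * (v * ∏ p ∈ P \ s, p) =
          ((w⁻¹ : Rˣ) : R) ^ 2 * (u * π₀ * ∏ p ∈ s, p) * δ
        rw [hw1]
        linear_combination (-((w⁻¹ : Rˣ) : R) ^ 2 * (u * π₀ * ∏ p ∈ s, p)) *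
          hprod.trans (congrArg (fun t => (u₀ : R) * π₀ * t) hPs)
    · rintro ⟨v, s, ⟨hv, hs⟩, rfl⟩
      obtain ⟨J, hJ⟩ := exists_span_eq_sq_of_dvd hδ (hdvd v s hs)
      exact ⟨_, J, rfl, by rw [hDval v s hs, hJ]⟩
  rw [hset, Nat.card_coe_set_eq, Set.ncard_coe_finset, Finset.card_image_of_injOn,
    Finset.card_product, Finset.card_powerset]
  rintro ⟨v, s⟩ hvs ⟨v', s'⟩ hvs' heq
  simp only [Finset.coe_product, Set.mem_prod, Finset.mem_coe, Finset.mem_powerset] at hvs hvs'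
  obtain ⟨n, x, hn, hx, h⟩ := mk_baseMap_eq_mk_baseMap h20 heq
  rw [hDval v s hvs.2, hDval v' s' hvs'.2] at h
  have hsq : Squarefree (↑u₀ * π₀ * ∏ p ∈ P, p) := hprod ▸ hδ
  have hnd : ∀ p ∈ P, ∀ t ⊆ P, p ∉ t → ¬p ∣ ∏ p ∈ t, p := by
    intro p hp t ht hpt hdvd
    rw [← Finset.mul_prod_erase _ _ hp, ← mul_assoc] at hsq
    exact not_dvd_of_squarefree_mul hsq (hPp p hp).not_isUnit (dvd_mul_left p _)
      (hdvd.trans (Finset.prod_dvd_prod_of_subset _ _ _ fun q hq =>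
        Finset.mem_erase.2 ⟨fun h => hpt (h ▸ hq), ht hq⟩))
  have hπnd : ∀ t ⊆ P, ¬π₀ ∣ ∏ p ∈ t, p := fun t ht hdvd =>
    not_dvd_of_squarefree_mul hsq hπ₀.not_isUnit (dvd_mul_left _ _)
      (hdvd.trans (Finset.prod_dvd_prod_of_subset _ _ _ ht))
  have hu : ∀ (u : Rˣ) (p t : R), p ∣ u * t → p ∣ t := fun u p t h => u.isUnit.dvd_mul_left.1 h
  have key : ∀ (v v' : Rˣ) (s s' : Finset R), s ⊆ P → s' ⊆ P → ∀ n x : R, n ≠ 0 → x ≠ 0 →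
      (v * ∏ p ∈ s, p) * (v' * ∏ p ∈ s', p) * n ^ 2 = x ^ 2 → s ⊆ s' := by
    intro v v' s s' hs hs' n x hn hx h p hp
    by_contra hps
    refine (hPp p (hs hp)).not_mul_sq_eq_mul_sq (a := 1) (b := v * (∏ p ∈ s.erase p, p) *
      (v' * ∏ p ∈ s', p)) (x := x) (y := n) ?_ ?_ hx hn ?_
    · exact fun h => (hPp p (hs hp)).not_isUnit (isUnit_of_dvd_one h)
    · intro h
      rcases (hPp p (hs hp)).dvd_or_dvd h with h | h
      · exact hnd p (hs hp) _ ((Finset.erase_subset _ _).trans hs) (Finset.notMem_erase _ _)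
          (hu _ _ _ h)
      · exact hnd p (hs hp) _ hs' hps (hu _ _ _ h)
    · rw [one_mul, ← h, ← Finset.mul_prod_erase _ _ hp]
      ring
  rcases h with h | h
  · obtain rfl : s = s' := (key v v' s s' hvs.2 hvs'.2 n x hn hx h).antisymm
      (key v' v s' s hvs'.2 hvs.2 n x hn hx (by rw [← h]; ring))
    have h3 : (∏ p ∈ s, p) * n ∣ x := by
      rw [← IsIntegrallyClosed.pow_dvd_pow_iff two_ne_zero, ← h]
      exact ⟨v * v', by ring⟩
    obtain ⟨t, rfl⟩ := h3
    have h4 : ((v * v' : Rˣ) : R) = t * t := by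
      have : (∏ p ∈ s, p) * n ≠ 0 := left_ne_zero_of_mul hx
      apply mul_left_cancel₀ (pow_ne_zero 2 this)
      push_cast
      linear_combination h
    have ht : IsUnit t := isUnit_of_mul_isUnit_left (h4 ▸ (v * v').isUnit)
    rw [hV' v hvs.1 v' hvs'.1 ⟨ht.unit, Units.ext h4⟩]
  · exfalso
    refine hπ₀.not_mul_sq_eq_mul_sq (a := (v * ∏ p ∈ s, p) * (v' * ∏ p ∈ s', p)) (x := n)
      (b := u₀ * ∏ p ∈ P, p) (y := x) ?_ ?_ hn hx ?_
    · intro h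
      rcases hπ₀.dvd_or_dvd h with h | h
      · exact hπnd _ hvs.2 (hu _ _ _ h)
      · exact hπnd _ hvs'.2 (hu _ _ _ h)
    · exact fun h => hπnd _ subset_rfl (hu _ _ _ h)
    · rw [h]
      linear_combination x ^ 2 * hprod

end QuadraticAlgebra

end

namespace Zsqrtd

theorem two_ne_mul_self (n : ℤ) : (2 : ℤ) ≠ n * n := by
  intro h
  have h1 : n < 2 := by nlinarith
  have h2 : -2 < n := by nlinarith
  interval_cases n <;> omega

theorem norm_two_eq_zero {x : ℤ√2} : x.norm = 0 ↔ x = 0 := norm_eq_zero two_ne_mul_self x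

instance : IsDomain (ℤ√2) :=
  haveI : NoZeroDivisors (ℤ√2) := ⟨fun {a b} h => by
    have h' := congrArg norm h
    rw [norm_mul, norm_zero, mul_eq_zero, norm_two_eq_zero, norm_two_eq_zero] at h'
    exact h'⟩
  NoZeroDivisors.to_isDomain _

theorem _root_.Int.exists_two_mul_abs_sub_mul_le (a : ℤ) {n : ℤ} (hn : n ≠ 0) :
    ∃ q : ℤ, 2 * |a - n * q| ≤ |n| := by
  have h0 := Int.emod_nonneg a hn
  have h1 := Int.emod_lt_abs a hn
  have h2 := Int.emod_add_mul_ediv a n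
  by_cases h : 2 * (a % n) ≤ |n|
  · refine ⟨a / n, ?_⟩
    rw [show a - n * (a / n) = a % n by linarith, abs_of_nonneg h0]
    exact h
  · refine ⟨a / n + n.sign, ?_⟩
    rw [show a - n * (a / n + n.sign) = a % n - |n| by
      rw [mul_add, Int.mul_sign_self, Int.natCast_natAbs]; linarith, abs_of_nonpos (by linarith)]
    linarith

/-- Division with rounding in `ℤ√2`: the remainder, divided by `b`, has both coordinates of
absolute value at most `1 / 2`. -/
theorem exists_two_mul_abs_le (a : ℤ√2) {b : ℤ√2} (hb : b ≠ 0) :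
    ∃ q : ℤ√2, 2 * |((a - b * q) * star b).re| ≤ |b.norm| ∧
      2 * |((a - b * q) * star b).im| ≤ |b.norm| := by
  have hn : b.norm ≠ 0 := mt norm_two_eq_zero.1 hb
  obtain ⟨x, hx⟩ := Int.exists_two_mul_abs_sub_mul_le (a * star b).re hn
  obtain ⟨y, hy⟩ := Int.exists_two_mul_abs_sub_mul_le (a * star b).im hn
  have key : (a - b * ⟨x, y⟩) * star b = a * star b - b.norm * ⟨x, y⟩ := by
    rw [norm_eq_mul_conj]; ring
  refine ⟨⟨x, y⟩, ?_, ?_⟩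
  · rw [key, re_sub, re_smul]; exact hx
  · rw [key, im_sub, im_smul]; exact hy

theorem abs_norm_lt_of_two_mul_abs_le {r b : ℤ√2} (hb : b ≠ 0)
    (hre : 2 * |(r * star b).re| ≤ |b.norm|) (him : 2 * |(r * star b).im| ≤ |b.norm|) :
    2 * |r.norm| ≤ |b.norm| := by
  have hn : 0 < |b.norm| := abs_pos.2 (mt norm_two_eq_zero.1 hb)
  have h1 : r.norm * b.norm = (r * star b).re ^ 2 - 2 * (r * star b).im ^ 2 := by
    rw [← norm_conj b, ← norm_mul, norm_def]; ring
  have h2 : |r.norm| * |b.norm| = |(r * star b).re ^ 2 - 2 * (r * star b).im ^ 2| := by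
    rw [← abs_mul, h1]
  have h3 := sq_abs (r * star b).re
  have h4 := sq_abs (r * star b).im
  have h5 := abs_nonneg (r * star b).re
  have h6 := abs_nonneg (r * star b).im
  have h7 : 2 * |(r * star b).re ^ 2 - 2 * (r * star b).im ^ 2| ≤ |b.norm| ^ 2 := by
    rcases abs_cases ((r * star b).re ^ 2 - 2 * (r * star b).im ^ 2) with h | h <;> nlinarith
  rw [← h2] at h7
  nlinarith

instance : IsPrincipalIdealRing (ℤ√2) := by
  classical
  choose q hq using fun (a : ℤ√2) (b : {b : ℤ√2 // b ≠ 0}) => exists_two_mul_abs_le a b.2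
  let Q : ℤ√2 → ℤ√2 → ℤ√2 := fun a b => if h : b ≠ 0 then q a ⟨b, h⟩ else 0
  let _ : EuclideanDomain (ℤ√2) :=
    { (inferInstance : CommRing (ℤ√2)), (inferInstance : Nontrivial (ℤ√2)) with
      quotient := Q
      remainder := fun a b => a - b * Q a b
      quotient_zero := fun a => by simp [Q]
      quotient_mul_add_remainder_eq := fun a b => by ring
      r := (measure (Int.natAbs ∘ norm)).rel
      r_wellFounded := (measure (Int.natAbs ∘ norm)).wf
      remainder_lt := fun a b hb => by
        have h := abs_norm_lt_of_two_mul_abs_le hb (hq a ⟨b, hb⟩).1 (hq a ⟨b, hb⟩).2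
        have hn : 0 < |b.norm| := abs_pos.2 (mt norm_two_eq_zero.1 hb)
        change (a - b * Q a b).norm.natAbs < b.norm.natAbs
        simp only [Q, dif_pos hb]
        zify
        linarith
      mul_left_not_lt := fun a b hb => by
        change ¬(a * b).norm.natAbs < a.norm.natAbs
        rw [norm_mul, Int.natAbs_mul, not_lt]
        exact le_mul_of_one_le_right (Nat.zero_le _)
          (Int.natAbs_pos.2 (mt norm_two_eq_zero.1 hb)) }
  exact EuclideanDomain.to_principal_ideal_domain

/-- The fundamental unit `1 + √2` of `ℤ√2`. -/
def silverUnit : (ℤ√2)ˣ := ⟨⟨1, 1⟩, ⟨-1, 1⟩, by decide, by decide⟩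

theorem val_silverUnit : (silverUnit : ℤ√2) = ⟨1, 1⟩ := rfl

theorem val_inv_silverUnit : ((silverUnit⁻¹ : (ℤ√2)ˣ) : ℤ√2) = ⟨-1, 1⟩ := rfl

theorem norm_unit (u : (ℤ√2)ˣ) : (u : ℤ√2).norm = 1 ∨ (u : ℤ√2).norm = -1 := by
  have := norm_eq_one_iff.2 u.isUnit
  omega

/-- The real embedding of `ℤ√2` sending `√2` to the positive root. -/
noncomputable abbrev embTwo : ℤ√2 →+* ℝ := toReal zero_le_two

theorem embTwo_apply (x : ℤ√2) : embTwo x = x.re + x.im * √2 := by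
  simp [embTwo, toReal]

theorem embTwo_injective : Function.Injective embTwo := toReal_injective _ two_ne_mul_self

theorem embTwo_mul_star (x : ℤ√2) : embTwo x * embTwo (star x) = x.norm := by
  rw [← map_mul, ← norm_eq_mul_conj, map_intCast]

/-- Every nonzero element of `ℤ√2` has an associate whose two conjugates are comparable. -/
theorem exists_associate_balanced {b : ℤ√2} (hb : b ≠ 0) : ∃ u : (ℤ√2)ˣ,
    |embTwo (star (u * b))| ≤ |embTwo (u * b)| ∧
      |embTwo (u * b)| < (3 + 2 * √2) * |embTwo (star (u * b))| := by
  have h1 : 0 < |embTwo b| := abs_pos.2 fun h => hb (embTwo_injective (h.trans (map_zero _).symm))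
  have h2 : 0 < |embTwo (star b)| := abs_pos.2 fun h => hb <|
    star_eq_zero.1 (embTwo_injective (h.trans (map_zero _).symm))
  have hs : √2 ^ 2 = 2 := Real.sq_sqrt zero_le_two
  have hs0 : 0 ≤ √2 := Real.sqrt_nonneg 2
  obtain ⟨k, hk1, hk2⟩ := exists_mem_Ico_zpow (y := 3 + 2 * √2) (div_pos h1 h2) (by linarith)
  have hE : (embTwo silverUnit) = 1 + √2 := by rw [val_silverUnit, embTwo_apply]; simp
  have hE' : (embTwo (star silverUnit)) = 1 - √2 := by
    rw [val_silverUnit, embTwo_apply]; simp [sub_eq_add_neg]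
  have hz : ∀ f : ℤ√2 →+* ℝ, f ((silverUnit ^ (-k) : (ℤ√2)ˣ) : ℤ√2) = f silverUnit ^ (-k) := by
    intro f
    have := congrArg Units.val (map_zpow (Units.map (f : ℤ√2 →* ℝ)) silverUnit (-k))
    rw [Units.val_zpow_eq_zpow_val] at this
    exact this
  have hz1 : embTwo ((silverUnit ^ (-k) : (ℤ√2)ˣ) * b) = (1 + √2) ^ (-k) * embTwo b := by
    rw [map_mul, hz, hE]
  have hz2 : embTwo (star ((silverUnit ^ (-k) : (ℤ√2)ˣ) * b)) =
      (1 - √2) ^ (-k) * embTwo (star b) := by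
    rw [star_mul', map_mul]
    have := hz (embTwo.comp (starRingEnd (ℤ√2)))
    simp only [RingHom.comp_apply, starRingEnd_apply] at this
    rw [this, hE']
  have hab : |1 - √2| = (1 + √2)⁻¹ := by
    rw [abs_of_nonpos (by nlinarith)]
    field_simp
    linarith
  have hsq : (3 + 2 * √2) = (1 + √2) ^ 2 := by linear_combination -hs
  have hx : 0 < 1 + √2 := by linarith
  have hxk : 0 < (1 + √2) ^ k := zpow_pos hx k
  refine ⟨silverUnit ^ (-k), ?_⟩
  rw [hz1, hz2, abs_mul, abs_mul, abs_zpow, abs_zpow, hab, abs_of_pos hx, inv_zpow', neg_neg,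
    zpow_neg]
  have hpk : (3 + 2 * √2) ^ k = ((1 + √2) ^ k) ^ 2 := by
    rw [hsq, ← zpow_natCast, ← zpow_mul, mul_comm, zpow_mul, zpow_natCast]
  rw [le_div_iff₀ h2, hpk] at hk1
  rw [div_lt_iff₀ h2, zpow_add_one₀ (by positivity), hpk] at hk2
  constructor
  · rw [inv_mul_eq_div, le_div_iff₀ hxk]
    linarith
  · rw [inv_mul_eq_div, div_lt_iff₀ hxk]
    linarith

end Zsqrtd

namespace Zsqrtd

/-- Representatives of the units of `ℤ√2` modulo squares. -/
def unitReps : Finset (ℤ√2)ˣ := {1, -1, silverUnit, -silverUnit}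

theorem card_unitReps : unitReps.card = 4 := by decide

theorem mem_unitReps {u : (ℤ√2)ˣ} :
    u ∈ unitReps ↔ u = 1 ∨ u = -1 ∨ u = silverUnit ∨ u = -silverUnit := by
  simp [unitReps]

theorem exists_unitReps_mul_sq (u : (ℤ√2)ˣ) : ∃ v ∈ unitReps, ∃ w : (ℤ√2)ˣ, u = v * w ^ 2 := by
  have step : ∀ x : (ℤ√2)ˣ, (∃ v ∈ unitReps, ∃ w : (ℤ√2)ˣ, x = v * w ^ 2) →
      ∃ v ∈ unitReps, ∃ w : (ℤ√2)ˣ, silverUnit * x = v * w ^ 2 := by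
    rintro _ ⟨v, hv, w, rfl⟩
    rcases mem_unitReps.1 hv with rfl | rfl | rfl | rfl
    · exact ⟨silverUnit, by decide, w, by rw [one_mul]⟩
    · exact ⟨-silverUnit, by decide, w, by rw [neg_mul, neg_mul, one_mul, mul_neg]⟩
    · exact ⟨1, by decide, silverUnit * w, by rw [one_mul, mul_pow, sq silverUnit, mul_assoc]⟩
    · exact ⟨-1, by decide, silverUnit * w, by
        rw [neg_mul, neg_mul, one_mul, mul_pow, sq silverUnit, mul_assoc, mul_neg]⟩
  induction h : (u : ℤ√2).im.natAbs using Nat.strong_induction_on generalizing u with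
  | _ m ih =>
    have hn : (u : ℤ√2).re * (u : ℤ√2).re - 2 * (u : ℤ√2).im * (u : ℤ√2).im = 1 ∨
        (u : ℤ√2).re * (u : ℤ√2).re - 2 * (u : ℤ√2).im * (u : ℤ√2).im = -1 := norm_unit u
    have h1 : ((silverUnit * u : (ℤ√2)ˣ) : ℤ√2).im = (u : ℤ√2).re + (u : ℤ√2).im := by
      rw [Units.val_mul, val_silverUnit]; simp [add_comm]
    have h2 : ((silverUnit⁻¹ * u : (ℤ√2)ˣ) : ℤ√2).im = (u : ℤ√2).re - (u : ℤ√2).im := by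
      rw [Units.val_mul, val_inv_silverUnit]; simp; ring
    have hlt : (u : ℤ√2).im = 0 ∨ |(u : ℤ√2).re + (u : ℤ√2).im| < |(u : ℤ√2).im| ∨
        |(u : ℤ√2).re - (u : ℤ√2).im| < |(u : ℤ√2).im| := by
      rw [or_iff_not_imp_left]
      intro hb
      rw [← sq_lt_sq, ← sq_lt_sq]
      by_contra! hc
      have hb1 : 1 ≤ (u : ℤ√2).im ^ 2 := by
        have := sq_pos_of_ne_zero hb
        omega
      have ha : (u : ℤ√2).re ≠ 0 := by
        intro ha
        rw [ha] at hn
        rcases hn with hn | hn <;> ring_nf at hn <;> omega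
      have ha1 : 1 ≤ (u : ℤ√2).re ^ 2 := by
        have := sq_pos_of_ne_zero ha
        omega
      have h3 : (2 * (u : ℤ√2).im) ^ 2 ≤ (u : ℤ√2).re ^ 2 := by
        rw [sq_le_sq]
        rcases abs_cases (u : ℤ√2).re with ⟨h, h'⟩ | ⟨h, h'⟩ <;> rw [h, abs_le] <;>
          constructor <;> nlinarith [hc.1, hc.2, abs_pos.2 ha]
      rcases hn with hn | hn <;> nlinarith
    rcases hlt with h0 | hlt | hlt
    · have hre : (u : ℤ√2).re = 1 ∨ (u : ℤ√2).re = -1 := by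
        rw [h0] at hn
        rcases hn with hn | hn
        · exact sq_eq_one_iff.1 (by linarith [sq (u : ℤ√2).re])
        · nlinarith
      rcases hre with hre | hre
      · exact ⟨1, by decide, 1, Units.ext (Zsqrtd.ext (by simpa using hre) (by simpa using h0))⟩
      · exact ⟨-1, by decide, 1, Units.ext (Zsqrtd.ext (by simpa using hre) (by simpa using h0))⟩
    · obtain ⟨v, hv, w, hw⟩ := step _ (ih _ (by rw [← h, h1]; zify; exact hlt) (silverUnit * u) rfl)
      refine ⟨v, hv, silverUnit⁻¹ * w, ?_⟩
      rw [mul_pow, mul_left_comm, ← hw, inv_pow, sq, ← mul_assoc silverUnit, inv_mul_cancel_left]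
    · obtain ⟨v, hv, w, hw⟩ := step _ (ih _ (by rw [← h, h2]; zify; exact hlt) (silverUnit⁻¹ * u) rfl)
      exact ⟨v, hv, w, by rw [← hw, mul_inv_cancel_left]⟩

theorem eq_of_isSquare_mul : ∀ v ∈ unitReps, ∀ v' ∈ unitReps, IsSquare (v * v') → v = v' := by
  have key : ∀ x : (ℤ√2)ˣ, IsSquare x → 0 < (x : ℤ√2).norm ∧ 0 ≤ (x : ℤ√2).re := by
    rintro _ ⟨w, rfl⟩
    rw [Units.val_mul, norm_mul, re_mul]
    refine ⟨?_, by nlinarith [mul_self_nonneg (w : ℤ√2).re, mul_self_nonneg (w : ℤ√2).im]⟩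
    rcases norm_unit w with h | h <;> rw [h] <;> norm_num
  have hall : ∀ v ∈ unitReps, ∀ v' ∈ unitReps,
      (0 < ((v * v' : (ℤ√2)ˣ) : ℤ√2).norm ∧ 0 ≤ ((v * v' : (ℤ√2)ˣ) : ℤ√2).re) → v = v' := by
    decide
  exact fun v hv v' hv' h => hall v hv v' hv' (key _ h)

end Zsqrtd

/-- `r` is, up to a nonzero square, represented by the binary form `X ^ 2 - u * Y ^ 2`. -/
def IsNormUpToSq {R : Type*} [CommRing R] (u r : R) : Prop :=
  ∃ c X Y : R, c ≠ 0 ∧ c ^ 2 * r = X ^ 2 - u * Y ^ 2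

namespace IsNormUpToSq

variable {R : Type*} [CommRing R] [IsDomain R] {u r s : R}

theorem one (u : R) : IsNormUpToSq u 1 := ⟨1, 1, 0, one_ne_zero, by ring⟩

theorem mul (hr : IsNormUpToSq u r) (hs : IsNormUpToSq u s) : IsNormUpToSq u (r * s) := by
  obtain ⟨c, X, Y, hc, h⟩ := hr
  obtain ⟨c', X', Y', hc', h'⟩ := hs
  exact ⟨c * c', X * X' + u * Y * Y', X * Y' + X' * Y, mul_ne_zero hc hc', by
    linear_combination c' ^ 2 * s * h + (X ^ 2 - u * Y ^ 2) * h'⟩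

theorem of_mul_sq {x : R} (hx : x ≠ 0) (h : IsNormUpToSq u (r * x ^ 2)) : IsNormUpToSq u r := by
  obtain ⟨c, X, Y, hc, h⟩ := h
  exact ⟨c * x, X, Y, mul_ne_zero hc hx, by rw [← h]; ring⟩

omit [IsDomain R] in
theorem mul_sq (h : IsNormUpToSq u r) (x : R) : IsNormUpToSq u (r * x ^ 2) := by
  obtain ⟨c, X, Y, hc, h⟩ := h
  exact ⟨c, X * x, Y * x, hc, by linear_combination x ^ 2 * h⟩

theorem prod {ι : Type*} (t : Finset ι) {f : ι → R} (h : ∀ i ∈ t, IsNormUpToSq u (f i)) :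
    IsNormUpToSq u (∏ i ∈ t, f i) :=
  Finset.prod_induction _ _ (fun _ _ => mul) (one u) h

end IsNormUpToSq

namespace Zsqrtd

theorem sq_sub_silverUnit_ne_zero (t : ℤ√2) : t ^ 2 - silverUnit ≠ 0 := by
  intro h
  have := congrArg norm (sub_eq_zero.1 h)
  rw [sq, norm_mul, val_silverUnit, norm_def ⟨1, 1⟩] at this
  nlinarith [mul_self_nonneg t.norm]

theorem abs_embTwo_le {r b : ℤ√2} (hb : b ≠ 0) (hre : 2 * |(r * star b).re| ≤ |b.norm|)
    (him : 2 * |(r * star b).im| ≤ |b.norm|) :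
    2 * |embTwo r| ≤ (1 + √2) * |embTwo b| ∧
      2 * |embTwo (star r)| ≤ (1 + √2) * |embTwo (star b)| := by
  have h1 : 0 < |embTwo b| := abs_pos.2 fun h => hb (embTwo_injective (h.trans (map_zero _).symm))
  have h2 : 0 < |embTwo (star b)| := abs_pos.2 fun h => hb <|
    star_eq_zero.1 (embTwo_injective (h.trans (map_zero _).symm))
  have hs0 : 0 ≤ √2 := Real.sqrt_nonneg 2
  have hN : |embTwo b| * |embTwo (star b)| = |(b.norm : ℝ)| := by
    rw [← abs_mul, embTwo_mul_star]
  have hre' : 2 * |((r * star b).re : ℝ)| ≤ |(b.norm : ℝ)| := by exact_mod_cast hre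
  have him' : 2 * |((r * star b).im : ℝ)| ≤ |(b.norm : ℝ)| := by exact_mod_cast him
  have e1 : embTwo r * embTwo (star b) = (r * star b).re + (r * star b).im * √2 := by
    rw [← map_mul, embTwo_apply]
  have e2 : embTwo (star r) * embTwo b = (r * star b).re - (r * star b).im * √2 := by
    have : star r * b = star (r * star b) := by rw [star_mul', star_star]
    rw [← map_mul, this, embTwo_apply, re_star, im_star]
    push_cast
    ring
  have key : ∀ A B N : ℝ, 2 * |A| ≤ N → 2 * |B| ≤ N → 2 * |A + B * √2| ≤ (1 + √2) * N := by
    intro A B N hA hB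
    have := abs_add_le A (B * √2)
    rw [abs_mul, abs_of_nonneg hs0] at this
    nlinarith [mul_le_mul_of_nonneg_right hB hs0]
  have k1 := key _ _ _ hre' him'
  have k2 := key _ (-((r * star b).im : ℝ)) _ hre' (by rwa [abs_neg])
  rw [← e1, abs_mul, ← hN] at k1
  rw [neg_mul, ← sub_eq_add_neg, ← e2, abs_mul, ← hN] at k2
  constructor
  · refine le_of_mul_le_mul_right ?_ h2
    linarith
  · refine le_of_mul_le_mul_right ?_ h1
    linarith

theorem abs_norm_sq_sub_silverUnit_lt {r b : ℤ√2} (hb : b ≠ 0) (hb5 : 5 ≤ |b.norm|)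
    (h1 : |embTwo (star b)| ≤ |embTwo b|)
    (h2 : |embTwo b| < (3 + 2 * √2) * |embTwo (star b)|)
    (hre : 2 * |(r * star b).re| ≤ |b.norm|) (him : 2 * |(r * star b).im| ≤ |b.norm|) :
    |(r ^ 2 - silverUnit).norm| < |b.norm| ^ 2 := by
  obtain ⟨hr, hr'⟩ := abs_embTwo_le hb hre him
  have hn := abs_norm_lt_of_two_mul_abs_le hb hre him
  have hN : |embTwo b| * |embTwo (star b)| = |(b.norm : ℝ)| := by
    rw [← abs_mul, embTwo_mul_star]
  have hb5' : (5 : ℝ) ≤ |(b.norm : ℝ)| := by exact_mod_cast hb5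
  have hn' : 2 * |(r.norm : ℝ)| ≤ |(b.norm : ℝ)| := by exact_mod_cast hn
  have hnr : |embTwo r| * |embTwo (star r)| = |(r.norm : ℝ)| := by
    rw [← abs_mul, embTwo_mul_star]
  have hsq : √2 ^ 2 = 2 := Real.sq_sqrt zero_le_two
  have hs0 : 0 ≤ √2 := Real.sqrt_nonneg 2
  have hs1 : √2 < 1.415 := by rw [Real.sqrt_lt' (by norm_num)]; norm_num
  have hs2 : 1 < √2 := by rw [Real.lt_sqrt (by norm_num)]; norm_num
  have hE : ((r ^ 2 - silverUnit).norm : ℝ) = (|embTwo r| * |embTwo (star r)|) ^ 2 +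
      (√2 - 1) * |embTwo r| ^ 2 - (1 + √2) * |embTwo (star r)| ^ 2 - 1 := by
    have hst : star (silverUnit : ℤ√2) = ⟨1, -1⟩ := rfl
    rw [← embTwo_mul_star, star_sub, hst, star_pow, map_sub, map_sub, map_pow, map_pow, mul_pow,
      sq_abs, sq_abs, val_silverUnit, embTwo_apply ⟨1, 1⟩, embTwo_apply ⟨1, -1⟩]
    push_cast
    linear_combination -hsq
  rw [← Int.cast_lt (R := ℝ), Int.cast_abs, Int.cast_pow, Int.cast_abs, hE, hnr]
  have hx0 := abs_nonneg (embTwo r)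
  have hx0' := abs_nonneg (embTwo (star r))
  have hy0 := abs_nonneg (embTwo b)
  have hy0' := abs_nonneg (embTwo (star b))
  have hn0 := abs_nonneg (r.norm : ℝ)
  generalize |embTwo r| = x at *
  generalize |embTwo (star r)| = x' at *
  generalize |embTwo b| = y at *
  generalize |embTwo (star b)| = y' at *
  generalize |(b.norm : ℝ)| = N at *
  generalize |(r.norm : ℝ)| = m at *
  have hm : 4 * m ^ 2 ≤ N ^ 2 := by nlinarith
  have hyN : y ^ 2 ≤ (3 + 2 * √2) * N := by nlinarith
  have hyN' : y' ^ 2 ≤ N := by nlinarith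
  have hx : 4 * x ^ 2 ≤ (3 + 2 * √2) * y ^ 2 := by
    have := pow_le_pow_left₀ (by positivity) hr 2
    linear_combination this + y ^ 2 * hsq
  have hx' : 4 * x' ^ 2 ≤ (3 + 2 * √2) * y' ^ 2 := by
    have := pow_le_pow_left₀ (by positivity) hr' 2
    linear_combination this + y' ^ 2 * hsq
  have hz : 4 * ((√2 - 1) * x ^ 2) ≤ (7 + 5 * √2) * N := by
    have h3 : 4 * x ^ 2 ≤ (3 + 2 * √2) * ((3 + 2 * √2) * N) :=
      hx.trans (mul_le_mul_of_nonneg_left hyN (by positivity))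
    have h4 := mul_le_mul_of_nonneg_left h3 (sub_nonneg.2 hs2.le)
    linear_combination h4 + (4 * N * √2 + 8 * N) * hsq
  have hz' : 4 * ((1 + √2) * x' ^ 2) ≤ (7 + 5 * √2) * N := by
    have h3 : 4 * x' ^ 2 ≤ (3 + 2 * √2) * N :=
      hx'.trans (mul_le_mul_of_nonneg_left hyN' (by positivity))
    have h4 := mul_le_mul_of_nonneg_left h3 (add_nonneg zero_le_one hs0)
    linear_combination h4 + 2 * N * hsq
  have hw : 0 ≤ (√2 - 1) * x ^ 2 := mul_nonneg (sub_nonneg.2 hs2.le) (sq_nonneg x)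
  have hw' : 0 ≤ (1 + √2) * x' ^ 2 := by positivity
  have hN7 : (7 + 5 * √2) * N ≤ 14.075 * N := mul_le_mul_of_nonneg_right (by linarith) (by linarith)
  rw [abs_lt]
  constructor <;> nlinarith [sq_nonneg m]

theorem isNormUpToSq_two_add_sqrtd : IsNormUpToSq (silverUnit : ℤ√2) ⟨2, 1⟩ :=
  ⟨1, silverUnit, 1, one_ne_zero, by decide⟩

theorem exists_unit_mul_of_abs_norm_eq_one {b : ℤ√2} (h : |b.norm| = 1) :
    ∃ v : (ℤ√2)ˣ, v * b = 1 := by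
  have hb : IsUnit b := norm_eq_one_iff.1 (by zify; exact h)
  exact ⟨hb.unit⁻¹, hb.val_inv_mul⟩

/-- If `silverUnit` is a square modulo `b`, some associate of `b` is, up to squares, a norm from
the extension generated by a square root of `silverUnit`. -/
theorem exists_unit_isNormUpToSq {b : ℤ√2} (hb : b ≠ 0) {t : ℤ√2} (ht : b ∣ t ^ 2 - silverUnit) :
    ∃ v : (ℤ√2)ˣ, IsNormUpToSq (silverUnit : ℤ√2) (v * b) := by
  induction h : b.norm.natAbs using Nat.strong_induction_on generalizing b t with
  | _ m ih =>
    by_cases hb5 : 5 ≤ |b.norm|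
    · obtain ⟨w, hw1, hw2⟩ := exists_associate_balanced hb
      have hwb : (w : ℤ√2) * b ≠ 0 := mul_ne_zero w.ne_zero hb
      have hnw : |((w : ℤ√2) * b).norm| = |b.norm| := by
        rw [norm_mul, abs_mul]
        rcases norm_unit w with h | h <;> rw [h] <;> simp
      obtain ⟨q, hq1, hq2⟩ := exists_two_mul_abs_le t hwb
      set r := t - w * b * q with hr
      have hlt := abs_norm_sq_sub_silverUnit_lt hwb (hnw.symm ▸ hb5) hw1 hw2 hq1 hq2
      obtain ⟨g, hg⟩ : (w : ℤ√2) * b ∣ r ^ 2 - silverUnit := by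
        have h1 : (w : ℤ√2) * b ∣ t ^ 2 - silverUnit := w.isUnit.mul_left_dvd.2 ht
        have h2 : r ^ 2 - silverUnit = t ^ 2 - silverUnit + w * b * (w * b * q ^ 2 - 2 * t * q) := by
          rw [hr]; ring
        rw [h2]
        exact dvd_add h1 (dvd_mul_right _ _)
      have hg0 : g ≠ 0 := by
        rintro rfl
        exact sq_sub_silverUnit_ne_zero r (by rw [hg, mul_zero])
      have hgn : g.norm.natAbs < m := by
        rw [hg, norm_mul, abs_mul, hnw, sq] at hlt
        have := lt_of_mul_lt_mul_left hlt (abs_nonneg _)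
        rw [← h]
        zify
        exact this
      obtain ⟨v, hv⟩ := ih _ hgn hg0 (t := r) ⟨w * b, by rw [hg, mul_comm]⟩ rfl
      refine ⟨v * w, IsNormUpToSq.of_mul_sq hg0 ?_⟩
      have h1 : IsNormUpToSq (silverUnit : ℤ√2) (r ^ 2 - silverUnit) :=
        ⟨1, r, 1, one_ne_zero, by ring⟩
      convert hv.mul h1 using 1
      rw [hg]
      push_cast
      ring
    · have hn0 : b.norm ≠ 0 := mt norm_two_eq_zero.1 hb
      have hn := norm_def b
      have hpos := abs_pos.2 hn0
      have hcases : |b.norm| = 1 ∨ |b.norm| = 2 ∨ |b.norm| = 3 ∨ |b.norm| = 4 := by omega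
      rcases hcases with h1 | h1 | h1 | h1
      · obtain ⟨v, hv⟩ := exists_unit_mul_of_abs_norm_eq_one h1
        exact ⟨v, hv ▸ IsNormUpToSq.one _⟩
      · have he : 2 ∣ b.re := by
          have : 2 ∣ b.re * b.re := by
            rw [mul_assoc] at hn
            rcases (abs_eq zero_le_two).1 h1 with h1 | h1 <;> omega
          exact (Int.prime_two.dvd_or_dvd this).elim id id
        obtain ⟨k, hk⟩ := he
        have hb' : b = ⟨2, 1⟩ * ⟨b.re - b.im, b.im - k⟩ := by
          ext <;> simp <;> linarith
        have h2 : |(⟨b.re - b.im, b.im - k⟩ : ℤ√2).norm| = 1 := by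
          have h3 := congrArg norm hb'
          rw [norm_mul, norm_def ⟨2, 1⟩] at h3
          rw [h3, abs_mul] at h1
          norm_num at h1
          exact h1
        obtain ⟨v, hv⟩ := exists_unit_mul_of_abs_norm_eq_one h2
        refine ⟨v, ?_⟩
        rw [hb', mul_left_comm, hv, mul_one]
        exact isNormUpToSq_two_add_sqrtd
      · exfalso
        have hm : ∀ x y : ZMod 3, x * x - 2 * y * y = 0 → x = 0 ∧ y = 0 := by decide
        have h3 : (3 : ℤ) ∣ b.norm := by rw [← dvd_abs, h1]
        rw [hn] at h3
        have h4 := (ZMod.intCast_zmod_eq_zero_iff_dvd _ 3).2 h3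
        push_cast at h4
        obtain ⟨h5, h6⟩ := hm _ _ h4
        obtain ⟨x, hx⟩ := (ZMod.intCast_zmod_eq_zero_iff_dvd _ 3).1 h5
        obtain ⟨y, hy⟩ := (ZMod.intCast_zmod_eq_zero_iff_dvd _ 3).1 h6
        have h7 : b.norm = 9 * (x * x - 2 * y * y) := by rw [hn, hx, hy]; push_cast; ring
        rcases (abs_eq zero_le_three).1 h1 with h1 | h1 <;> omega
      · exfalso
        have hm : ∀ x y : ZMod 4, x * x - 2 * y * y = 0 → 2 * x = 0 ∧ 2 * y = 0 := by decide
        have h3 : (4 : ℤ) ∣ b.norm := by rw [← dvd_abs, h1]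
        rw [hn] at h3
        have h4 := (ZMod.intCast_zmod_eq_zero_iff_dvd _ 4).2 h3
        push_cast at h4
        obtain ⟨h5, h6⟩ := hm _ _ h4
        have h5' := (ZMod.intCast_zmod_eq_zero_iff_dvd (2 * b.re) 4).1 (by exact_mod_cast h5)
        have h6' := (ZMod.intCast_zmod_eq_zero_iff_dvd (2 * b.im) 4).1 (by exact_mod_cast h6)
        have h7 : ((2 : ℤ) : ℤ√2) ∣ b := (intCast_dvd _ _).2 ⟨by omega, by omega⟩
        have h8 := ((intCast_dvd _ _).1 (h7.trans ht)).2
        rw [sq, im_sub, im_mul, val_silverUnit] at h8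
        simp only at h8
        rw [mul_comm t.im] at h8
        omega

end Zsqrtd

namespace QuadraticAlgebra

variable {R : Type*} [CommRing R] [IsDomain R] [IsPrincipalIdealRing R] {δ : R}

/-- If `u` is a norm up to squares, then it is a square modulo every divisor of `δ`. -/
theorem exists_dvd_sq_sub (hδ : Squarefree δ) (u : R) {z : QuadraticAlgebra R δ 0} {c : R}
    (hc : c ≠ 0) (h : z.norm = u * c ^ 2) {d : R} (hd : d ∣ δ) : ∃ t : R, d ∣ t ^ 2 - u := by
  obtain ⟨z, c, hc, h, α, β, γ, hprim⟩ := exists_primitive_norm_eq u hc h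
  rw [norm_eq_re_sq_sub] at h
  have hcop : IsCoprime c d := by
    refine isCoprime_of_prime_dvd (fun h0 => hc h0.1) fun π hπ hπc hπd => hπ.not_isUnit ?_
    have h1 : π ∣ z.re := by
      refine hπ.dvd_of_dvd_pow (n := 2) ?_
      rw [sub_eq_iff_eq_add.1 h]
      exact dvd_add (hπc.trans (Dvd.intro_left (u * c) (by ring)))
        ((hπd.trans hd).mul_right _)
    have h2 := dvd_im_of_dvd_re hδ hπ h hπc h1
    refine isUnit_of_dvd_one (hprim ▸ ?_)
    exact dvd_add (dvd_add (h1.mul_left _) (h2.mul_left _)) (hπc.mul_left _)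
  obtain ⟨a, b, hab⟩ := hcop
  obtain ⟨e, he⟩ := hd
  exact ⟨a * z.re, a ^ 2 * e * z.im ^ 2 - u * b * (1 + a * c), by
    linear_combination a ^ 2 * h + a ^ 2 * z.im ^ 2 * he + u * (a * c + 1) * hab⟩

theorem exists_norm_eq_of_isNormUpToSq (hδ : Squarefree δ) (hδu : ¬IsUnit δ) {u : R}
    (h : IsNormUpToSq u δ) : ∃ (z : QuadraticAlgebra R δ 0) (c : R),
      c ≠ 0 ∧ z.norm = u * c ^ 2 := by
  obtain ⟨c, X, Y, hc, h⟩ := h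
  refine ⟨⟨X, c⟩, Y, ?_, ?_⟩
  · rintro rfl
    have h1 : c ^ 2 ∣ X ^ 2 := ⟨δ, by linear_combination -h⟩
    obtain ⟨e, rfl⟩ := (IsIntegrallyClosed.pow_dvd_pow_iff two_ne_zero).1 h1
    have h2 : δ = e * e := by
      refine mul_left_cancel₀ (pow_ne_zero 2 hc) ?_
      linear_combination h
    have := hδ e (h2 ▸ dvd_rfl)
    exact hδu (h2 ▸ this.mul this)
  · rw [norm_eq_re_sq_sub]
    change X ^ 2 - δ * c ^ 2 = _
    linear_combination -h

end QuadraticAlgebra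

namespace Zsqrtd

/-- `u` is a square modulo the rational integer `p` in `ℤ√2`. -/
def IsSquareMod (u : ℤ√2) (p : ℕ) : Prop := ∃ t : ℤ√2, (p : ℤ√2) ∣ t ^ 2 - u

theorem isNormUpToSq_silverUnit_natCast {p : ℕ} (hp : 0 < p) (h : IsSquareMod silverUnit p) :
    IsNormUpToSq (silverUnit : ℤ√2) p := by
  obtain ⟨t, ht⟩ := h
  obtain ⟨v, hv⟩ := exists_unit_isNormUpToSq (Nat.cast_ne_zero.2 hp.ne') ht
  obtain ⟨v, hvm, w, rfl⟩ := exists_unitReps_mul_sq v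
  have hv1 : IsNormUpToSq (silverUnit : ℤ√2) (v * p) := by
    refine IsNormUpToSq.of_mul_sq w.ne_zero ?_
    convert hv using 1
    push_cast
    ring
  have hs2 : 1 < √2 := by rw [Real.lt_sqrt (by norm_num)]; norm_num
  have hpos : 0 ≤ embTwo (star v) := by
    obtain ⟨c, X, Y, hc, h⟩ := hv1
    have h1 := congrArg (fun x => embTwo (star x)) h
    simp only [star_mul', star_sub, star_pow, map_mul, map_sub, map_pow, star_natCast,
      map_natCast] at h1
    have hst : embTwo (star (silverUnit : ℤ√2)) = 1 - √2 := by
      have : star (silverUnit : ℤ√2) = ⟨1, -1⟩ := rfl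
      rw [this, embTwo_apply]
      push_cast
      ring
    have hc' : 0 < embTwo (star c) ^ 2 := by
      have : embTwo (star c) ≠ 0 := fun h => hc <|
        star_eq_zero.1 (embTwo_injective (h.trans (map_zero _).symm))
      positivity
    have hp' : (0 : ℝ) < p := by exact_mod_cast hp
    rw [hst, ← mul_assoc, mul_right_comm] at h1
    by_contra! hneg
    nlinarith [mul_pos hc' hp', sq_nonneg (embTwo (star X)), sq_nonneg (embTwo (star Y)),
      mul_nonneg (sub_nonneg.2 hs2.le) (sq_nonneg (embTwo (star Y)))]
  rcases mem_unitReps.1 hvm with rfl | rfl | rfl | rfl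
  · simpa using hv1
  · exfalso
    simp at hpos
    linarith
  · exfalso
    have : star (silverUnit : ℤ√2) = ⟨1, -1⟩ := rfl
    rw [this, embTwo_apply] at hpos
    push_cast at hpos
    linarith
  · refine IsNormUpToSq.of_mul_sq silverUnit.ne_zero ?_
    have h1 : IsNormUpToSq (silverUnit : ℤ√2) (-silverUnit) := ⟨1, 0, 1, one_ne_zero, by ring⟩
    convert hv1.mul h1 using 1
    push_cast
    ring

theorem isNormUpToSq_neg_one_of_dvd {m : ℕ} (hm : 0 < m) {t : ℤ} {s : ℕ} (hs : s = 1 ∨ s = 2)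
    (h : (m : ℤ) ∣ t ^ 2 + s) : IsNormUpToSq (-1 : ℤ√2) m := by
  induction m using Nat.strong_induction_on generalizing t with
  | _ m ih =>
    by_cases hm1 : m = 1
    · rw [hm1, Nat.cast_one]
      exact IsNormUpToSq.one _
    have hm2 : (2 : ℤ) ≤ m := by omega
    obtain ⟨q, hq⟩ := Int.exists_two_mul_abs_sub_mul_le t (n := m) (by omega)
    set r := t - m * q with hr
    have hrm : 4 * r ^ 2 ≤ (m : ℤ) ^ 2 := by
      rw [← sq_abs r, ← sq_abs (m : ℤ)]
      nlinarith [abs_nonneg r]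
    obtain ⟨k, hk⟩ : (m : ℤ) ∣ r ^ 2 + s := by
      rw [show r ^ 2 + s = t ^ 2 + s + m * (m * q ^ 2 - 2 * t * q) by rw [hr]; ring]
      exact dvd_add h (dvd_mul_right _ _)
    have hs' : (1 : ℤ) ≤ s ∧ (s : ℤ) ≤ 2 := by omega
    have hk0 : 0 < k := by nlinarith [sq_nonneg r]
    have hkm : k < m := by
      by_contra! hc
      have : (m : ℤ) * m ≤ m * k := mul_le_mul_of_nonneg_left hc (by omega)
      nlinarith
    lift k to ℕ using hk0.le
    have h1 := ih k (by exact_mod_cast hkm) (by exact_mod_cast hk0) (t := r)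
      ⟨m, by rw [hk, mul_comm]⟩
    have hk' : ((r : ℤ√2)) ^ 2 + s = m * k := by exact_mod_cast congrArg (Int.cast : ℤ → ℤ√2) hk
    have h2 : IsNormUpToSq (-1 : ℤ√2) (m * k) := by
      rcases hs with rfl | rfl
      · exact ⟨1, r, 1, one_ne_zero, by rw [← hk']; push_cast; ring⟩
      · exact ⟨1, r, sqrtd, one_ne_zero, by
          rw [← hk', sq sqrtd, dmuld]; push_cast; ring⟩
    refine IsNormUpToSq.of_mul_sq (x := (k : ℤ√2)) (by exact_mod_cast hk0.ne') ?_
    convert h2.mul h1 using 1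
    ring

theorem isNormUpToSq_neg_one_two_add_sqrtd : IsNormUpToSq (-1 : ℤ√2) ⟨2, 1⟩ :=
  ⟨⟨0, 1⟩, 1, silverUnit, by decide, by decide⟩

end Zsqrtd

namespace Zsqrtd

theorem isSquareMod_iff {u : ℤ√2} {p : ℕ} :
    IsSquareMod u p ↔ ∃ a b : ZMod p, a ^ 2 + 2 * b ^ 2 = u.re ∧ 2 * a * b = u.im := by
  have key : ∀ t : ℤ√2, (p : ℤ√2) ∣ t ^ 2 - u ↔
      (t.re : ZMod p) ^ 2 + 2 * (t.im : ZMod p) ^ 2 = u.re ∧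
        2 * (t.re : ZMod p) * (t.im : ZMod p) = u.im := by
    intro t
    have h : ((p : ℤ) : ℤ√2) = p := by push_cast; rfl
    rw [← h, intCast_dvd, ← ZMod.intCast_zmod_eq_zero_iff_dvd, ← ZMod.intCast_zmod_eq_zero_iff_dvd,
      sq, re_sub, im_sub, re_mul, im_mul]
    push_cast
    rw [sub_eq_zero, sub_eq_zero]
    constructor <;> rintro ⟨h1, h2⟩ <;> exact ⟨by linear_combination h1, by linear_combination h2⟩
  constructor
  · rintro ⟨t, ht⟩
    exact ⟨_, _, (key t).1 ht⟩
  · rintro ⟨a, b, h⟩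
    obtain ⟨a, rfl⟩ := ZMod.intCast_surjective a
    obtain ⟨b, rfl⟩ := ZMod.intCast_surjective b
    exact ⟨⟨a, b⟩, (key _).2 h⟩

variable {p : ℕ} [hp : Fact p.Prime]

theorem isNormUpToSq_neg_one (hodd : p % 2 = 1) (h8 : p % 8 ≠ 7) :
    IsNormUpToSq (-1 : ℤ√2) p := by
  have hp2 : p ≠ 2 := by omega
  by_cases h4 : p % 4 = 3
  · obtain ⟨a, ha⟩ := (ZMod.exists_sq_eq_neg_two_iff hp2).2 (by omega)
    obtain ⟨t, rfl⟩ := ZMod.intCast_surjective a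
    refine isNormUpToSq_neg_one_of_dvd hp.out.pos (t := t) (Or.inr rfl) ?_
    rw [← ZMod.intCast_zmod_eq_zero_iff_dvd]
    push_cast
    linear_combination -ha
  · obtain ⟨a, ha⟩ := ZMod.exists_sq_eq_neg_one_iff.2 h4
    obtain ⟨t, rfl⟩ := ZMod.intCast_surjective a
    refine isNormUpToSq_neg_one_of_dvd hp.out.pos (t := t) (Or.inl rfl) ?_
    rw [← ZMod.intCast_zmod_eq_zero_iff_dvd]
    push_cast
    linear_combination -ha

theorem not_isSquareMod_neg_one (h8 : p % 8 = 7) : ¬IsSquareMod (-1) p := by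
  rw [isSquareMod_iff]
  rintro ⟨a, b, h1, h2⟩
  have hp2 : p ≠ 2 := by omega
  have h20 : (2 : ZMod p) ≠ 0 := Ring.two_ne_zero (by rwa [ZMod.ringChar_zmod_n])
  have h3 : a = 0 ∨ b = 0 := by
    simpa [h20] using h2
  simp only [re_neg, re_one, Int.cast_neg, Int.cast_one] at h1
  rcases h3 with rfl | rfl
  · have hs : IsSquare (-2 : ZMod p) := ⟨2 * b, by linear_combination -2 * h1⟩
    have := (ZMod.exists_sq_eq_neg_two_iff hp2).1 hs
    omega
  · have hs : IsSquare (-1 : ZMod p) := ⟨a, by linear_combination -h1⟩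
    exact ZMod.exists_sq_eq_neg_one_iff.1 hs (by omega)

theorem not_isSquareMod_of_norm_eq_neg_one (h4 : p % 4 = 3) {u : ℤ√2} (hu : u.norm = -1) :
    ¬IsSquareMod u p := by
  rw [isSquareMod_iff]
  rintro ⟨a, b, h1, h2⟩
  have hs : IsSquare (-1 : ZMod p) := by
    refine ⟨a ^ 2 - 2 * b ^ 2, ?_⟩
    have := congrArg (Int.cast : ℤ → ZMod p) hu
    rw [norm_def] at this
    push_cast at this
    rw [← h1, ← h2] at this
    linear_combination -this
  exact ZMod.exists_sq_eq_neg_one_iff.1 hs h4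

theorem isSquareMod_of_neg (h4 : p % 4 = 1) {u : ℤ√2} (hu : IsSquareMod (-u) p) :
    IsSquareMod u p := by
  obtain ⟨i, hi⟩ := ZMod.exists_sq_eq_neg_one_iff.2 (show p % 4 ≠ 3 by omega)
  rw [isSquareMod_iff] at hu ⊢
  obtain ⟨a, b, h1, h2⟩ := hu
  rw [re_neg, Int.cast_neg] at h1
  rw [im_neg, Int.cast_neg] at h2
  exact ⟨i * a, i * b, by linear_combination -h1 - (a ^ 2 + 2 * b ^ 2) * hi,
    by linear_combination -h2 - 2 * a * b * hi⟩

theorem isSquareMod_silverUnit_iff_isSquare (hp2 : p ≠ 2) {i c : ZMod p} (hi : i ^ 2 = -1)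
    (hc : 2 * c = 1) :
    IsSquareMod silverUnit p ↔ IsSquare ((1 + i) * c) ∨ IsSquare ((1 - i) * c) := by
  have h20 : (2 : ZMod p) ≠ 0 := Ring.two_ne_zero (by rwa [ZMod.ringChar_zmod_n])
  have hre : ((silverUnit : ℤ√2).re : ZMod p) = 1 := by rw [val_silverUnit]; simp
  have him : ((silverUnit : ℤ√2).im : ZMod p) = 1 := by rw [val_silverUnit]; simp
  rw [isSquareMod_iff, hre, him]
  constructor
  · rintro ⟨a, b, h1, h2⟩
    have h3 : 2 * a ^ 4 - 2 * a ^ 2 + 1 = 0 := by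
      linear_combination 2 * a ^ 2 * h1 - (2 * a * b + 1) * h2
    have h4 : (2 * a ^ 2 - 1 - i) * (2 * a ^ 2 - 1 + i) = 0 := by
      linear_combination 2 * h3 - hi
    rcases mul_eq_zero.1 h4 with h | h
    · exact Or.inl ⟨a, by linear_combination -c * h + a ^ 2 * hc⟩
    · exact Or.inr ⟨a, by linear_combination -c * h + a ^ 2 * hc⟩
  · have key : ∀ j : ZMod p, j ^ 2 = -1 → IsSquare ((1 + j) * c) →
        ∃ a b : ZMod p, a ^ 2 + 2 * b ^ 2 = 1 ∧ 2 * a * b = 1 := by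
      rintro j hj ⟨a, ha⟩
      have h1 : 2 * a ^ 2 = 1 + j := by linear_combination -2 * ha + (1 + j) * hc
      have ha0 : a ≠ 0 := by
        rintro rfl
        apply h20
        linear_combination (j - 1) * h1 + hj
      refine ⟨a, c * a⁻¹, ?_, ?_⟩
      · have : 2 * a ^ 2 * (a ^ 2 + 2 * (c * a⁻¹) ^ 2) = 2 * a ^ 2 * 1 := by
          have h5 : a ^ 2 * a⁻¹ ^ 2 = 1 := by rw [← mul_pow, mul_inv_cancel₀ ha0, one_pow]
          linear_combination 4 * c ^ 2 * h5 + (a ^ 2 + c * (1 + j) - 1) * h1 + c * hj +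
            (2 * c + 1 - a ^ 2 * (1 + j) + j) * hc
        exact mul_left_cancel₀ (mul_ne_zero h20 (pow_ne_zero 2 ha0)) this
      · linear_combination hc + 2 * c * mul_inv_cancel₀ ha0
    rintro (h | h)
    · exact key i hi h
    · exact key (-i) (by rw [neg_sq, hi]) (by rwa [← sub_eq_add_neg])

theorem isSquareMod_silverUnit_of_mod_eight_eq_five (h8 : p % 8 = 5) :
    IsSquareMod silverUnit p := by
  have hp2 : p ≠ 2 := by omega
  have h20 : (2 : ZMod p) ≠ 0 := Ring.two_ne_zero (by rwa [ZMod.ringChar_zmod_n])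
  obtain ⟨i, hi⟩ := ZMod.exists_sq_eq_neg_one_iff.2 (show p % 4 ≠ 3 by omega)
  have hi' : i ^ 2 = -1 := by rw [hi, sq]
  have hc : 2 * (2 : ZMod p)⁻¹ = 1 := mul_inv_cancel₀ h20
  rw [isSquareMod_silverUnit_iff_isSquare hp2 hi' hc]
  set c := (2 : ZMod p)⁻¹
  have hprod : (1 + i) * c * ((1 - i) * c) = c := by
    linear_combination -c ^ 2 * hi' + c * hc
  have hc0 : c ≠ 0 := inv_ne_zero h20
  have h1 : (1 + i) * c ≠ 0 := left_ne_zero_of_mul (hprod ▸ hc0)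
  have h2 : (1 - i) * c ≠ 0 := right_ne_zero_of_mul (hprod ▸ hc0)
  rw [ZMod.euler_criterion p h1, ZMod.euler_criterion p h2]
  obtain ⟨k, hk⟩ : ∃ k, p / 2 = 2 * (2 * k + 1) := ⟨p / 8, by omega⟩
  have e1 : ((1 + i) * c) ^ 2 = i * c := by
    linear_combination c ^ 2 * hi' + c * i * hc
  have e2 : ((1 - i) * c) ^ 2 = -(i * c) := by
    linear_combination c ^ 2 * hi' - c * i * hc
  rcases ZMod.pow_div_two_eq_neg_one_or_one p h1 with h | h
  · exact Or.inl h
  · right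
    rw [hk, pow_mul, e1] at h
    rw [hk, pow_mul, e2, Odd.neg_pow ⟨k, rfl⟩, h, neg_neg]

theorem isSquareMod_silverUnit_iff_quartSym (h8 : p % 8 = 1) :
    IsSquareMod silverUnit p ↔ quartSym p 2 = (-1) ^ ((p - 1) / 8) := by
  have hp2 : p ≠ 2 := by omega
  have h20 : (2 : ZMod p) ≠ 0 := Ring.two_ne_zero (by rwa [ZMod.ringChar_zmod_n])
  obtain ⟨i, hi⟩ := ZMod.exists_sq_eq_neg_one_iff.2 (show p % 4 ≠ 3 by omega)
  have hi' : i ^ 2 = -1 := by rw [hi, sq]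
  have hc : 2 * (2 : ZMod p)⁻¹ = 1 := mul_inv_cancel₀ h20
  rw [isSquareMod_silverUnit_iff_isSquare hp2 hi' hc]
  set c := (2 : ZMod p)⁻¹
  have hprod : (1 + i) * c * ((1 - i) * c) = c := by
    linear_combination -c ^ 2 * hi' + c * hc
  have hc0 : c ≠ 0 := inv_ne_zero h20
  have h1 : (1 + i) * c ≠ 0 := left_ne_zero_of_mul (hprod ▸ hc0)
  have h2 : (1 - i) * c ≠ 0 := right_ne_zero_of_mul (hprod ▸ hc0)
  obtain ⟨k, hk⟩ : ∃ k, p = 8 * k + 1 := ⟨p / 8, by omega⟩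
  have hk2 : p / 2 = 2 * (2 * k) := by omega
  have hk4 : (p - 1) / 4 = 2 * k := by omega
  have hk8 : (p - 1) / 8 = k := by omega
  have e1 : ((1 + i) * c) ^ 2 = i * c := by
    linear_combination c ^ 2 * hi' + c * i * hc
  have e2 : ((1 - i) * c) ^ 2 = -(i * c) := by
    linear_combination c ^ 2 * hi' - c * i * hc
  have h2k : ((2 : ZMod p) ^ (2 * k)) = 1 ∨ ((2 : ZMod p) ^ (2 * k)) = -1 := by
    rw [← sq_eq_one_iff, ← pow_mul, mul_comm (2 * k), ← hk2, ← ZMod.euler_criterion p h20,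
      ZMod.exists_sq_eq_two_iff hp2]
    exact Or.inl h8
  have hne : (1 : ZMod p) ≠ -1 := (Ring.neg_one_ne_one_of_char_ne_two
    (by rwa [ZMod.ringChar_zmod_n])).symm
  have hcast : ((quartSym p 2 : ℤ) : ZMod p) = 2 ^ (2 * k) := by
    rw [quartSym, hk4]
    push_cast
    rcases h2k with h | h
    · rw [h]; simp
    · rw [h, if_neg hne.symm]
  have hq : quartSym p 2 = 1 ∨ quartSym p 2 = -1 := by
    unfold quartSym
    split_ifs <;> simp
  have hiff : quartSym p 2 = (-1) ^ k ↔ (2 : ZMod p) ^ (2 * k) = (-1) ^ k := by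
    rw [← hcast]
    rcases Nat.even_or_odd k with h' | h' <;> rcases hq with h | h <;>
      rw [h, h'.neg_one_pow, h'.neg_one_pow] <;> simp [hne, hne.symm]
  have hic : (i * c) ^ (2 * k) = 1 ↔ (2 : ZMod p) ^ (2 * k) = (-1) ^ k := by
    rw [mul_pow, pow_mul i, hi', inv_pow]
    rw [mul_inv_eq_one₀ (pow_ne_zero _ h20), eq_comm]
  rw [ZMod.euler_criterion p h1, ZMod.euler_criterion p h2, hk2,
    pow_mul ((1 + i) * c) 2, e1, pow_mul ((1 - i) * c) 2, e2, Even.neg_pow (even_two_mul k), or_self, hic, hk8, hiff]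

end Zsqrtd

namespace Zsqrtd

theorem prime_of_natAbs_norm_prime {b : ℤ√2} (hb : b.norm.natAbs.Prime) : Prime b := by
  refine Irreducible.prime ⟨fun h => hb.one_lt.ne' (norm_eq_one_iff.2 h), fun x y h => ?_⟩
  rw [h, norm_mul, Int.natAbs_mul, Nat.prime_mul_iff] at hb
  rcases hb with h | h
  · exact Or.inr (norm_eq_one_iff.1 h.2)
  · exact Or.inl (norm_eq_one_iff.1 h.2)

theorem prime_two_add_sqrtd : Prime (⟨2, 1⟩ : ℤ√2) :=
  prime_of_natAbs_norm_prime (by norm_num [norm_def])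

theorem dvd_two_add_sqrtd {p : ℤ√2} (hp : Prime p) (h : p ∣ 2) : p ∣ ⟨2, 1⟩ := by
  have h1 : (2 : ℤ√2) = ⟨2, 1⟩ * (⟨2, 1⟩ * ⟨3, -2⟩) := by decide
  rw [h1] at h
  rcases hp.dvd_or_dvd h with h | h
  · exact h
  · exact (hp.dvd_or_dvd h).resolve_right fun h3 => hp.not_isUnit
      (isUnit_of_dvd_unit h3 (norm_eq_one_iff.1 (by decide)))

variable {p : ℕ} [hp : Fact p.Prime]

theorem natAbs_norm_eq_of_mul_eq {a b : ℤ√2} (h : (p : ℤ√2) = a * b) (ha : ¬IsUnit a)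
    (hb : ¬IsUnit b) : a.norm.natAbs = p := by
  have h1 := congrArg (fun x => (norm x).natAbs) h
  simp only [norm_mul, norm_natCast, Int.natAbs_mul, Int.natAbs_natCast] at h1
  exact ((hp.out.mul_eq_prime_sq_iff (mt norm_eq_one_iff.1 ha) (mt norm_eq_one_iff.1 hb)).1
    (by rw [sq, h1])).1

theorem prime_natCast_of_mod_eight (h8 : p % 8 = 3 ∨ p % 8 = 5) : Prime (p : ℤ√2) := by
  refine Irreducible.prime ⟨fun h => ?_, fun a b h => ?_⟩
  · have := norm_eq_one_iff.2 h
    rw [norm_natCast, Int.natAbs_mul, Int.natAbs_natCast] at this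
    exact hp.out.one_lt.ne' (Nat.eq_one_of_mul_eq_one_right this)
  · by_contra! hc
    have h1 := natAbs_norm_eq_of_mul_eq h hc.1 hc.2
    have key : ∀ x y : ZMod 8, x * x - 2 * y * y ≠ 3 ∧ x * x - 2 * y * y ≠ 5 := by decide
    have h2 : ((a.norm : ℤ) : ZMod 8) = a.re * a.re - 2 * a.im * a.im := by
      rw [norm_def]; push_cast; rfl
    have h3 : a.norm % 8 = 3 ∨ a.norm % 8 = 5 := by omega
    have h4 : ((a.norm : ℤ) : ZMod 8) = 3 ∨ ((a.norm : ℤ) : ZMod 8) = 5 := by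
      rcases h3 with h3 | h3
      · exact Or.inl ((ZMod.intCast_eq_intCast_iff' _ 3 8).2 h3)
      · exact Or.inr ((ZMod.intCast_eq_intCast_iff' _ 5 8).2 h3)
    rw [h2] at h4
    exact h4.elim (key _ _).1 (key _ _).2

theorem exists_norm_eq_prime (h8 : p % 8 = 1 ∨ p % 8 = 7) : ∃ b : ℤ√2, b.norm = p := by
  obtain ⟨a, ha⟩ := (ZMod.exists_sq_eq_two_iff (p := p) (by omega)).2 h8
  obtain ⟨t, rfl⟩ := ZMod.intCast_surjective a
  have hpt : (p : ℤ) ∣ t * t - 2 := by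
    rw [← ZMod.intCast_zmod_eq_zero_iff_dvd]
    push_cast
    rw [ha, sub_self]
  have hcast : ((p : ℤ) : ℤ√2) = p := by push_cast; rfl
  have hnp : ¬Prime (p : ℤ√2) := by
    intro h
    have h1 : (p : ℤ√2) ∣ ⟨t, 1⟩ * ⟨t, -1⟩ := by
      have : (⟨t, 1⟩ * ⟨t, -1⟩ : ℤ√2) = ((t * t - 2 : ℤ) : ℤ√2) := by ext <;> simp; ring
      rw [this, ← hcast]
      exact (intCast_dvd_intCast _ _).2 hpt
    have hp1 := hp.out.one_lt
    rcases h.dvd_or_dvd h1 with h2 | h2 <;> rw [← hcast, intCast_dvd] at h2 <;>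
      have h3 := Int.le_of_dvd one_pos (by simpa using h2.2) <;> omega
  have hunit : ¬IsUnit (p : ℤ√2) := fun h => by
    have := norm_eq_one_iff.2 h
    rw [norm_natCast, Int.natAbs_mul, Int.natAbs_natCast] at this
    exact hp.out.one_lt.ne' (Nat.eq_one_of_mul_eq_one_right this)
  have hirr : ¬Irreducible (p : ℤ√2) := fun h => hnp h.prime
  rw [irreducible_iff] at hirr
  push Not at hirr
  obtain ⟨a, b, h, ha, hb⟩ := hirr hunit
  have hn := natAbs_norm_eq_of_mul_eq h ha hb
  rcases Int.natAbs_eq a.norm with h1 | h1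
  · exact ⟨a, by rw [h1, hn]⟩
  · refine ⟨silverUnit * a, ?_⟩
    rw [norm_mul, h1, hn, val_silverUnit, norm_def]
    simp

theorem isCoprime_star {b : ℤ√2} (hp2 : p ≠ 2) (hb : b.norm = p) : IsCoprime b (star b) := by
  have hbp : Prime b := prime_of_natAbs_norm_prime (by rw [hb]; exact hp.out)
  rw [hbp.irreducible.coprime_iff_not_dvd]
  intro h
  have hpp : Prime (p : ℤ) := Nat.prime_iff_prime_int.1 hp.out
  have h1 : b ∣ ((2 * b.re : ℤ) : ℤ√2) := by
    have : ((2 * b.re : ℤ) : ℤ√2) = b + star b := by ext <;> simp; ring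
    rw [this]
    exact dvd_add dvd_rfl h
  have h2 : (p : ℤ) ∣ (2 * b.re) * (2 * b.re) := by
    obtain ⟨c, hc⟩ := h1
    have := congrArg norm hc
    rw [norm_intCast, norm_mul, hb] at this
    exact ⟨_, this⟩
  have hp2' : ¬(p : ℤ) ∣ 2 := fun h => hp2 ((Nat.prime_dvd_prime_iff_eq hp.out
    Nat.prime_two).1 (by exact_mod_cast h))
  have h3 : (p : ℤ) ∣ b.re :=
    (hpp.dvd_or_dvd ((hpp.dvd_or_dvd h2).elim id id)).resolve_left hp2'
  rw [norm_def] at hb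
  have h4 : (p : ℤ) ∣ 2 * (b.im * b.im) := by
    rw [show 2 * (b.im * b.im) = b.re * b.re - p by rw [← hb]; ring]
    exact dvd_sub (h3.mul_left _) dvd_rfl
  have h5 : (p : ℤ) ∣ b.im := (hpp.dvd_or_dvd ((hpp.dvd_or_dvd h4).resolve_left hp2')).elim id id
  obtain ⟨x, hx⟩ := h3
  obtain ⟨y, hy⟩ := h5
  have h6 : (p : ℤ) * (p * (x * x - 2 * y * y)) = p * 1 := by
    rw [mul_one]
    nth_rewrite 3 [← hb]
    rw [hx, hy]
    ring
  have h7 := mul_left_cancel₀ hpp.ne_zero h6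
  exact hpp.not_isUnit (IsUnit.of_mul_eq_one _ h7)

theorem squarefree_natCast_prime (hp2 : p ≠ 2) : Squarefree (p : ℤ√2) := by
  have hodd := hp.out.eq_two_or_odd.resolve_left hp2
  by_cases h8 : p % 8 = 3 ∨ p % 8 = 5
  · exact (prime_natCast_of_mod_eight h8).squarefree
  · obtain ⟨b, hb⟩ := exists_norm_eq_prime (p := p) (by omega)
    have hp' : (p : ℤ√2) = b * star b := by rw [← norm_eq_mul_conj, hb]; simp
    rw [hp', squarefree_mul_iff]
    refine ⟨(isCoprime_star hp2 hb).isRelPrime, ?_, ?_⟩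
    · exact (prime_of_natAbs_norm_prime (by rw [hb]; exact hp.out)).squarefree
    · exact (prime_of_natAbs_norm_prime (by rw [norm_conj, hb]; exact hp.out)).squarefree

/-- The number of primes of `ℤ√2` above an odd rational prime. -/
def numPrimesAbove (p : ℕ) : ℕ := if p % 8 = 1 ∨ p % 8 = 7 then 2 else 1

theorem exists_finset_prod_eq_prime (hp2 : p ≠ 2) : ∃ s : Finset (ℤ√2), (∀ b ∈ s, Prime b) ∧
    ∏ b ∈ s, b = p ∧ s.card = numPrimesAbove p := by
  have hodd := hp.out.eq_two_or_odd.resolve_left hp2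
  by_cases h8 : p % 8 = 1 ∨ p % 8 = 7
  · obtain ⟨b, hb⟩ := exists_norm_eq_prime h8
    have hb1 : Prime b := prime_of_natAbs_norm_prime (by rw [hb]; exact hp.out)
    have hb2 : Prime (star b) := prime_of_natAbs_norm_prime (by rw [norm_conj, hb]; exact hp.out)
    have hne : b ≠ star b := fun h => hb1.not_isUnit
      (isCoprime_self.1 (by nth_rewrite 2 [h]; exact isCoprime_star hp2 hb))
    refine ⟨{b, star b}, ?_, ?_, ?_⟩
    · simp [hb1, hb2]
    · rw [Finset.prod_pair hne, ← norm_eq_mul_conj, hb]; simp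
    · rw [Finset.card_pair hne, numPrimesAbove, if_pos h8]
  · refine ⟨{(p : ℤ√2)}, ?_, by simp, by rw [numPrimesAbove, if_neg h8, Finset.card_singleton]⟩
    simp only [Finset.mem_singleton, forall_eq]
    exact prime_natCast_of_mod_eight (by omega)

theorem isCoprime_natCast {m n : ℕ} (h : m.Coprime n) : IsCoprime (m : ℤ√2) n := by
  simpa using (Nat.isCoprime_iff_coprime.2 h).map (Int.castRingHom (ℤ√2))

theorem exists_finset_prod_eq {n : ℕ} (hodd : Odd n) (hsq : Squarefree n) :
    ∃ s : Finset (ℤ√2), (∀ b ∈ s, Prime b) ∧ ∏ b ∈ s, b = n ∧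
      s.card = ∑ p ∈ n.primeFactors, numPrimesAbove p := by
  have h : ∀ p ∈ n.primeFactors, ∃ s : Finset (ℤ√2), (∀ b ∈ s, Prime b) ∧
      ∏ b ∈ s, b = p ∧ s.card = numPrimesAbove p := by
    intro p hp
    have := Fact.mk (Nat.prime_of_mem_primeFactors hp)
    refine exists_finset_prod_eq_prime ?_
    rintro rfl
    exact hodd.not_two_dvd_nat (Nat.dvd_of_mem_primeFactors hp)
  choose! f hf1 hf2 hf3 using h
  have hdisj : (n.primeFactors : Set ℕ).PairwiseDisjoint f := by
    intro p hp q hq hpq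
    rw [Function.onFun, Finset.disjoint_left]
    intro b hbp hbq
    refine (hf1 p hp b hbp).not_isUnit ?_
    refine (isCoprime_natCast ((Nat.coprime_primes (Nat.prime_of_mem_primeFactors hp)
      (Nat.prime_of_mem_primeFactors hq)).2 hpq)).isUnit_of_dvd' ?_ ?_
    · rw [← hf2 p hp]; exact Finset.dvd_prod_of_mem _ hbp
    · rw [← hf2 q hq]; exact Finset.dvd_prod_of_mem _ hbq
  refine ⟨n.primeFactors.biUnion f, ?_, ?_, ?_⟩
  · simp only [Finset.mem_biUnion]
    rintro b ⟨p, hp, hb⟩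
    exact hf1 p hp b hb
  · rw [Finset.prod_biUnion hdisj, Finset.prod_congr rfl hf2, ← Nat.cast_prod,
      Nat.prod_primeFactors_of_squarefree hsq]
  · rw [Finset.card_biUnion hdisj, Finset.sum_congr rfl hf3]

theorem squarefree_natCast {n : ℕ} (hodd : Odd n) (hsq : Squarefree n) :
    Squarefree (n : ℤ√2) := by
  rw [← Nat.prod_primeFactors_of_squarefree hsq, Nat.cast_prod]
  refine Finset.squarefree_prod_of_pairwise_isCoprime ?_ ?_
  · intro p hp q hq hpq
    exact (isCoprime_natCast ((Nat.coprime_primes (Nat.prime_of_mem_primeFactors hp)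
      (Nat.prime_of_mem_primeFactors hq)).2 hpq)).isRelPrime
  · intro p hp
    have := Fact.mk (Nat.prime_of_mem_primeFactors hp)
    refine squarefree_natCast_prime ?_
    rintro rfl
    exact hodd.not_two_dvd_nat (Nat.dvd_of_mem_primeFactors hp)

theorem squarefree_natCast_mul {n : ℕ} (hodd : Odd n) (hsq : Squarefree n) :
    Squarefree ((n : ℤ√2) * ⟨2, 1⟩) := by
  rw [squarefree_mul_iff]
  refine ⟨?_, squarefree_natCast hodd hsq, prime_two_add_sqrtd.squarefree⟩
  have h : IsCoprime (n : ℤ√2) (2 : ℕ) := isCoprime_natCast (Nat.coprime_two_right.2 hodd)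
  have h2 : ((2 : ℕ) : ℤ√2) = ⟨2, 1⟩ * ⟨2, -1⟩ := by decide
  rw [h2] at h
  exact h.of_mul_right_left.isRelPrime

end Zsqrtd

section

open scoped nonZeroDivisors

namespace QuadraticAlgebra

variable {R : Type*} [CommRing R] [IsDomain R] {δ : R}

/-- `u` is, up to a nonzero square, the norm of an element of `R[√δ]`. -/
def IsNormFrom (δ u : R) : Prop :=
  ∃ (z : QuadraticAlgebra R δ 0) (c : R), c ≠ 0 ∧ z.norm = u * c ^ 2

theorem IsNormFrom.mul {u v : R} (hu : IsNormFrom δ u) (hv : IsNormFrom δ v) :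
    IsNormFrom δ (u * v) := by
  obtain ⟨z, c, hc, h⟩ := hu
  obtain ⟨z', c', hc', h'⟩ := hv
  exact ⟨z * z', c * c', mul_ne_zero hc hc', by rw [map_mul, h, h']; ring⟩

theorem IsNormFrom.of_mul_sq {u a : R} (ha : a ≠ 0) (hu : IsNormFrom δ (u * a ^ 2)) :
    IsNormFrom δ u := by
  obtain ⟨z, c, hc, h⟩ := hu
  exact ⟨z, a * c, mul_ne_zero ha hc, by rw [h]; ring⟩

omit [IsDomain R] in
theorem IsNormFrom.mul_sq {u : R} (hu : IsNormFrom δ u) (w : R) : IsNormFrom δ (u * w ^ 2) := by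
  obtain ⟨z, c, hc, h⟩ := hu
  exact ⟨algebraMap R _ w * z, c, hc, by rw [map_mul, norm_algebraMap, h]; ring⟩

theorem isNormFrom_one : IsNormFrom δ 1 := ⟨1, 1, one_ne_zero, by simp⟩

/-- The square class of a unit. -/
def unitClass (v : Rˣ) : SqClass R⁰ := SqClass.mk ⟨v, v.isUnit.mem_nonZeroDivisors⟩

theorem isSquare_of_unitClass_eq [IsIntegrallyClosed R] {v v' : Rˣ} (h : unitClass v = unitClass v') :
    IsSquare (v * v') := by
  obtain ⟨a, b, hab⟩ := SqClass.mk_eq_mk.1 h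
  have hab' : (a : R) ^ 2 * v = (b : R) ^ 2 * v' := congrArg Subtype.val hab
  have ha : (a : R) ≠ 0 := nonZeroDivisors.ne_zero a.2
  have hdvd : (a : R) ∣ b := by
    rw [← IsIntegrallyClosed.pow_dvd_pow_iff two_ne_zero]
    refine ⟨v * (v'⁻¹ : Rˣ), ?_⟩
    rw [← mul_assoc, hab', mul_assoc, Units.mul_inv, mul_one]
  obtain ⟨c, hc⟩ := hdvd
  have h1 : (v : R) = c ^ 2 * v' := by
    refine mul_left_cancel₀ (pow_ne_zero 2 ha) ?_
    rw [hab', hc]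
    ring
  have hcu : IsUnit (c * v') := by
    have : IsUnit (c ^ 2) := isUnit_of_mul_isUnit_left (h1 ▸ v.isUnit)
    exact ((isUnit_pow_iff two_ne_zero).1 this).mul v'.isUnit
  obtain ⟨w, hw⟩ := hcu
  refine ⟨w, Units.ext ?_⟩
  rw [Units.val_mul, Units.val_mul, hw, h1]
  ring

open Classical in
theorem card_isNormFrom [IsIntegrallyClosed R] {V : Finset Rˣ}
    (hV : ∀ u : Rˣ, ∃ v ∈ V, ∃ w : Rˣ, u = v * w ^ 2)
    (hV' : ∀ v ∈ V, ∀ v' ∈ V, IsSquare (v * v') → v = v') :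
    Nat.card {r : SqClass R⁰ | ∃ (u : R⁰) (z : QuadraticAlgebra R δ 0) (c : R), IsUnit (u : R) ∧
      SqClass.mk u = r ∧ c ≠ 0 ∧ z.norm = u * c ^ 2} =
      (V.filter fun v : Rˣ => IsNormFrom δ (v : R)).card := by
  have himg : {r : SqClass R⁰ | ∃ (u : R⁰) (z : QuadraticAlgebra R δ 0) (c : R), IsUnit (u : R) ∧
      SqClass.mk u = r ∧ c ≠ 0 ∧ z.norm = u * c ^ 2} =
      unitClass '' (V.filter fun v : Rˣ => IsNormFrom δ (v : R) : Finset Rˣ) := by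
    ext r
    rw [Set.mem_ofPred_eq, Set.mem_image]
    constructor
    · rintro ⟨u, z, c, ⟨u', hu'⟩, rfl, hc, h⟩
      obtain ⟨v, hv, w, hw⟩ := hV u'
      refine ⟨v, ?_, ?_⟩
      · rw [Finset.mem_coe, Finset.mem_filter]
        refine ⟨hv, IsNormFrom.of_mul_sq w.ne_zero ⟨z, c, hc, ?_⟩⟩
        rw [h, ← hu', hw, Units.val_mul, Units.val_pow_eq_pow_val]
      · refine SqClass.mk_eq_mk.2 ⟨⟨w, w.isUnit.mem_nonZeroDivisors⟩, 1, Subtype.ext ?_⟩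
        simp only [Submonoid.coe_mul, SubmonoidClass.coe_pow, Submonoid.coe_one, ← hu', hw]
        push_cast
        ring
    · rintro ⟨v, hv, rfl⟩
      rw [Finset.mem_coe, Finset.mem_filter] at hv
      obtain ⟨z, c, hc, h⟩ := hv.2
      exact ⟨_, z, c, v.isUnit, rfl, hc, h⟩
  rw [himg, Nat.card_image_of_injOn, Nat.card_coe_set_eq, Set.ncard_coe_finset]
  intro v hv v' hv' h
  rw [Finset.mem_coe, Finset.mem_filter] at hv hv'
  exact hV' v hv.1 v' hv'.1 (isSquare_of_unitClass_eq h)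

end QuadraticAlgebra

/-- An odd prime modulo whose prime divisors in `ℤ[√2]` every unit of `ℤ[√2]` is a square. -/
def IsUnitSquarePrime (p : ℕ) : Prop :=
  p % 8 = 5 ∨ (p % 8 = 1 ∧ quartSym p 2 = (-1) ^ ((p - 1) / 8))

open Classical in
/-- The `2`-rank of the group of those units of `ℤ[√2]`, up to squares, which fail to be norms. -/
noncomputable def unitDefect (n : ℕ) : ℕ :=
  if ∃ p ∈ n.primeFactors, p % 8 = 7 then 2
  else if ∃ p ∈ n.primeFactors, ¬IsUnitSquarePrime p then 1 else 0

namespace Zsqrtd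

open QuadraticAlgebra

variable {n : ℕ}

theorem isNormFrom_of_forall (hodd : Odd n) (hsq : Squarefree n) {u : ℤ√2}
    (h2 : IsNormUpToSq u ⟨2, 1⟩) (h : ∀ p ∈ n.primeFactors, IsNormUpToSq u p) :
    IsNormFrom ((n : ℤ√2) * ⟨2, 1⟩) u := by
  refine exists_norm_eq_of_isNormUpToSq (squarefree_natCast_mul hodd hsq)
    (fun hu => prime_two_add_sqrtd.not_isUnit (isUnit_of_mul_isUnit_right hu)) ?_
  refine IsNormUpToSq.mul ?_ h2
  rw [← Nat.prod_primeFactors_of_squarefree hsq, Nat.cast_prod]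
  exact IsNormUpToSq.prod _ h

theorem isSquareMod_of_isNormFrom (hodd : Odd n) (hsq : Squarefree n) {u : ℤ√2}
    (h : IsNormFrom ((n : ℤ√2) * ⟨2, 1⟩) u) {p : ℕ} (hp : p ∈ n.primeFactors) :
    IsSquareMod u p := by
  obtain ⟨z, c, hc, h⟩ := h
  refine exists_dvd_sq_sub (squarefree_natCast_mul hodd hsq) u hc h (Dvd.dvd.mul_right ?_ _)
  obtain ⟨m, hm⟩ := Nat.dvd_of_mem_primeFactors hp
  exact ⟨m, by exact_mod_cast hm⟩

theorem odd_of_mem_primeFactors (hodd : Odd n) {p : ℕ} (hp : p ∈ n.primeFactors) : p % 2 = 1 :=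
  Nat.odd_iff.1 (hodd.of_dvd_nat (Nat.dvd_of_mem_primeFactors hp))

theorem isNormFrom_neg_one_iff (hodd : Odd n) (hsq : Squarefree n) :
    IsNormFrom ((n : ℤ√2) * ⟨2, 1⟩) (-1) ↔ ∀ p ∈ n.primeFactors, p % 8 ≠ 7 := by
  refine ⟨fun h p hp h7 => ?_, fun h => ?_⟩
  · have := Fact.mk (Nat.prime_of_mem_primeFactors hp)
    exact not_isSquareMod_neg_one h7 (isSquareMod_of_isNormFrom hodd hsq h hp)
  · refine isNormFrom_of_forall hodd hsq isNormUpToSq_neg_one_two_add_sqrtd fun p hp => ?_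
    have := Fact.mk (Nat.prime_of_mem_primeFactors hp)
    exact isNormUpToSq_neg_one (odd_of_mem_primeFactors hodd hp) (h p hp)

theorem isUnitSquarePrime_of_isSquareMod {p : ℕ} [Fact p.Prime] (hp2 : p % 2 = 1) {u : ℤ√2}
    (hu : u = silverUnit ∨ u = -silverUnit) (h : IsSquareMod u p) : IsUnitSquarePrime p := by
  have h4 : p % 4 = 1 := by
    by_contra h4
    refine not_isSquareMod_of_norm_eq_neg_one (p := p) (by omega) (u := u) ?_ h
    rcases hu with rfl | rfl <;> decide
  have h' : IsSquareMod silverUnit p := by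
    rcases hu with rfl | rfl
    · exact h
    · exact isSquareMod_of_neg h4 h
  rcases (by omega : p % 8 = 1 ∨ p % 8 = 5) with h8 | h8
  · exact Or.inr ⟨h8, (isSquareMod_silverUnit_iff_quartSym h8).1 h'⟩
  · exact Or.inl h8

theorem isNormFrom_silverUnit (hodd : Odd n) (hsq : Squarefree n)
    (h : ∀ p ∈ n.primeFactors, IsUnitSquarePrime p) :
    IsNormFrom ((n : ℤ√2) * ⟨2, 1⟩) silverUnit := by
  refine isNormFrom_of_forall hodd hsq isNormUpToSq_two_add_sqrtd fun p hp => ?_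
  have hpp := Fact.mk (Nat.prime_of_mem_primeFactors hp)
  refine isNormUpToSq_silverUnit_natCast hpp.out.pos ?_
  rcases h p hp with h8 | ⟨h8, h⟩
  · exact isSquareMod_silverUnit_of_mod_eight_eq_five h8
  · exact (isSquareMod_silverUnit_iff_quartSym h8).2 h

open Classical in
theorem card_filter_isNormFrom (hodd : Odd n) (hsq : Squarefree n) :
    (unitReps.filter fun v : (ℤ√2)ˣ => IsNormFrom ((n : ℤ√2) * ⟨2, 1⟩) (v : ℤ√2)).card *
      2 ^ unitDefect n = 4 := by
  have h1 : IsNormFrom ((n : ℤ√2) * ⟨2, 1⟩) ((1 : (ℤ√2)ˣ) : ℤ√2) := isNormFrom_one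
  have hneg := isNormFrom_neg_one_iff hodd hsq
  have hneg' : IsNormFrom ((n : ℤ√2) * ⟨2, 1⟩) ((-1 : (ℤ√2)ˣ) : ℤ√2) ↔ _ := hneg
  have hu : ∀ u : (ℤ√2)ˣ, (u : ℤ√2) = silverUnit ∨ (u : ℤ√2) = -silverUnit →
      IsNormFrom ((n : ℤ√2) * ⟨2, 1⟩) (u : ℤ√2) → ∀ p ∈ n.primeFactors, IsUnitSquarePrime p := by
    intro u hu h p hp
    have := Fact.mk (Nat.prime_of_mem_primeFactors hp)
    exact isUnitSquarePrime_of_isSquareMod (odd_of_mem_primeFactors hodd hp) hu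
      (isSquareMod_of_isNormFrom hodd hsq h hp)
  have hu1 := hu silverUnit (Or.inl rfl)
  have hu2 := hu (-silverUnit) (Or.inr rfl)
  unfold unitDefect
  rw [unitReps]
  split_ifs with h7 h5
  · have hn1 : ¬IsNormFrom ((n : ℤ√2) * ⟨2, 1⟩) ((-1 : (ℤ√2)ˣ) : ℤ√2) := fun h =>
      let ⟨p, hp, h8⟩ := h7
      hneg'.1 h p hp h8
    have hns : ¬∀ p ∈ n.primeFactors, IsUnitSquarePrime p := fun h => by
      obtain ⟨p, hp, h8⟩ := h7
      rcases h p hp with h | h <;> omega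
    rw [Finset.filter_insert, if_pos h1, Finset.filter_insert, if_neg hn1, Finset.filter_insert,
      if_neg (fun h => hns (hu1 h)), Finset.filter_singleton, if_neg (fun h => hns (hu2 h))]
    rfl
  · push Not at h7
    have hns : ¬∀ p ∈ n.primeFactors, IsUnitSquarePrime p := by push Not; exact h5
    rw [Finset.filter_insert, if_pos h1, Finset.filter_insert, if_pos (hneg'.2 h7),
      Finset.filter_insert,
      if_neg (fun h => hns (hu1 h)), Finset.filter_singleton, if_neg (fun h => hns (hu2 h))]
    decide
  · push Not at h7 h5
    have hs := isNormFrom_silverUnit hodd hsq h5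
    have hs' : IsNormFrom ((n : ℤ√2) * ⟨2, 1⟩) ((-silverUnit : (ℤ√2)ˣ) : ℤ√2) := by
      have := (hneg.2 h7).mul hs
      rwa [neg_one_mul] at this
    rw [Finset.filter_insert, if_pos h1, Finset.filter_insert, if_pos (hneg'.2 h7),
      Finset.filter_insert, if_pos hs, Finset.filter_singleton, if_pos hs']
    decide

theorem card_selmer_mul (hodd : Odd n) (hsq : Squarefree n)
    [IsDedekindDomain (QuadraticAlgebra (ℤ√2) ((n : ℤ√2) * ⟨2, 1⟩) 0)] :
    Nat.card {q : SqClass (QuadraticAlgebra (ℤ√2) ((n : ℤ√2) * ⟨2, 1⟩) 0)⁰ |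
      ∃ (s : (QuadraticAlgebra (ℤ√2) ((n : ℤ√2) * ⟨2, 1⟩) 0)⁰) (I : Ideal _),
        SqClass.mk s = q ∧ Ideal.span {(s : QuadraticAlgebra (ℤ√2) ((n : ℤ√2) * ⟨2, 1⟩) 0)} = I ^ 2} *
      2 ^ unitDefect n = 2 ^ (4 + ∑ p ∈ n.primeFactors, numPrimesAbove p) := by
  classical
  have hδ := squarefree_natCast_mul hodd hsq
  have h2 : ∀ p : ℤ√2, Prime p → p ∣ 2 → p ∣ (n : ℤ√2) * ⟨2, 1⟩ := fun p hp h =>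
    (dvd_two_add_sqrtd hp h).mul_left _
  obtain ⟨P, hP, hprod, hcard⟩ := exists_finset_prod_eq hodd hsq
  rw [← card_selmerNorm hδ h2, card_isNormFrom exists_unitReps_mul_sq eq_of_isSquare_mul,
    card_base_squares hδ h2 (by decide) exists_unitReps_mul_sq eq_of_isSquare_mul hP
      prime_two_add_sqrtd 1 (by rw [hprod]; simp [mul_comm]), mul_right_comm,
    card_filter_isNormFrom hodd hsq, card_unitReps, hcard, pow_add]
  ring

end Zsqrtd

end

section

open Polynomial

/-- If a ring embeds into two domains, quotients of corresponding elements by an integer are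
simultaneously integral. -/
theorem IsIntegral.of_intCast_mul_eq {T A B : Type*} [CommRing T] [CommRing A] [CommRing B]
    [Algebra ℤ A] [Algebra ℤ B] [IsDomain B] [CharZero B] {f : T →+* A} (hf : Function.Injective f) (g : T →+* B)
    {s : T} {m : ℤ} (hm : m ≠ 0) {x : A} {y : B} (hx : m * x = f s) (hy : m * y = g s)
    (h : IsIntegral ℤ x) : IsIntegral ℤ y := by
  obtain ⟨P, hP, h0⟩ := h
  refine ⟨P, hP, ?_⟩
  have h1 := scaleRoots_eval₂_mul (p := P) (algebraMap ℤ A) x m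
  rw [h0, mul_zero, eq_intCast, hx, ← RingHom.ext_int (f.comp (algebraMap ℤ T)) (algebraMap ℤ A),
    ← hom_eval₂, map_eq_zero_iff f hf] at h1
  have h2 := scaleRoots_eval₂_mul (p := P) (algebraMap ℤ B) y m
  rw [eq_intCast, hy, ← RingHom.ext_int (g.comp (algebraMap ℤ T)) (algebraMap ℤ B), ← hom_eval₂, h1,
    map_zero] at h2
  have hm' : (m : B) ≠ 0 := Int.cast_ne_zero.2 hm
  rw [← RingHom.ext_int (g.comp (algebraMap ℤ T)) (algebraMap ℤ B)]
  exact (mul_eq_zero.1 h2.symm).resolve_left (pow_ne_zero _ hm')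

theorem Squarefree.dvd_of_sq_dvd_mul_sq {R : Type*} [CommRing R] [IsDomain R]
    [UniqueFactorizationMonoid R] {δ m y : R} (hδ : Squarefree δ) (hm : m ≠ 0)
    (h : m ^ 2 ∣ δ * y ^ 2) : m ∣ y := by
  obtain ⟨a, b, c, hab, rfl, rfl⟩ := UniqueFactorizationMonoid.exists_reduced_factors m hm y
  rw [mul_pow, mul_pow, mul_left_comm] at h
  have h1 := (mul_dvd_mul_iff_left (pow_ne_zero 2 (left_ne_zero_of_mul hm))).1 h
  have h2 : a * a ∣ δ := by
    rw [← sq]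
    exact (IsRelPrime.pow hab).dvd_of_dvd_mul_right h1
  exact mul_dvd_mul_left c ((hδ a h2).dvd)

namespace Zsqrtd

theorem intCast_dvd_of_isIntegral {r : ℤ√2} {m : ℤ} (hm : m ≠ 0) {x : ℝ} (hx : m * x = embTwo r)
    (h : IsIntegral ℤ x) : (m : ℤ√2) ∣ r := by
  have hm' : (algebraMap (ℤ√2) (FractionRing (ℤ√2)) (m : ℤ√2)) ≠ 0 :=
    fun h => hm (by
      have := (map_eq_zero_iff _ (IsFractionRing.injective (ℤ√2) (FractionRing (ℤ√2)))).1 h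
      exact_mod_cast this)
  have h1 : IsIntegral ℤ (algebraMap (ℤ√2) (FractionRing (ℤ√2)) r /
      algebraMap (ℤ√2) (FractionRing (ℤ√2)) (m : ℤ√2)) :=
    IsIntegral.of_intCast_mul_eq embTwo_injective
      (algebraMap (ℤ√2) (FractionRing (ℤ√2))) hm hx
      (by rw [← map_intCast (algebraMap (ℤ√2) (FractionRing (ℤ√2))) m, mul_div_cancel₀ _ hm']) h
  obtain ⟨t, ht⟩ := IsIntegrallyClosed.isIntegral_iff.1 (h1.tower_top (A := ℤ√2))
  refine ⟨t, IsFractionRing.injective (ℤ√2) (FractionRing (ℤ√2)) ?_⟩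
  rw [map_mul, ht, mul_div_cancel₀ _ hm']

variable {n : ℕ}

theorem two_add_sqrtd_not_dvd_natCast (hodd : Odd n) : ¬(⟨2, 1⟩ : ℤ√2) ∣ n := by
  intro h
  have h1 : IsCoprime (n : ℤ√2) (2 : ℕ) := isCoprime_natCast (Nat.coprime_two_right.2 hodd)
  refine prime_two_add_sqrtd.not_isUnit (h1.isUnit_of_dvd' h ⟨⟨2, -1⟩, by decide⟩)

theorem two_add_sqrtd_dvd_of_sq_dvd (hodd : Odd n) {a b : ℤ√2}
    (h : (⟨2, 1⟩ : ℤ√2) ^ 2 ∣ a ^ 2 - (n : ℤ√2) * ⟨2, 1⟩ * b ^ 2) :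
    (⟨2, 1⟩ : ℤ√2) ∣ a ∧ (⟨2, 1⟩ : ℤ√2) ∣ b := by
  have hρ := prime_two_add_sqrtd
  have ha : (⟨2, 1⟩ : ℤ√2) ∣ a := by
    refine hρ.dvd_of_dvd_pow (n := 2) ?_
    rw [← sub_add_cancel (a ^ 2) ((n : ℤ√2) * ⟨2, 1⟩ * b ^ 2)]
    exact dvd_add ((dvd_pow_self _ two_ne_zero).trans h) ((dvd_mul_left _ _).mul_right _)
  refine ⟨ha, ?_⟩
  have h1 : (⟨2, 1⟩ : ℤ√2) ^ 2 ∣ (n : ℤ√2) * ⟨2, 1⟩ * b ^ 2 := by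
    rw [← sub_sub_cancel (a ^ 2) ((n : ℤ√2) * ⟨2, 1⟩ * b ^ 2)]
    exact dvd_sub (pow_dvd_pow_of_dvd ha 2) h
  rw [mul_comm (n : ℤ√2), mul_assoc, sq, mul_dvd_mul_iff_left hρ.ne_zero] at h1
  exact hρ.dvd_of_dvd_pow ((hρ.dvd_or_dvd h1).resolve_left (two_add_sqrtd_not_dvd_natCast hodd))

theorem two_dvd_of_four_dvd (hodd : Odd n) {a b : ℤ√2}
    (h : (4 : ℤ√2) ∣ a ^ 2 - (n : ℤ√2) * ⟨2, 1⟩ * b ^ 2) : (2 : ℤ√2) ∣ a ∧ (2 : ℤ√2) ∣ b := by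
  have hρ := prime_two_add_sqrtd
  have h2 : (2 : ℤ√2) ∣ ⟨2, 1⟩ ^ 2 := ⟨⟨3, 2⟩, by decide⟩
  have h4 : (⟨2, 1⟩ : ℤ√2) ^ 2 * ⟨2, 1⟩ ^ 2 ∣ 4 := ⟨⟨17, -12⟩, by decide⟩
  obtain ⟨⟨a, rfl⟩, ⟨b, rfl⟩⟩ :=
    two_add_sqrtd_dvd_of_sq_dvd hodd ((dvd_mul_right _ _).trans (h4.trans h))
  have h5 : (⟨2, 1⟩ : ℤ√2) ^ 2 ∣ a ^ 2 - (n : ℤ√2) * ⟨2, 1⟩ * b ^ 2 := by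
    rw [← mul_dvd_mul_iff_left (pow_ne_zero 2 hρ.ne_zero)]
    refine (h4.trans h).trans (dvd_of_eq ?_)
    ring
  obtain ⟨⟨a, rfl⟩, ⟨b, rfl⟩⟩ := two_add_sqrtd_dvd_of_sq_dvd hodd h5
  rw [← mul_assoc, ← mul_assoc, ← sq]
  exact ⟨h2.mul_right _, h2.mul_right _⟩

/-- If twice the entries of `z` and the norm of `z` are divisible by `m` and `m ^ 2`, then `z` is
divisible by `m`. -/
theorem dvd_of_dvd_two_mul (hodd : Odd n) (hsq : Squarefree n) {a b m : ℤ√2} (hm : m ≠ 0)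
    (h1 : m ∣ 2 * a) (h2 : m ^ 2 ∣ a ^ 2 - (n : ℤ√2) * ⟨2, 1⟩ * b ^ 2) : m ∣ a ∧ m ∣ b := by
  have h3 : m ∣ 2 * b := by
    refine (squarefree_natCast_mul hodd hsq).dvd_of_sq_dvd_mul_sq hm ?_
    have : (n : ℤ√2) * ⟨2, 1⟩ * (2 * b) ^ 2 =
      (2 * a) ^ 2 - 4 * (a ^ 2 - (n : ℤ√2) * ⟨2, 1⟩ * b ^ 2) := by ring
    rw [this]
    exact dvd_sub (pow_dvd_pow_of_dvd h1 2) (h2.mul_left _)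
  obtain ⟨A, hA⟩ := h1
  obtain ⟨B, hB⟩ := h3
  obtain ⟨C, hC⟩ := h2
  have h4 : (4 : ℤ√2) ∣ A ^ 2 - (n : ℤ√2) * ⟨2, 1⟩ * B ^ 2 := by
    refine ⟨C, mul_left_cancel₀ (pow_ne_zero 2 hm) ?_⟩
    linear_combination -(2 * a + m * A) * hA + (n : ℤ√2) * ⟨2, 1⟩ * (2 * b + m * B) * hB + 4 * hC
  obtain ⟨⟨A, rfl⟩, ⟨B, rfl⟩⟩ := two_dvd_of_four_dvd hodd h4
  have h20 : (2 : ℤ√2) ≠ 0 := two_ne_zero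
  exact ⟨⟨A, mul_left_cancel₀ h20 (by rw [hA]; ring)⟩,
    ⟨B, mul_left_cancel₀ h20 (by rw [hB]; ring)⟩⟩

end Zsqrtd

end

section

open Zsqrtd

/-- The order `ℤ[√2][√(n(2 + √2))]`. -/
abbrev QuarticOrder (n : ℕ) : Type := QuadraticAlgebra (ℤ√2) ((n : ℤ√2) * ⟨2, 1⟩) 0

namespace QuarticOrder

/-- The positive real square root of `n(1 + √2)√2 = n(2 + √2)`. -/
noncomputable def root (n : ℕ) : ℝ := √((n : ℝ) * ((1 : ℝ) + √2) * √2)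

theorem root_sq (n : ℕ) : root n ^ 2 = embTwo ((n : ℤ√2) * ⟨2, 1⟩) := by
  rw [root, Real.sq_sqrt (by positivity), map_mul, map_natCast, embTwo_apply]
  push_cast
  linear_combination (n : ℝ) * Real.sq_sqrt (zero_le_two (α := ℝ))

variable {n : ℕ}

/-- The embedding of the quartic order in the real numbers. -/
noncomputable def emb (n : ℕ) : QuarticOrder n →+* ℝ where
  toFun z := embTwo z.re + embTwo z.im * root n
  map_one' := by
    rw [QuadraticAlgebra.re_one, QuadraticAlgebra.im_one, map_one, map_zero, zero_mul, add_zero]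
  map_zero' := by
    rw [QuadraticAlgebra.re_zero, QuadraticAlgebra.im_zero, map_zero, zero_mul, add_zero]
  map_add' x y := by
    rw [QuadraticAlgebra.re_add, QuadraticAlgebra.im_add, map_add, map_add]
    ring
  map_mul' x y := by
    simp only [QuadraticAlgebra.re_mul, QuadraticAlgebra.im_mul, map_add, map_mul _ (_ * x.im),
      map_mul _ _ x.im, ← root_sq]
    simp only [map_mul, map_zero]
    ring

theorem emb_apply (z : QuarticOrder n) : emb n z = embTwo z.re + embTwo z.im * root n := rfl

theorem emb_algebraMap (r : ℤ√2) : emb n (algebraMap _ _ r) = embTwo r := by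
  rw [emb_apply, QuadraticAlgebra.algebraMap_re, QuadraticAlgebra.algebraMap_im, map_zero,
    zero_mul, add_zero]

theorem emb_mul_star (z : QuarticOrder n) : emb n z * emb n (star z) = embTwo z.norm := by
  rw [← map_mul, ← QuadraticAlgebra.algebraMap_norm_eq_mul_star, emb_algebraMap]

theorem emb_star (z : QuarticOrder n) : emb n (star z) = embTwo z.re - embTwo z.im * root n := by
  rw [emb_apply, QuadraticAlgebra.re_star, QuadraticAlgebra.im_star, zero_mul, add_zero,
    map_neg, neg_mul, sub_eq_add_neg]

theorem norm_eq_zero (hn : n ≠ 0) {z : QuarticOrder n} (hz : z.norm = 0) : z = 0 := by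
  rw [QuadraticAlgebra.norm_eq_re_sq_sub, sub_eq_zero] at hz
  have h1 := congrArg Zsqrtd.norm hz
  rw [sq, sq, norm_mul, norm_mul, norm_mul, norm_mul, norm_natCast,
    show norm (⟨2, 1⟩ : ℤ√2) = 2 from rfl] at h1
  have h2 : (⟨z.re.norm, n * z.im.norm⟩ : ℤ√2).norm = 0 := by
    rw [norm_def]
    simp only
    linear_combination h1
  have h3 := norm_two_eq_zero.1 h2
  rw [Zsqrtd.ext_iff] at h3
  have h4 : z.im.norm = 0 := by simpa [hn] using h3.2
  exact QuadraticAlgebra.ext (norm_two_eq_zero.1 h3.1) (norm_two_eq_zero.1 h4)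

theorem emb_injective (hn : n ≠ 0) : Function.Injective (emb n) := by
  rw [injective_iff_map_eq_zero]
  intro z hz
  refine norm_eq_zero hn (embTwo_injective ?_)
  rw [← emb_mul_star, hz, zero_mul, map_zero]

theorem isIntegral_emb (z : QuarticOrder n) : IsIntegral ℤ (emb n z) := by
  have h1 : ∀ r : ℤ√2, IsIntegral ℤ (embTwo r) := by
    intro r
    rw [embTwo_apply]
    refine (isIntegral_algebraMap (R := ℤ) (x := r.re)).add
      ((isIntegral_algebraMap (R := ℤ) (x := r.im)).mul (IsIntegral.of_pow two_pos ?_))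
    rw [Real.sq_sqrt zero_le_two]
    exact isIntegral_algebraMap (R := ℤ) (x := 2)
  refine (h1 _).add ((h1 _).mul (IsIntegral.of_pow two_pos ?_))
  rw [root_sq]
  exact h1 _

theorem mem_range_of_isIntegral (hodd : Odd n) (hsq : Squarefree n) {m : ℤ} (hm : m ≠ 0)
    {s : QuarticOrder n} {x : ℝ} (hx : m * x = emb n s) (h : IsIntegral ℤ x) :
    x ∈ (emb n).range := by
  have hn : n ≠ 0 := hsq.ne_zero
  have hmR : (m : ℝ) ≠ 0 := Int.cast_ne_zero.2 hm
  set y : ℝ := emb n (star s) / m with hy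
  have hy' : m * y = emb n (star s) := mul_div_cancel₀ _ hmR
  have h' : IsIntegral ℤ y := by
    refine IsIntegral.of_intCast_mul_eq (emb_injective hn)
      ((emb n).comp (starRingEnd (QuarticOrder n))) hm hx ?_ h
    exact hy'
  have htr : m * (x + y) = embTwo (2 * s.re) := by
    rw [mul_add, hx, hy', emb_apply, emb_star, map_mul, map_ofNat]
    ring
  have hnorm : ((m ^ 2 : ℤ) : ℝ) * (x * y) = embTwo s.norm := by
    rw [← emb_mul_star, ← hx, ← hy']
    push_cast
    ring
  have h1 := intCast_dvd_of_isIntegral hm htr (h.add h')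
  have h2 := intCast_dvd_of_isIntegral (pow_ne_zero 2 hm) hnorm (h.mul h')
  rw [Int.cast_pow, QuadraticAlgebra.norm_eq_re_sq_sub] at h2
  obtain ⟨⟨a, ha⟩, ⟨b, hb⟩⟩ := dvd_of_dvd_two_mul hodd hsq (Int.cast_ne_zero.2 hm) h1 h2
  refine ⟨⟨a, b⟩, mul_left_cancel₀ hmR ?_⟩
  rw [hx, emb_apply, emb_apply, ha, hb, map_mul, map_mul, map_intCast]
  ring

open IntermediateField

theorem exists_intCast_mul_eq (hn : n ≠ 0) {x : ℝ} (hx : x ∈ adjoin ℚ {root n}) :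
    ∃ (m : ℤ) (s : QuarticOrder n), m ≠ 0 ∧ m * x = emb n s := by
  induction hx using adjoin_induction with
  | mem x hx =>
    rw [Set.mem_singleton_iff] at hx
    exact ⟨1, ⟨0, 1⟩, one_ne_zero, by rw [hx, emb_apply]; simp⟩
  | algebraMap q =>
    refine ⟨q.den, (q.num : QuarticOrder n), by exact_mod_cast q.den_ne_zero, ?_⟩
    rw [map_intCast]
    have := Rat.den_mul_eq_num q
    simp only [eq_ratCast, Int.cast_natCast]
    exact_mod_cast this
  | add x y _ _ hx hy =>
    obtain ⟨m, s, hm, h⟩ := hx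
    obtain ⟨m', s', hm', h'⟩ := hy
    refine ⟨m * m', m' * s + m * s', mul_ne_zero hm hm', ?_⟩
    rw [map_add, map_mul, map_mul, map_intCast, map_intCast, ← h, ← h']
    push_cast
    ring
  | mul x y _ _ hx hy =>
    obtain ⟨m, s, hm, h⟩ := hx
    obtain ⟨m', s', hm', h'⟩ := hy
    refine ⟨m * m', s * s', mul_ne_zero hm hm', ?_⟩
    rw [map_mul, ← h, ← h']
    push_cast
    ring
  | inv x _ hx =>
    obtain ⟨m, s, hm, h⟩ := hx
    have hmR : (m : ℝ) ≠ 0 := Int.cast_ne_zero.2 hm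
    by_cases hx0 : x = 0
    · exact ⟨1, 0, one_ne_zero, by simp [hx0]⟩
    have hs : s.norm ≠ 0 := by
      intro h0
      rw [norm_eq_zero hn h0, map_zero] at h
      exact mul_ne_zero hmR hx0 h
    have hN : s.norm.norm ≠ 0 := fun h => hs (norm_two_eq_zero.1 h)
    refine ⟨s.norm.norm, m * star s * algebraMap _ _ (star s.norm), hN, ?_⟩
    rw [map_mul, map_mul, map_intCast, emb_algebraMap, ← embTwo_mul_star, ← emb_mul_star, ← h]
    field_simp

theorem emb_mem_adjoin (hn : n ≠ 0) (z : QuarticOrder n) : emb n z ∈ adjoin ℚ {root n} := by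
  have h1 : root n ∈ adjoin ℚ {root n} := mem_adjoin_simple_self ℚ _
  have h2 : √2 ∈ adjoin ℚ {root n} := by
    have : √2 = root n ^ 2 / n - 2 := by
      have hn' : (n : ℝ) ≠ 0 := by exact_mod_cast hn
      rw [root_sq, map_mul, map_natCast, embTwo_apply]
      push_cast
      field_simp
      ring
    rw [this]
    exact sub_mem (div_mem (pow_mem h1 2) (_root_.natCast_mem _ n)) (_root_.ofNat_mem _ 2)
  have h3 : ∀ r : ℤ√2, embTwo r ∈ adjoin ℚ {root n} := fun r => by
    rw [embTwo_apply]
    exact add_mem (_root_.intCast_mem _ _) (mul_mem (_root_.intCast_mem _ _) h2)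
  rw [emb_apply]
  exact add_mem (h3 _) (mul_mem (h3 _) h1)

/-- The ring of integers of `ℚ(√(n(2 + √2)))`. -/
theorem nonempty_ringEquiv (hodd : Odd n) (hsq : Squarefree n) {K : IntermediateField ℚ ℝ}
    (hK : K = adjoin ℚ {root n}) : Nonempty (NumberField.RingOfIntegers K ≃+* QuarticOrder n) := by
  have hn : n ≠ 0 := hsq.ne_zero
  set f : NumberField.RingOfIntegers K →+* ℝ :=
    (algebraMap K ℝ).comp (algebraMap (NumberField.RingOfIntegers K) K) with hf
  have hfinj : Function.Injective f :=
    (algebraMap K ℝ).injective.comp NumberField.RingOfIntegers.coe_injective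
  have hrange : f.range = (emb n).range := by
    ext x
    constructor
    · rintro ⟨a, rfl⟩
      have hmem : f a ∈ adjoin ℚ {root n} := by rw [← hK]; exact (a : K).2
      obtain ⟨m, s, hm, h⟩ := exists_intCast_mul_eq hn hmem
      exact mem_range_of_isIntegral hodd hsq hm h
        ((NumberField.RingOfIntegers.isIntegral_coe a).algebraMap (B := ℝ))
    · rintro ⟨z, rfl⟩
      have hmem := emb_mem_adjoin hn z
      rw [← hK] at hmem
      refine ⟨⟨⟨emb n z, hmem⟩, ?_⟩, rfl⟩
      exact (isIntegral_algebraMap_iff (algebraMap K ℝ).injective).1 (isIntegral_emb z)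
  exact ⟨((RingEquiv.ofBijective f.rangeRestrict
    ⟨fun a b h => hfinj (congrArg (Subtype.val : f.range → ℝ) h), f.rangeRestrict_surjective⟩).trans
    (RingEquiv.subringCongr hrange)).trans (RingEquiv.ofBijective (emb n).rangeRestrict
    ⟨fun a b h => emb_injective hn
      (congrArg (Subtype.val : (emb n).range → ℝ) h), (emb n).rangeRestrict_surjective⟩).symm⟩

end QuarticOrder

end

section

open NumberField QuadraticAlgebra

namespace NumberField.Units

variable {K : Type*} [Field K]

theorem eq_one_or_eq_neg_one_of_mem_torsion (f : K →+* ℝ) {ζ : (𝓞 K)ˣ} (hζ : ζ ∈ torsion K) :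
    ζ = 1 ∨ ζ = -1 := by
  obtain ⟨k, hk, h⟩ := isOfFinOrder_iff_pow_eq_one.1 ((CommGroup.mem_torsion _).1 hζ)
  have h1 : f (ζ : K) ^ k = 1 := by rw [← map_pow, ← coe_pow, h, coe_one, map_one]
  have h2 : |f (ζ : K)| = 1 := by
    rw [← pow_eq_one_iff_of_nonneg (abs_nonneg _) hk.ne', ← abs_pow, h1, abs_one]
  rcases eq_or_eq_neg_of_abs_eq h2 with h3 | h3
  · left
    exact coe_injective K (f.injective (h3.trans (by simp)))
  · right
    exact coe_injective K (f.injective (h3.trans (by simp)))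

variable [NumberField K]

/-- A unit determined by a sign and a set of fundamental units. -/
noncomputable def ofBool (x : Bool × (Fin (rank K) → Bool)) : (𝓞 K)ˣ :=
  (if x.1 then -1 else 1) * ∏ i, fundSystem K i ^ (if x.2 i then 1 else 0 : ℤ)

theorem ofBool_injective_mod_squares (f : K →+* ℝ) {x y : Bool × (Fin (rank K) → Bool)}
    (h : IsSquare (ofBool x * ofBool y)) : x = y := by
  obtain ⟨w, hw⟩ := h
  obtain ⟨⟨ζ, e⟩, hζ, -⟩ := exist_unique_eq_mul_prod K w
  have hζ2 : (ζ : (𝓞 K)ˣ) * ζ = 1 := by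
    rcases eq_one_or_eq_neg_one_of_mem_torsion f ζ.2 with h | h <;> rw [h] <;> simp
  have hneg : (-1 : (𝓞 K)ˣ) ∈ torsion K :=
    (CommGroup.mem_torsion _).2 (isOfFinOrder_iff_pow_eq_one.2 ⟨2, two_pos, by simp⟩)
  have hs : ∀ b : Bool, (if b then -1 else 1 : (𝓞 K)ˣ) ∈ torsion K := by
    intro b
    cases b
    · exact one_mem _
    · exact hneg
  obtain ⟨z, -, huniq⟩ := exist_unique_eq_mul_prod K (w * w)
  have h1 := huniq (1, fun i => 2 * e i) (by
    rw [hζ]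
    simp only [OneMemClass.coe_one, one_mul]
    rw [mul_mul_mul_comm, hζ2, one_mul, ← Finset.prod_mul_distrib]
    exact Finset.prod_congr rfl fun i _ => by rw [two_mul, zpow_add])
  have h2 := huniq (⟨_, mul_mem (hs x.1) (hs y.1)⟩,
    fun i => (if x.2 i then 1 else 0) + (if y.2 i then 1 else 0)) (by
    rw [← hw, ofBool, ofBool, mul_mul_mul_comm, ← Finset.prod_mul_distrib]
    exact congrArg _ (Finset.prod_congr rfl fun i _ => by rw [zpow_add]))
  have h3 := h1.trans h2.symm
  rw [Prod.mk.injEq] at h3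
  have hne : (-1 : (𝓞 K)ˣ) ≠ 1 := by
    intro h
    have h4 := congrArg (fun u : (𝓞 K)ˣ => f (u : K)) h
    simp only [coe_neg_one, coe_one, map_neg, map_one] at h4
    norm_num at h4
  refine Prod.ext ?_ (funext fun i => ?_)
  · have h4 := congrArg Subtype.val h3.1
    simp only [OneMemClass.coe_one] at h4
    cases hx : x.1 <;> cases hy : y.1 <;> simp [hx, hy, hne.symm] at h4 ⊢
  · have h4 := congrFun h3.2 i
    cases hx : x.2 i <;> cases hy : y.2 i <;> simp only [hx, hy] at h4 ⊢ <;> simp at h4 <;> omega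

theorem exists_eq_ofBool_mul_sq (f : K →+* ℝ) (u : (𝓞 K)ˣ) :
    ∃ (x : Bool × (Fin (rank K) → Bool)) (w : (𝓞 K)ˣ), u = ofBool x * w ^ 2 := by
  obtain ⟨⟨ζ, e⟩, hζ, -⟩ := exist_unique_eq_mul_prod K u
  obtain ⟨b, hb⟩ : ∃ b : Bool, (ζ : (𝓞 K)ˣ) = if b then -1 else 1 := by
    rcases eq_one_or_eq_neg_one_of_mem_torsion f ζ.2 with h | h
    · exact ⟨false, h⟩
    · exact ⟨true, h⟩
  refine ⟨(b, fun i => decide (e i % 2 = 1)), ∏ i, fundSystem K i ^ (e i / 2), ?_⟩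
  rw [hζ, ofBool, hb, mul_assoc, ← Finset.prod_pow, ← Finset.prod_mul_distrib]
  refine congrArg _ (Finset.prod_congr rfl fun i _ => ?_)
  rw [← zpow_natCast, ← zpow_mul, ← zpow_add]
  congr 1
  simp only [decide_eq_true_eq]
  split_ifs <;> push_cast <;> omega

open scoped nonZeroDivisors in
theorem card_unit_sqClasses (f : K →+* ℝ) {S : Type*} [CommRing S] [IsDomain S]
    [IsIntegrallyClosed S] (e : 𝓞 K ≃+* S) :
    Nat.card {q : SqClass S⁰ | ∃ s : S⁰, IsUnit (s : S) ∧ SqClass.mk s = q} =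
      2 ^ (rank K + 1) := by
  set g : (𝓞 K)ˣ ≃* Sˣ := _root_.Units.mapEquiv e.toMulEquiv
  have hrange : {q : SqClass S⁰ | ∃ s : S⁰, IsUnit (s : S) ∧ SqClass.mk s = q} =
      Set.range fun x => unitClass (g (ofBool x)) := by
    ext q
    constructor
    · rintro ⟨s, ⟨u, hu⟩, rfl⟩
      obtain ⟨x, w, h⟩ := exists_eq_ofBool_mul_sq f (g.symm u)
      refine ⟨x, ?_⟩
      have hgu : u = g (ofBool x) * g w ^ 2 := by
        rw [← map_pow, ← map_mul, ← h, MulEquiv.apply_symm_apply]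
      have hs : s = ⟨g (ofBool x), (g (ofBool x)).isUnit.mem_nonZeroDivisors⟩ *
          ⟨g w, (g w).isUnit.mem_nonZeroDivisors⟩ ^ 2 := Subtype.ext (by
        rw [← hu, hgu]
        rfl)
      rw [hs, SqClass.mk_mul_sq]
      rfl
    · rintro ⟨x, rfl⟩
      exact ⟨_, (g (ofBool x)).isUnit, rfl⟩
  have hinj : Function.Injective fun x => unitClass (g (ofBool x)) := fun x y h => by
    obtain ⟨w, hw⟩ := isSquare_of_unitClass_eq h
    refine ofBool_injective_mod_squares f ⟨g.symm w, g.injective ?_⟩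
    rw [map_mul, hw, map_mul, MulEquiv.apply_symm_apply]
  rw [hrange, Nat.card_range_of_injective hinj, Nat.card_eq_fintype_card]
  simp [pow_succ, mul_comm]

end NumberField.Units

namespace QuarticOrder

open IntermediateField

variable {n : ℕ} {K : IntermediateField ℚ ℝ} [NumberField K]

theorem finrank_eq_four (hodd : Odd n) (hsq : Squarefree n) (hK : K = adjoin ℚ {root n}) :
    Module.finrank ℚ K = 4 := by
  obtain ⟨e⟩ := nonempty_ringEquiv hodd hsq hK
  have e' : 𝓞 K ≃+ (ℤ × ℤ) × (ℤ × ℤ) := e.toAddEquiv.trans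
    { toFun := fun z => ((z.re.re, z.re.im), (z.im.re, z.im.im))
      invFun := fun w => ⟨⟨w.1.1, w.1.2⟩, ⟨w.2.1, w.2.2⟩⟩
      left_inv := fun _ => rfl
      right_inv := fun _ => rfl
      map_add' := fun _ _ => rfl }
  rw [← RingOfIntegers.rank K, e'.toIntLinearEquiv.finrank_eq]
  simp

omit [NumberField K] in
theorem isTotallyReal (hn : n ≠ 0) (hK : K = adjoin ℚ {root n}) : IsTotallyReal K := by
  refine ⟨fun v => ?_⟩
  rw [InfinitePlace.isReal_iff, ComplexEmbedding.isReal_iff]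
  set φ := v.embedding
  suffices h : (ComplexEmbedding.conjugate φ).toRatAlgHom = φ.toRatAlgHom by
    exact congrArg AlgHom.toRingHom h
  refine algHom_ext_of_eq_adjoin ℚ (K := ℂ) hK ?_
  intro x hx
  rw [Set.mem_singleton_iff] at hx
  subst hx
  set θ : K := ⟨root n, _⟩ with hθ
  change (starRingEnd ℂ) (φ θ) = φ θ
  have h2 : √2 ^ 2 = 2 := Real.sq_sqrt zero_le_two
  have h1 : (θ ^ 2 - 2 * (n : K)) ^ 2 = 2 * (n : K) ^ 2 := by
    refine Subtype.ext ?_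
    change (root n ^ 2 - 2 * (n : ℝ)) ^ 2 = 2 * (n : ℝ) ^ 2
    rw [root_sq, map_mul, map_natCast, Zsqrtd.embTwo_apply]
    push_cast
    linear_combination (n : ℝ) ^ 2 * h2
  have h3 : (φ θ ^ 2 - 2 * (n : ℂ)) ^ 2 = ((n * √2 : ℝ) : ℂ) ^ 2 := by
    have := congrArg φ h1
    simp only [map_pow, map_sub, map_mul, map_natCast, map_ofNat] at this
    rw [this]
    norm_cast
    rw [mul_pow, h2]
    push_cast
    ring
  have h4 : ∃ c : ℝ, 0 ≤ c ∧ φ θ ^ 2 = c := by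
    have hlt : √2 ≤ 2 := by nlinarith [Real.sqrt_nonneg 2]
    rcases sq_eq_sq_iff_eq_or_eq_neg.1 h3 with h | h
    · exact ⟨2 * n + n * √2, by positivity, by
        push_cast at h ⊢; linear_combination h⟩
    · exact ⟨2 * n - n * √2, by nlinarith [(Nat.cast_nonneg n : (0 : ℝ) ≤ n)], by
        push_cast at h ⊢; linear_combination h⟩
  obtain ⟨c, hc, h⟩ := h4
  have h5 : φ θ ^ 2 = ((√c : ℝ) : ℂ) ^ 2 := by
    rw [h, ← Complex.ofReal_pow, Real.sq_sqrt hc]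
  rcases sq_eq_sq_iff_eq_or_eq_neg.1 h5 with h | h <;> rw [h]
  · exact Complex.conj_ofReal _
  · rw [map_neg, Complex.conj_ofReal]

theorem rank_eq_three (hodd : Odd n) (hsq : Squarefree n) (hK : K = adjoin ℚ {root n}) :
    Units.rank K = 3 := by
  have := isTotallyReal hsq.ne_zero hK
  have h1 := IsTotallyReal.finrank K
  rw [finrank_eq_four hodd hsq hK] at h1
  rw [Units.rank, InfinitePlace.card_eq_nrRealPlaces_add_nrComplexPlaces, ← h1,
    IsTotallyReal.nrComplexPlaces_eq_zero]

open scoped nonZeroDivisors in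
/-- The order of the `2`-torsion of the class group of `ℚ(√(n(2 + √2)))`. -/
theorem card_classGroup_two_torsion (hodd : Odd n) (hsq : Squarefree n)
    (hK : K = adjoin ℚ {root n}) :
    Nat.card {c : ClassGroup (𝓞 K) // c ^ 2 = 1} * 2 ^ unitDefect n =
      2 ^ ∑ p ∈ n.primeFactors, Zsqrtd.numPrimesAbove p := by
  obtain ⟨e⟩ := nonempty_ringEquiv hodd hsq hK
  have hdom : IsDomain (QuarticOrder n) := e.symm.toMulEquiv.isDomain
  have hclosed : IsIntegrallyClosed (QuarticOrder n) := .of_equiv e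
  have hnoeth : IsNoetherianRing (QuarticOrder n) := isNoetherianRing_of_ringEquiv _ e
  have hdim : Ring.DimensionLEOne (QuarticOrder n) := .of_ringEquiv e.symm
  have hD : IsDedekindDomain (QuarticOrder n) := { }
  have h1 := card_two_torsion_mul_card_units (S := QuarticOrder n)
  have h2 := Zsqrtd.card_selmer_mul hodd hsq
  rw [← h1, Units.card_unit_sqClasses (algebraMap K ℝ) e, rank_eq_three hodd hsq hK, pow_add,
    mul_right_comm, mul_comm] at h2
  rw [← pow_add, pow_add 2 4] at h2
  have h3 := Nat.eq_of_mul_eq_mul_left (by positivity) h2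
  rw [← h3]
  congr 1
  refine Nat.card_congr ((ClassGroup.mulEquiv e).toEquiv.subtypeEquiv fun c => ?_)
  change c ^ 2 = 1 ↔ ClassGroup.mulEquiv e c ^ 2 = 1
  rw [← map_pow, map_eq_one_iff _ (ClassGroup.mulEquiv e).injective]

end QuarticOrder

end

theorem legSym_two {p : ℕ} (hp : p.Prime) (hodd : p % 2 = 1) :
    legSym p 2 = if p % 8 = 1 ∨ p % 8 = 7 then 1 else -1 := by
  have := Fact.mk hp
  have hp2 : p ≠ 2 := by rintro rfl; simp at hodd
  have h2 : (2 : ZMod p) ≠ 0 := by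
    have := ZMod.prime_ne_zero p 2 hp2
    exact_mod_cast this
  have h := (ZMod.exists_sq_eq_two_iff hp2).symm.trans (ZMod.euler_criterion p h2)
  rw [show p / 2 = (p - 1) / 2 by lia] at h
  unfold legSym
  push_cast
  simp only [← h, if_neg h2]

theorem legSym_two_eq_or {p : ℕ} (hp : p.Prime) (hodd : p % 2 = 1) :
    legSym p 2 = 1 ∨ legSym p 2 = -1 := by
  rw [legSym_two hp hodd]
  split_ifs <;> simp

namespace Zsqrtd

theorem numPrimesAbove_eq {p : ℕ} (hp : p.Prime) (hodd : p % 2 = 1) :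
    numPrimesAbove p = if legSym p 2 = 1 then 2 else 1 := by
  rw [legSym_two hp hodd, numPrimesAbove]
  split_ifs <;> simp_all

end Zsqrtd

/-- The condition on the prime factors of `n` for the `2`-rank of the class group to be three. -/
def HasRankThree (n : ℕ) : Prop :=
  ∑ p ∈ n.primeFactors, Zsqrtd.numPrimesAbove p = 3 + unitDefect n

/-- The fourth power symbols `(2/p)₄` and `(p/2)₄` agree. -/
def QuartEq (p : ℕ) : Prop := quartSym p 2 = (-1) ^ ((p - 1) / 8)

open Classical in
theorem hasRankThree_iff {n : ℕ} {s t : Finset ℕ}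
    (hs : ∀ p ∈ s, p.Prime ∧ p % 4 = 1) (ht : ∀ q ∈ t, q.Prime ∧ q % 4 = 3)
    (hn : n = (∏ p ∈ s, p) * ∏ q ∈ t, q) :
    HasRankThree n ↔
      (∑ p ∈ s, if legSym p 2 = 1 then 2 else 1) + (∑ q ∈ t, if legSym q 2 = 1 then 2 else 1) =
        3 + if ∃ q ∈ t, legSym q 2 = 1 then 2
          else if t.Nonempty ∨ ∃ p ∈ s, legSym p 2 = 1 ∧ ¬QuartEq p then 1 else 0 := by
  have hdisj : Disjoint s t := Finset.disjoint_left.2 fun p h h' => by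
    have := (hs p h).2
    have := (ht p h').2
    lia
  have hprime : ∀ p ∈ s ∪ t, p.Prime := fun p h =>
    (Finset.mem_union.1 h).elim (fun h => (hs p h).1) fun h => (ht p h).1
  have hfac : n.primeFactors = s ∪ t := by
    rw [hn, ← Finset.prod_union hdisj, Nat.primeFactors_prod hprime]
  have h7 : (∃ p ∈ s ∪ t, p % 8 = 7) ↔ ∃ q ∈ t, legSym q 2 = 1 := by
    constructor
    · rintro ⟨p, h, h7⟩
      rcases Finset.mem_union.1 h with h | h
      · have := (hs p h).2
        lia
      · exact ⟨p, h, by rw [legSym_two (ht p h).1 (by lia), if_pos (Or.inr h7)]⟩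
    · rintro ⟨q, h, h1⟩
      have h3 := (ht q h).2
      refine ⟨q, Finset.mem_union_right _ h, ?_⟩
      rw [legSym_two (ht q h).1 (by lia)] at h1
      split_ifs at h1
      lia
  have hu : (∃ p ∈ s ∪ t, ¬IsUnitSquarePrime p) ↔
      t.Nonempty ∨ ∃ p ∈ s, legSym p 2 = 1 ∧ ¬QuartEq p := by
    constructor
    · rintro ⟨p, h, hne⟩
      rcases Finset.mem_union.1 h with h | h
      · have h1 := (hs p h).2
        rw [IsUnitSquarePrime, not_or, not_and] at hne
        exact Or.inr ⟨p, h, by rw [legSym_two (hs p h).1 (by lia), if_pos (by lia)],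
          hne.2 (by lia)⟩
      · exact Or.inl ⟨p, h⟩
    · rintro (⟨q, h⟩ | ⟨p, h, h1, hne⟩)
      · refine ⟨q, Finset.mem_union_right _ h, ?_⟩
        have h3 := (ht q h).2
        rintro (h' | ⟨h', -⟩) <;> lia
      · refine ⟨p, Finset.mem_union_left _ h, ?_⟩
        rintro (h' | ⟨-, h'⟩)
        · rw [legSym_two (hs p h).1 (by lia), if_neg (by lia)] at h1
          simp at h1
        · exact hne h'
  rw [HasRankThree, unitDefect, hfac, Finset.sum_union hdisj,
    Finset.sum_congr rfl fun p h =>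
      Zsqrtd.numPrimesAbove_eq (hs p h).1 (by have := (hs p h).2; lia),
    Finset.sum_congr (s₁ := t) rfl fun p h =>
      Zsqrtd.numPrimesAbove_eq (ht p h).1 (by have := (ht p h).2; lia)]
  simp only [h7, hu]

theorem HasRankThree.card_cases {n : ℕ} {s t : Finset ℕ}
    (hs : ∀ p ∈ s, p.Prime ∧ p % 4 = 1) (ht : ∀ q ∈ t, q.Prime ∧ q % 4 = 3)
    (hn : n = (∏ p ∈ s, p) * ∏ q ∈ t, q) (h : HasRankThree n) :
    (s.card = 2 ∧ t.card = 0) ∨ (s.card = 3 ∧ t.card = 0) ∨ (s.card = 0 ∧ t.card = 3) ∨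
      (s.card = 0 ∧ t.card = 4) ∨ (s.card = 3 ∧ t.card = 1) ∨ (s.card = 1 ∧ t.card = 3) ∨
      (s.card = 2 ∧ t.card = 2) ∨ (s.card = 1 ∧ t.card = 2) ∨ (s.card = 2 ∧ t.card = 1) := by
  classical
  rw [hasRankThree_iff hs ht hn] at h
  have hsum : ∀ u : Finset ℕ, ∑ p ∈ u, (if legSym p 2 = 1 then 2 else 1) =
      u.card + (u.filter fun p => legSym p 2 = 1).card := by
    intro u
    rw [Finset.card_eq_sum_ones, Finset.card_filter, ← Finset.sum_add_distrib]
    exact Finset.sum_congr rfl fun p _ => by split_ifs <;> rfl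
  have h1 := s.card_filter_le fun p => legSym p 2 = 1
  have h2 := t.card_filter_le fun p => legSym p 2 = 1
  rw [hsum, hsum] at h
  have hpos : ∀ u : Finset ℕ, (∃ q ∈ u, legSym q 2 = 1) ↔
      0 < (u.filter fun p => legSym p 2 = 1).card := by
    intro u
    rw [Finset.card_pos, Finset.filter_nonempty_iff]
  have h3 : (∃ p ∈ s, legSym p 2 = 1 ∧ ¬QuartEq p) →
      0 < (s.filter fun p => legSym p 2 = 1).card := by
    rintro ⟨p, hp, h, -⟩
    exact (hpos s).1 ⟨p, hp, h⟩
  simp only [← Finset.card_pos, hpos t] at h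
  split_ifs at h with h4 h5
  · lia
  · rcases h5 with h5 | h5
    · lia
    · have := h3 h5
      lia
  · lia

section

variable {p₁ p₂ p₃ q₁ q₂ q₃ q₄ : ℕ}

theorem hasRankThree_two_zero (hp₁ : p₁.Prime) (hp₂ : p₂.Prime) (h₁ : p₁ % 4 = 1)
    (h₂ : p₂ % 4 = 1) (h₁₂ : p₁ ≠ p₂) :
    HasRankThree (p₁ * p₂) ↔
      (legSym p₁ 2 = 1 ∧ legSym p₂ 2 = 1 ∧ (¬QuartEq p₁ ∨ ¬QuartEq p₂)) ∨
      (legSym p₁ 2 = -1 ∧ legSym p₂ 2 = 1 ∧ QuartEq p₂) ∨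
      (legSym p₂ 2 = -1 ∧ legSym p₁ 2 = 1 ∧ QuartEq p₁) := by
  classical
  rw [hasRankThree_iff (s := {p₁, p₂}) (t := ∅) (by simp [*]) (by simp) (by simp [*])]
  by_cases hQ₁ : QuartEq p₁ <;> by_cases hQ₂ : QuartEq p₂ <;>
  rcases legSym_two_eq_or hp₁ (by lia) with l₁ | l₁ <;>
  rcases legSym_two_eq_or hp₂ (by lia) with l₂ | l₂ <;>
  simp [*]

theorem hasRankThree_three_zero (hp₁ : p₁.Prime) (hp₂ : p₂.Prime) (hp₃ : p₃.Prime)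
    (h₁ : p₁ % 4 = 1) (h₂ : p₂ % 4 = 1) (h₃ : p₃ % 4 = 1) (h₁₂ : p₁ ≠ p₂) (h₁₃ : p₁ ≠ p₃)
    (h₂₃ : p₂ ≠ p₃) :
    HasRankThree (p₁ * p₂ * p₃) ↔
      (legSym p₁ 2 = -1 ∧ legSym p₂ 2 = -1 ∧ legSym p₃ 2 = -1) ∨
      (legSym p₁ 2 = -1 ∧ legSym p₂ 2 = -1 ∧ legSym p₃ 2 = 1 ∧ ¬QuartEq p₃) ∨
      (legSym p₁ 2 = -1 ∧ legSym p₃ 2 = -1 ∧ legSym p₂ 2 = 1 ∧ ¬QuartEq p₂) ∨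
      (legSym p₂ 2 = -1 ∧ legSym p₃ 2 = -1 ∧ legSym p₁ 2 = 1 ∧ ¬QuartEq p₁) := by
  classical
  rw [hasRankThree_iff (s := {p₁, p₂, p₃}) (t := ∅) (by simp [*]) (by simp)
    (by simp [*, mul_assoc])]
  rcases legSym_two_eq_or hp₁ (by lia) with l₁ | l₁ <;>
  rcases legSym_two_eq_or hp₂ (by lia) with l₂ | l₂ <;>
  rcases legSym_two_eq_or hp₃ (by lia) with l₃ | l₃ <;>
  simp [*] <;> split_ifs <;> simp_all

theorem hasRankThree_zero_three (hq₁ : q₁.Prime) (hq₂ : q₂.Prime) (hq₃ : q₃.Prime)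
    (h₁ : q₁ % 4 = 3) (h₂ : q₂ % 4 = 3) (h₃ : q₃ % 4 = 3) (h₁₂ : q₁ ≠ q₂) (h₁₃ : q₁ ≠ q₃)
    (h₂₃ : q₂ ≠ q₃) :
    HasRankThree (q₁ * q₂ * q₃) ↔
      (Finset.filter (fun x : ℕ => legSym x 2 = -1) ({q₁, q₂, q₃} : Finset ℕ)).card = 1 := by
  classical
  rw [hasRankThree_iff (s := ∅) (t := {q₁, q₂, q₃}) (by simp) (by simp [*])
    (by simp [*, mul_assoc])]
  rcases legSym_two_eq_or hq₁ (by lia) with l₁ | l₁ <;>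
  rcases legSym_two_eq_or hq₂ (by lia) with l₂ | l₂ <;>
  rcases legSym_two_eq_or hq₃ (by lia) with l₃ | l₃ <;>
  simp [*, Finset.filter_insert, Finset.filter_singleton]

theorem hasRankThree_zero_four (hq₁ : q₁.Prime) (hq₂ : q₂.Prime) (hq₃ : q₃.Prime)
    (hq₄ : q₄.Prime) (h₁ : q₁ % 4 = 3) (h₂ : q₂ % 4 = 3) (h₃ : q₃ % 4 = 3) (h₄ : q₄ % 4 = 3)
    (h₁₂ : q₁ ≠ q₂) (h₁₃ : q₁ ≠ q₃) (h₁₄ : q₁ ≠ q₄) (h₂₃ : q₂ ≠ q₃) (h₂₄ : q₂ ≠ q₄)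
    (h₃₄ : q₃ ≠ q₄) :
    HasRankThree (q₁ * q₂ * q₃ * q₄) ↔
      (Finset.filter (fun x : ℕ => legSym x 2 = 1) ({q₁, q₂, q₃, q₄} : Finset ℕ)).card ≤ 1 := by
  classical
  rw [hasRankThree_iff (s := ∅) (t := {q₁, q₂, q₃, q₄}) (by simp) (by simp [*])
    (by simp [*, mul_assoc])]
  rcases legSym_two_eq_or hq₁ (by lia) with l₁ | l₁ <;>
  rcases legSym_two_eq_or hq₂ (by lia) with l₂ | l₂ <;>
  rcases legSym_two_eq_or hq₃ (by lia) with l₃ | l₃ <;>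
  rcases legSym_two_eq_or hq₄ (by lia) with l₄ | l₄ <;>
  simp [*, Finset.filter_insert, Finset.filter_singleton]

theorem hasRankThree_three_one (hp₁ : p₁.Prime) (hp₂ : p₂.Prime) (hp₃ : p₃.Prime)
    (h₁ : p₁ % 4 = 1) (h₂ : p₂ % 4 = 1) (h₃ : p₃ % 4 = 1) (h₁₂ : p₁ ≠ p₂) (h₁₃ : p₁ ≠ p₃)
    (h₂₃ : p₂ ≠ p₃) (hq₁ : q₁.Prime) (hm₁ : q₁ % 4 = 3) :
    HasRankThree (p₁ * p₂ * p₃ * q₁) ↔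
      legSym p₁ 2 = -1 ∧ legSym p₂ 2 = -1 ∧ legSym p₃ 2 = -1 := by
  classical
  rw [hasRankThree_iff (s := {p₁, p₂, p₃}) (t := {q₁}) (by simp [*]) (by simp [*])
    (by simp [*, mul_assoc])]
  rcases legSym_two_eq_or hp₁ (by lia) with l₁ | l₁ <;>
  rcases legSym_two_eq_or hp₂ (by lia) with l₂ | l₂ <;>
  rcases legSym_two_eq_or hp₃ (by lia) with l₃ | l₃ <;>
  rcases legSym_two_eq_or hq₁ (by lia) with l₄ | l₄ <;>
  simp [*]

theorem hasRankThree_one_three (hp₁ : p₁.Prime) (hm₁ : p₁ % 4 = 1) (hq₁ : q₁.Prime)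
    (hq₂ : q₂.Prime) (hq₃ : q₃.Prime) (h₁ : q₁ % 4 = 3) (h₂ : q₂ % 4 = 3) (h₃ : q₃ % 4 = 3)
    (h₁₂ : q₁ ≠ q₂) (h₁₃ : q₁ ≠ q₃) (h₂₃ : q₂ ≠ q₃) :
    HasRankThree (p₁ * (q₁ * q₂ * q₃)) ↔ legSym p₁ 2 = -1 ∧
      (Finset.filter (fun x : ℕ => legSym x 2 = 1) ({q₁, q₂, q₃} : Finset ℕ)).card ≤ 1 := by
  classical
  rw [hasRankThree_iff (s := {p₁}) (t := {q₁, q₂, q₃}) (by simp [*]) (by simp [*])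
    (by simp [*, mul_assoc])]
  rcases legSym_two_eq_or hp₁ (by lia) with l₄ | l₄ <;>
  rcases legSym_two_eq_or hq₁ (by lia) with l₁ | l₁ <;>
  rcases legSym_two_eq_or hq₂ (by lia) with l₂ | l₂ <;>
  rcases legSym_two_eq_or hq₃ (by lia) with l₃ | l₃ <;>
  simp [*, Finset.filter_insert, Finset.filter_singleton]

theorem hasRankThree_two_two (hp₁ : p₁.Prime) (hp₂ : p₂.Prime) (h₁ : p₁ % 4 = 1)
    (h₂ : p₂ % 4 = 1) (h₁₂ : p₁ ≠ p₂) (hq₁ : q₁.Prime) (hq₂ : q₂.Prime) (hm₁ : q₁ % 4 = 3)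
    (hm₂ : q₂ % 4 = 3) (hm₁₂ : q₁ ≠ q₂) :
    HasRankThree (p₁ * p₂ * (q₁ * q₂)) ↔ legSym p₁ 2 = -1 ∧ legSym p₂ 2 = -1 ∧
      (legSym q₁ 2 = -1 ∨ legSym q₂ 2 = -1) := by
  classical
  rw [hasRankThree_iff (s := {p₁, p₂}) (t := {q₁, q₂}) (by simp [*]) (by simp [*])
    (by simp [*])]
  rcases legSym_two_eq_or hp₁ (by lia) with l₁ | l₁ <;>
  rcases legSym_two_eq_or hp₂ (by lia) with l₂ | l₂ <;>
  rcases legSym_two_eq_or hq₁ (by lia) with l₃ | l₃ <;>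
  rcases legSym_two_eq_or hq₂ (by lia) with l₄ | l₄ <;>
  simp [*]

theorem hasRankThree_one_two (hp₁ : p₁.Prime) (h₁ : p₁ % 4 = 1) (hq₁ : q₁.Prime)
    (hq₂ : q₂.Prime) (hm₁ : q₁ % 4 = 3) (hm₂ : q₂ % 4 = 3) (hm₁₂ : q₁ ≠ q₂) :
    HasRankThree (p₁ * (q₁ * q₂)) ↔
      (legSym p₁ 2 = 1 ∧ (legSym q₁ 2 = -1 ∨ legSym q₂ 2 = -1)) ∨
      (legSym p₁ 2 = -1 ∧ legSym q₁ 2 = 1 ∧ legSym q₂ 2 = 1) := by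
  classical
  rw [hasRankThree_iff (s := {p₁}) (t := {q₁, q₂}) (by simp [*]) (by simp [*]) (by simp [*])]
  rcases legSym_two_eq_or hp₁ (by lia) with l₁ | l₁ <;>
  rcases legSym_two_eq_or hq₁ (by lia) with l₃ | l₃ <;>
  rcases legSym_two_eq_or hq₂ (by lia) with l₄ | l₄ <;>
  simp [*]

theorem hasRankThree_two_one (hp₁ : p₁.Prime) (hp₂ : p₂.Prime) (h₁ : p₁ % 4 = 1)
    (h₂ : p₂ % 4 = 1) (h₁₂ : p₁ ≠ p₂) (hq₁ : q₁.Prime) (hm₁ : q₁ % 4 = 3) :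
    HasRankThree (p₁ * p₂ * q₁) ↔ legSym p₁ 2 ≠ legSym p₂ 2 := by
  classical
  rw [hasRankThree_iff (s := {p₁, p₂}) (t := {q₁}) (by simp [*]) (by simp [*]) (by simp [*])]
  rcases legSym_two_eq_or hp₁ (by lia) with l₁ | l₁ <;>
  rcases legSym_two_eq_or hp₂ (by lia) with l₂ | l₂ <;>
  rcases legSym_two_eq_or hq₁ (by lia) with l₃ | l₃ <;>
  simp [*]

end

theorem twoTorsCard_eq_eight_iff {n : ℕ} (hodd : Odd n) (hsq : Squarefree n)
    {K : IntermediateField ℚ ℝ} [NumberField K]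
    (hK : K = IntermediateField.adjoin ℚ {QuarticOrder.root n}) :
    twoTorsCard K = 2 ^ 3 ↔ HasRankThree n := by
  have h := QuarticOrder.card_classGroup_two_torsion hodd hsq hK
  rw [HasRankThree, ← (Nat.pow_right_injective le_rfl).eq_iff (a := ∑ p ∈ n.primeFactors, _),
    ← h, pow_add, Nat.mul_left_inj (by positivity)]
  rfl

/-- `n` odd squarefree positive, `𝕂 = ℚ(√(n·(1+√2)·√2))`.
One has `r₂(H) = 3` (i.e. the 2-torsion of the class group has exactly `2³ = 8`
elements) iff `n` has one of the nine listed forms (`p, p₁, p₂, p₃` distinct primes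
`≡ 1 (mod 4)`, `q, q₁, …, q₄` distinct primes `≡ 3 (mod 4)`; "for some ordering"
clauses are absorbed by the symmetric existential quantifiers). -/
theorem stmt_19
    (n : ℕ) (hnodd : Odd n) (hnsq : Squarefree n) (hn0 : 0 < n)
    (K : IntermediateField ℚ ℝ)
    (hK : K = IntermediateField.adjoin ℚ
      ({Real.sqrt ((n : ℝ) * ((1 : ℝ) + Real.sqrt 2) * Real.sqrt 2)} : Set ℝ))
    [NumberField K] :
    twoTorsCard K = 2 ^ 3 ↔
      ((∃ p₁ p₂ : ℕ, p₁.Prime ∧ p₂.Prime ∧ p₁ % 4 = 1 ∧ p₂ % 4 = 1 ∧ p₁ ≠ p₂ ∧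
          n = p₁ * p₂ ∧
          ((legSym p₁ 2 = 1 ∧ legSym p₂ 2 = 1 ∧
              (quartSym p₁ 2 ≠ (-1 : ℤ) ^ ((p₁ - 1) / 8) ∨
                quartSym p₂ 2 ≠ (-1 : ℤ) ^ ((p₂ - 1) / 8))) ∨
            (legSym p₁ 2 = -1 ∧ legSym p₂ 2 = 1 ∧
              quartSym p₂ 2 = (-1 : ℤ) ^ ((p₂ - 1) / 8)))) ∨
        (∃ p₁ p₂ p₃ : ℕ, p₁.Prime ∧ p₂.Prime ∧ p₃.Prime ∧
          p₁ % 4 = 1 ∧ p₂ % 4 = 1 ∧ p₃ % 4 = 1 ∧ p₁ ≠ p₂ ∧ p₁ ≠ p₃ ∧ p₂ ≠ p₃ ∧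
          n = p₁ * p₂ * p₃ ∧
          ((legSym p₁ 2 = -1 ∧ legSym p₂ 2 = -1 ∧ legSym p₃ 2 = -1) ∨
            (legSym p₁ 2 = -1 ∧ legSym p₂ 2 = -1 ∧ legSym p₃ 2 = 1 ∧
              quartSym p₃ 2 ≠ (-1 : ℤ) ^ ((p₃ - 1) / 8)))) ∨
        (∃ q₁ q₂ q₃ : ℕ, q₁.Prime ∧ q₂.Prime ∧ q₃.Prime ∧
          q₁ % 4 = 3 ∧ q₂ % 4 = 3 ∧ q₃ % 4 = 3 ∧ q₁ ≠ q₂ ∧ q₁ ≠ q₃ ∧ q₂ ≠ q₃ ∧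
          n = q₁ * q₂ * q₃ ∧
          (Finset.filter (fun x : ℕ => legSym x 2 = -1)
            ({q₁, q₂, q₃} : Finset ℕ)).card = 1) ∨
        (∃ q₁ q₂ q₃ q₄ : ℕ, q₁.Prime ∧ q₂.Prime ∧ q₃.Prime ∧ q₄.Prime ∧
          q₁ % 4 = 3 ∧ q₂ % 4 = 3 ∧ q₃ % 4 = 3 ∧ q₄ % 4 = 3 ∧
          q₁ ≠ q₂ ∧ q₁ ≠ q₃ ∧ q₁ ≠ q₄ ∧ q₂ ≠ q₃ ∧ q₂ ≠ q₄ ∧ q₃ ≠ q₄ ∧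
          n = q₁ * q₂ * q₃ * q₄ ∧
          (Finset.filter (fun x : ℕ => legSym x 2 = 1)
            ({q₁, q₂, q₃, q₄} : Finset ℕ)).card ≤ 1) ∨
        (∃ p₁ p₂ p₃ q : ℕ, p₁.Prime ∧ p₂.Prime ∧ p₃.Prime ∧
          p₁ % 4 = 1 ∧ p₂ % 4 = 1 ∧ p₃ % 4 = 1 ∧ p₁ ≠ p₂ ∧ p₁ ≠ p₃ ∧ p₂ ≠ p₃ ∧
          q.Prime ∧ q % 4 = 3 ∧ n = p₁ * p₂ * p₃ * q ∧
          legSym p₁ 2 = -1 ∧ legSym p₂ 2 = -1 ∧ legSym p₃ 2 = -1) ∨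
        (∃ p q₁ q₂ q₃ : ℕ, p.Prime ∧ p % 4 = 1 ∧
          q₁.Prime ∧ q₂.Prime ∧ q₃.Prime ∧
          q₁ % 4 = 3 ∧ q₂ % 4 = 3 ∧ q₃ % 4 = 3 ∧ q₁ ≠ q₂ ∧ q₁ ≠ q₃ ∧ q₂ ≠ q₃ ∧
          n = p * (q₁ * q₂ * q₃) ∧ legSym p 2 = -1 ∧
          (Finset.filter (fun x : ℕ => legSym x 2 = 1)
            ({q₁, q₂, q₃} : Finset ℕ)).card ≤ 1) ∨
        (∃ p₁ p₂ q₁ q₂ : ℕ, p₁.Prime ∧ p₂.Prime ∧ p₁ % 4 = 1 ∧ p₂ % 4 = 1 ∧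
          p₁ ≠ p₂ ∧ q₁.Prime ∧ q₂.Prime ∧ q₁ % 4 = 3 ∧ q₂ % 4 = 3 ∧ q₁ ≠ q₂ ∧
          n = p₁ * p₂ * (q₁ * q₂) ∧ legSym p₁ 2 = -1 ∧ legSym p₂ 2 = -1 ∧
          (legSym q₁ 2 = -1 ∨ legSym q₂ 2 = -1)) ∨
        (∃ p q₁ q₂ : ℕ, p.Prime ∧ p % 4 = 1 ∧ q₁.Prime ∧ q₂.Prime ∧
          q₁ % 4 = 3 ∧ q₂ % 4 = 3 ∧ q₁ ≠ q₂ ∧ n = p * (q₁ * q₂) ∧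
          ((legSym p 2 = 1 ∧ (legSym q₁ 2 = -1 ∨ legSym q₂ 2 = -1)) ∨
            (legSym p 2 = -1 ∧ legSym q₁ 2 = 1 ∧ legSym q₂ 2 = 1))) ∨
        (∃ p₁ p₂ q : ℕ, p₁.Prime ∧ p₂.Prime ∧ p₁ % 4 = 1 ∧ p₂ % 4 = 1 ∧ p₁ ≠ p₂ ∧
          q.Prime ∧ q % 4 = 3 ∧ n = p₁ * p₂ * q ∧
          legSym p₁ 2 ≠ legSym p₂ 2)) := by
  rw [twoTorsCard_eq_eight_iff hnodd hnsq hK]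
  constructor
  · intro h
    set s := n.primeFactors.filter fun p => p % 4 = 1 with hs_def
    set t := n.primeFactors.filter fun p => ¬p % 4 = 1 with ht_def
    have hs : ∀ p ∈ s, p.Prime ∧ p % 4 = 1 := fun p hp => by
      rw [hs_def, Finset.mem_filter] at hp
      exact ⟨Nat.prime_of_mem_primeFactors hp.1, hp.2⟩
    have ht : ∀ q ∈ t, q.Prime ∧ q % 4 = 3 := fun q hq => by
      rw [ht_def, Finset.mem_filter] at hq
      have := Zsqrtd.odd_of_mem_primeFactors hnodd hq.1
      exact ⟨Nat.prime_of_mem_primeFactors hq.1, by lia⟩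
    have hn : n = (∏ p ∈ s, p) * ∏ q ∈ t, q := by
      rw [Finset.prod_filter_mul_prod_filter_not, Nat.prod_primeFactors_of_squarefree hnsq]
    clear_value s t
    rcases HasRankThree.card_cases hs ht hn h with ⟨hcs, hct⟩ | ⟨hcs, hct⟩ | ⟨hcs, hct⟩ |
      ⟨hcs, hct⟩ | ⟨hcs, hct⟩ | ⟨hcs, hct⟩ | ⟨hcs, hct⟩ | ⟨hcs, hct⟩ | ⟨hcs, hct⟩
    · obtain ⟨p₁, p₂, h₁₂, rfl⟩ := Finset.card_eq_two.1 hcs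
      obtain rfl := Finset.card_eq_zero.1 hct
      obtain ⟨⟨hp₁, h₁⟩, hp₂, h₂⟩ : (p₁.Prime ∧ p₁ % 4 = 1) ∧ p₂.Prime ∧ p₂ % 4 = 1 := by
        simpa using hs
      replace hn : n = p₁ * p₂ := by simpa [h₁₂] using hn
      rw [hn, hasRankThree_two_zero hp₁ hp₂ h₁ h₂ h₁₂] at h
      refine Or.inl ?_
      rcases h with h | h | h
      · exact ⟨p₁, p₂, hp₁, hp₂, h₁, h₂, h₁₂, hn, Or.inl h⟩
      · exact ⟨p₁, p₂, hp₁, hp₂, h₁, h₂, h₁₂, hn, Or.inr h⟩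
      · exact ⟨p₂, p₁, hp₂, hp₁, h₂, h₁, h₁₂.symm, hn.trans (mul_comm _ _), Or.inr h⟩
    · obtain ⟨p₁, p₂, p₃, h₁₂, h₁₃, h₂₃, rfl⟩ := Finset.card_eq_three.1 hcs
      obtain rfl := Finset.card_eq_zero.1 hct
      obtain ⟨⟨hp₁, h₁⟩, ⟨hp₂, h₂⟩, hp₃, h₃⟩ :
          (p₁.Prime ∧ p₁ % 4 = 1) ∧ (p₂.Prime ∧ p₂ % 4 = 1) ∧ p₃.Prime ∧ p₃ % 4 = 1 := by
        simpa using hs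
      replace hn : n = p₁ * p₂ * p₃ := by simpa [h₁₂, h₁₃, h₂₃, mul_assoc] using hn
      rw [hn, hasRankThree_three_zero hp₁ hp₂ hp₃ h₁ h₂ h₃ h₁₂ h₁₃ h₂₃] at h
      refine Or.inr (Or.inl ?_)
      rcases h with h | h | h | h
      · exact ⟨p₁, p₂, p₃, hp₁, hp₂, hp₃, h₁, h₂, h₃, h₁₂, h₁₃, h₂₃, hn, Or.inl h⟩
      · exact ⟨p₁, p₂, p₃, hp₁, hp₂, hp₃, h₁, h₂, h₃, h₁₂, h₁₃, h₂₃, hn, Or.inr h⟩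
      · exact ⟨p₁, p₃, p₂, hp₁, hp₃, hp₂, h₁, h₃, h₂, h₁₃, h₁₂, h₂₃.symm,
          hn.trans (by ring), Or.inr h⟩
      · exact ⟨p₂, p₃, p₁, hp₂, hp₃, hp₁, h₂, h₃, h₁, h₂₃, h₁₂.symm, h₁₃.symm,
          hn.trans (by ring), Or.inr h⟩
    · obtain rfl := Finset.card_eq_zero.1 hcs
      obtain ⟨q₁, q₂, q₃, h₁₂, h₁₃, h₂₃, rfl⟩ := Finset.card_eq_three.1 hct
      obtain ⟨⟨hq₁, h₁⟩, ⟨hq₂, h₂⟩, hq₃, h₃⟩ :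
          (q₁.Prime ∧ q₁ % 4 = 3) ∧ (q₂.Prime ∧ q₂ % 4 = 3) ∧ q₃.Prime ∧ q₃ % 4 = 3 := by
        simpa using ht
      replace hn : n = q₁ * q₂ * q₃ := by simpa [h₁₂, h₁₃, h₂₃, mul_assoc] using hn
      rw [hn, hasRankThree_zero_three hq₁ hq₂ hq₃ h₁ h₂ h₃ h₁₂ h₁₃ h₂₃] at h
      exact Or.inr (Or.inr (Or.inl
        ⟨q₁, q₂, q₃, hq₁, hq₂, hq₃, h₁, h₂, h₃, h₁₂, h₁₃, h₂₃, hn, h⟩))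
    · obtain rfl := Finset.card_eq_zero.1 hcs
      obtain ⟨q₁, q₂, q₃, q₄, h₁₂, h₁₃, h₁₄, h₂₃, h₂₄, h₃₄, rfl⟩ := Finset.card_eq_four.1 hct
      obtain ⟨⟨hq₁, h₁⟩, ⟨hq₂, h₂⟩, ⟨hq₃, h₃⟩, hq₄, h₄⟩ : (q₁.Prime ∧ q₁ % 4 = 3) ∧
          (q₂.Prime ∧ q₂ % 4 = 3) ∧ (q₃.Prime ∧ q₃ % 4 = 3) ∧ q₄.Prime ∧ q₄ % 4 = 3 := by
        simpa using ht
      replace hn : n = q₁ * q₂ * q₃ * q₄ := by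
        simpa [h₁₂, h₁₃, h₁₄, h₂₃, h₂₄, h₃₄, mul_assoc] using hn
      rw [hn, hasRankThree_zero_four hq₁ hq₂ hq₃ hq₄ h₁ h₂ h₃ h₄ h₁₂ h₁₃ h₁₄ h₂₃ h₂₄ h₃₄] at h
      exact Or.inr (Or.inr (Or.inr (Or.inl ⟨q₁, q₂, q₃, q₄, hq₁, hq₂, hq₃, hq₄, h₁, h₂, h₃, h₄,
        h₁₂, h₁₃, h₁₄, h₂₃, h₂₄, h₃₄, hn, h⟩)))
    · obtain ⟨p₁, p₂, p₃, h₁₂, h₁₃, h₂₃, rfl⟩ := Finset.card_eq_three.1 hcs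
      obtain ⟨q, rfl⟩ := Finset.card_eq_one.1 hct
      obtain ⟨⟨hp₁, h₁⟩, ⟨hp₂, h₂⟩, hp₃, h₃⟩ :
          (p₁.Prime ∧ p₁ % 4 = 1) ∧ (p₂.Prime ∧ p₂ % 4 = 1) ∧ p₃.Prime ∧ p₃ % 4 = 1 := by
        simpa using hs
      obtain ⟨hq, hm⟩ : q.Prime ∧ q % 4 = 3 := by simpa using ht
      replace hn : n = p₁ * p₂ * p₃ * q := by simpa [h₁₂, h₁₃, h₂₃, mul_assoc] using hn
      rw [hn, hasRankThree_three_one hp₁ hp₂ hp₃ h₁ h₂ h₃ h₁₂ h₁₃ h₂₃ hq hm] at h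
      exact Or.inr (Or.inr (Or.inr (Or.inr (Or.inl ⟨p₁, p₂, p₃, q, hp₁, hp₂, hp₃, h₁, h₂, h₃,
        h₁₂, h₁₃, h₂₃, hq, hm, hn, h⟩))))
    · obtain ⟨p, rfl⟩ := Finset.card_eq_one.1 hcs
      obtain ⟨q₁, q₂, q₃, h₁₂, h₁₃, h₂₃, rfl⟩ := Finset.card_eq_three.1 hct
      obtain ⟨⟨hq₁, h₁⟩, ⟨hq₂, h₂⟩, hq₃, h₃⟩ :
          (q₁.Prime ∧ q₁ % 4 = 3) ∧ (q₂.Prime ∧ q₂ % 4 = 3) ∧ q₃.Prime ∧ q₃ % 4 = 3 := by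
        simpa using ht
      obtain ⟨hp, hm⟩ : p.Prime ∧ p % 4 = 1 := by simpa using hs
      replace hn : n = p * (q₁ * q₂ * q₃) := by simpa [h₁₂, h₁₃, h₂₃, mul_assoc] using hn
      rw [hn, hasRankThree_one_three hp hm hq₁ hq₂ hq₃ h₁ h₂ h₃ h₁₂ h₁₃ h₂₃] at h
      exact Or.inr (Or.inr (Or.inr (Or.inr (Or.inr (Or.inl ⟨p, q₁, q₂, q₃, hp, hm, hq₁, hq₂, hq₃,
        h₁, h₂, h₃, h₁₂, h₁₃, h₂₃, hn, h⟩)))))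
    · obtain ⟨p₁, p₂, h₁₂, rfl⟩ := Finset.card_eq_two.1 hcs
      obtain ⟨q₁, q₂, hm₁₂, rfl⟩ := Finset.card_eq_two.1 hct
      obtain ⟨⟨hp₁, h₁⟩, hp₂, h₂⟩ : (p₁.Prime ∧ p₁ % 4 = 1) ∧ p₂.Prime ∧ p₂ % 4 = 1 := by
        simpa using hs
      obtain ⟨⟨hq₁, hm₁⟩, hq₂, hm₂⟩ : (q₁.Prime ∧ q₁ % 4 = 3) ∧ q₂.Prime ∧ q₂ % 4 = 3 := by
        simpa using ht
      replace hn : n = p₁ * p₂ * (q₁ * q₂) := by simpa [h₁₂, hm₁₂] using hn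
      rw [hn, hasRankThree_two_two hp₁ hp₂ h₁ h₂ h₁₂ hq₁ hq₂ hm₁ hm₂ hm₁₂] at h
      exact Or.inr (Or.inr (Or.inr (Or.inr (Or.inr (Or.inr (Or.inl ⟨p₁, p₂, q₁, q₂, hp₁, hp₂,
        h₁, h₂, h₁₂, hq₁, hq₂, hm₁, hm₂, hm₁₂, hn, h⟩))))))
    · obtain ⟨p, rfl⟩ := Finset.card_eq_one.1 hcs
      obtain ⟨q₁, q₂, hm₁₂, rfl⟩ := Finset.card_eq_two.1 hct
      obtain ⟨hp, h₁⟩ : p.Prime ∧ p % 4 = 1 := by simpa using hs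
      obtain ⟨⟨hq₁, hm₁⟩, hq₂, hm₂⟩ : (q₁.Prime ∧ q₁ % 4 = 3) ∧ q₂.Prime ∧ q₂ % 4 = 3 := by
        simpa using ht
      replace hn : n = p * (q₁ * q₂) := by simpa [hm₁₂] using hn
      rw [hn, hasRankThree_one_two hp h₁ hq₁ hq₂ hm₁ hm₂ hm₁₂] at h
      exact Or.inr (Or.inr (Or.inr (Or.inr (Or.inr (Or.inr (Or.inr (Or.inl ⟨p, q₁, q₂, hp, h₁,
        hq₁, hq₂, hm₁, hm₂, hm₁₂, hn, h⟩)))))))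
    · obtain ⟨p₁, p₂, h₁₂, rfl⟩ := Finset.card_eq_two.1 hcs
      obtain ⟨q, rfl⟩ := Finset.card_eq_one.1 hct
      obtain ⟨⟨hp₁, h₁⟩, hp₂, h₂⟩ : (p₁.Prime ∧ p₁ % 4 = 1) ∧ p₂.Prime ∧ p₂ % 4 = 1 := by
        simpa using hs
      obtain ⟨hq, hm⟩ : q.Prime ∧ q % 4 = 3 := by simpa using ht
      replace hn : n = p₁ * p₂ * q := by simpa [h₁₂] using hn
      rw [hn, hasRankThree_two_one hp₁ hp₂ h₁ h₂ h₁₂ hq hm] at h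
      exact Or.inr (Or.inr (Or.inr (Or.inr (Or.inr (Or.inr (Or.inr (Or.inr ⟨p₁, p₂, q, hp₁, hp₂,
        h₁, h₂, h₁₂, hq, hm, hn, h⟩)))))))
  · rintro (⟨p₁, p₂, hp₁, hp₂, h₁, h₂, h₁₂, rfl, h⟩ |
      ⟨p₁, p₂, p₃, hp₁, hp₂, hp₃, h₁, h₂, h₃, h₁₂, h₁₃, h₂₃, rfl, h⟩ |
      ⟨q₁, q₂, q₃, hq₁, hq₂, hq₃, h₁, h₂, h₃, h₁₂, h₁₃, h₂₃, rfl, h⟩ |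
      ⟨q₁, q₂, q₃, q₄, hq₁, hq₂, hq₃, hq₄, h₁, h₂, h₃, h₄, h₁₂, h₁₃, h₁₄, h₂₃, h₂₄, h₃₄, rfl, h⟩ |
      ⟨p₁, p₂, p₃, q, hp₁, hp₂, hp₃, h₁, h₂, h₃, h₁₂, h₁₃, h₂₃, hq, hm, rfl, h⟩ |
      ⟨p, q₁, q₂, q₃, hp, hm, hq₁, hq₂, hq₃, h₁, h₂, h₃, h₁₂, h₁₃, h₂₃, rfl, h⟩ |
      ⟨p₁, p₂, q₁, q₂, hp₁, hp₂, h₁, h₂, h₁₂, hq₁, hq₂, hm₁, hm₂, hm₁₂, rfl, h⟩ |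
      ⟨p, q₁, q₂, hp, h₁, hq₁, hq₂, hm₁, hm₂, hm₁₂, rfl, h⟩ |
      ⟨p₁, p₂, q, hp₁, hp₂, h₁, h₂, h₁₂, hq, hm, rfl, h⟩)
    · exact (hasRankThree_two_zero hp₁ hp₂ h₁ h₂ h₁₂).2 (h.imp_right Or.inl)
    · exact (hasRankThree_three_zero hp₁ hp₂ hp₃ h₁ h₂ h₃ h₁₂ h₁₃ h₂₃).2 (h.imp_right Or.inl)
    · exact (hasRankThree_zero_three hq₁ hq₂ hq₃ h₁ h₂ h₃ h₁₂ h₁₃ h₂₃).2 h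
    · exact (hasRankThree_zero_four hq₁ hq₂ hq₃ hq₄ h₁ h₂ h₃ h₄ h₁₂ h₁₃ h₁₄ h₂₃ h₂₄ h₃₄).2 h
    · exact (hasRankThree_three_one hp₁ hp₂ hp₃ h₁ h₂ h₃ h₁₂ h₁₃ h₂₃ hq hm).2 h
    · exact (hasRankThree_one_three hp hm hq₁ hq₂ hq₃ h₁ h₂ h₃ h₁₂ h₁₃ h₂₃).2 h
    · exact (hasRankThree_two_two hp₁ hp₂ h₁ h₂ h₁₂ hq₁ hq₂ hm₁ hm₂ hm₁₂).2 h
    · exact (hasRankThree_one_two hp h₁ hq₁ hq₂ hm₁ hm₂ hm₁₂).2 h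
    · exact (hasRankThree_two_one hp₁ hp₂ h₁ h₂ h₁₂ hq hm).2 h
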